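/- Let F(X) = a₀Xⁿ + a₁Xⁿ⁻¹ + ⋯ + aₙ ∈ 𝓞_S[X] have degree n ≥ 2 and nonzero discriminant, let δ ∈ 𝓞_S ∖ {0}, and let m ≥ 3 be an integer. Then every solution x, y ∈ 𝓞_S of F(x) = δ y^m satisfies h(x), h(y) ≤ c₃^{m³}·|Δ_L|^{2m²n²}·Q^{3m²n²}·e^{8m²n³·d_L·ĥ}, where c₃ := (6ns)^{14n³s} and ĥ := Σ_{v ∈ 𝓜_L} d_v·log max(1, |δ|_v, |a₀|_v,…,|aₙ|_v). -/

import Mathlib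

open scoped BigOperators Classical NumberField

open NumberField IsDedekindDomain

noncomputable section

/-- The order of vanishing `ord_v(x) ∈ ℤ` of `x ∈ L` at a finite place (nonzero prime) `v`
of the ring of integers of `L`, with the convention `ord_v(0) = 0`. -/
noncomputable def ordAt {L : Type*} [Field L] [NumberField L]
    (v : HeightOneSpectrum (𝓞 L)) (x : L) : ℤ :=
  if hx : x = 0 then 0
  else -Multiplicative.toAdd (WithZero.unzero
    ((Valuation.ne_zero_iff (v.valuation (K := L))).mpr hx))

/-- The absolute logarithmic Weil height of an element of a number field `L`:
`h(x) = (1/[L:ℚ]) ( ∑_{w | ∞} mult(w) log⁺ w(x) + ∑_{v fin} max(0, -ord_v x) log N(v) )`. -/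
noncomputable def wHeight {L : Type*} [Field L] [NumberField L] (x : L) : ℝ :=
  ((∑ w : InfinitePlace L, (w.mult : ℝ) * Real.log (max 1 (w x))) +
    ∑ᶠ v : HeightOneSpectrum (𝓞 L),
      ((max 0 (-(ordAt v x)) : ℤ) : ℝ) * Real.log (Ideal.absNorm v.asIdeal)) /
    (Module.finrank ℚ L)
/-- The `(2n-2) × (2n-2)` matrix whose determinant is (up to sign) the discriminant of the
binary form `a₀ Xⁿ + a₁ Xⁿ⁻¹ Y + ⋯ + aₙ Yⁿ` (equivalently, of the polynomial
`a₀ Xⁿ + ⋯ + aₙ`). -/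
def discMat {R : Type*} [CommRing R] (n : ℕ) (a : ℕ → R) :
    Matrix (Fin (2*n-2)) (Fin (2*n-2)) R := fun i j =>
  if (i : ℕ) < n - 2 then
    (if (i : ℕ) ≤ (j : ℕ) ∧ (j : ℕ) ≤ (i : ℕ) + n then a ((j : ℕ) - (i : ℕ)) else 0)
  else if (i : ℕ) = n - 2 then
    (if (j : ℕ) + 1 ≤ n then (((j : ℕ) + 1 : ℕ) : R) * a ((j : ℕ) + 1) else 0)
  else
    (if (i : ℕ) - (n - 1) ≤ (j : ℕ) ∧ (j : ℕ) ≤ (i : ℕ) - (n - 1) + (n - 1)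
      then ((n - ((j : ℕ) - ((i : ℕ) - (n - 1))) : ℕ) : R) * a ((j : ℕ) - ((i : ℕ) - (n - 1)))
      else 0)

/-- The discriminant of the binary form (or polynomial) with coefficients `a 0, …, a n`. -/
noncomputable def binDisc {R : Type*} [CommRing R] (n : ℕ) (a : ℕ → R) : R := (discMat n a).det

/-- `ĥ = ∑_v d_v log max(1, |δ|_v, |a₀|_v, …, |aₙ|_v)`, the height of the coefficient tuple
of `δ` and `F = a₀ Xⁿ + ⋯ + aₙ`. -/
noncomputable def hhat {L : Type*} [Field L] [NumberField L] (n : ℕ) (δ : L) (a : ℕ → L) : ℝ :=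
  ((∑ w : InfinitePlace L, (w.mult : ℝ) *
      Real.log (max 1 (max (w δ)
        ((Finset.range (n + 1)).sup'
          (Finset.nonempty_range_iff.mpr (Nat.succ_ne_zero n)) fun j => w (a j))))) +
    ∑ᶠ v : HeightOneSpectrum (𝓞 L),
      ((max 0 (-(min (ordAt v δ)
        ((Finset.range (n + 1)).inf'
          (Finset.nonempty_range_iff.mpr (Nat.succ_ne_zero n)) fun j => ordAt v (a j)))) : ℤ) : ℝ) *
        Real.log (Ideal.absNorm v.asIdeal)) / (Module.finrank ℚ L)

namespace SuperElliptic

set_option linter.unusedSectionVars false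

section

variable {K : Type*} [Field K] [NumberField K]

variable (K) in
/-- The places of a number field. -/
abbrev Pl := InfinitePlace K ⊕ HeightOneSpectrum (𝓞 K)

/-- The absolute value attached to a place (adic ones are normalised by the norm). -/
def ab : Pl K → AbsoluteValue K ℝ
  | .inl w => w.1
  | .inr v => NumberField.HeightOneSpectrum.adicAbv K v

/-- The exponent turning `ab` into the normalised absolute value. -/
def ex : Pl K → ℕ
  | .inl w => w.mult
  | .inr _ => 1

/-- The local degree at an infinite place, and `0` at a finite place. -/
def cc : Pl K → ℕ
  | .inl w => w.mult
  | .inr _ => 0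

/-- The normalised multiplicative value at a place (satisfying the product formula). -/
def av (v : Pl K) : K →*₀ ℝ :=
  { toFun := fun x => ab v x ^ ex v
    map_zero' := by
      have : ex v ≠ 0 := by
        cases v with
        | inl w => exact w.mult_ne_zero
        | inr _ => exact one_ne_zero
      simp [this]
    map_one' := by simp
    map_mul' := fun x y => by simp [mul_pow] }

lemma av_def (v : Pl K) (x : K) : av v x = ab v x ^ ex v := rfl

lemma av_nonneg (v : Pl K) (x : K) : 0 ≤ av v x := pow_nonneg ((ab v).nonneg x) _

lemma av_pos (v : Pl K) {x : K} (hx : x ≠ 0) : 0 < av v x := pow_pos ((ab v).pos hx) _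

lemma av_ne (v : Pl K) {x : K} (hx : x ≠ 0) : av v x ≠ 0 := (av_pos v hx).ne'

lemma av_neg (v : Pl K) (x : K) : av v (-x) = av v x := by
  rw [av_def, av_def, (ab v).map_neg]

lemma av_sub_comm (v : Pl K) (x y : K) : av v (x - y) = av v (y - x) := by
  rw [← av_neg, neg_sub]

lemma log_av_mul (v : Pl K) {x y : K} (hx : x ≠ 0) (hy : y ≠ 0) :
    Real.log (av v (x * y)) = Real.log (av v x) + Real.log (av v y) := by
  rw [map_mul, Real.log_mul (av_ne v hx) (av_ne v hy)]

lemma log_av_div (v : Pl K) {x y : K} (hx : x ≠ 0) (hy : y ≠ 0) :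
    Real.log (av v (x / y)) = Real.log (av v x) - Real.log (av v y) := by
  rw [map_div₀, Real.log_div (av_ne v hx) (av_ne v hy)]

lemma log_av_pow (v : Pl K) (x : K) (n : ℕ) :
    Real.log (av v (x ^ n)) = n * Real.log (av v x) := by
  rw [map_pow, Real.log_pow]

lemma log_av_inv (v : Pl K) (x : K) :
    Real.log (av v x⁻¹) = - Real.log (av v x) := by
  rw [map_inv₀, Real.log_inv]

lemma log_av_eq (v : Pl K) (x : K) : Real.log (av v x) = ex v * Real.log (ab v x) := by
  rw [av_def, Real.log_pow]

/-- Ultrametric or triangle inequality in uniform shape. -/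
lemma av_sum_le (v : Pl K) {ι : Type*} (s : Finset ι) (f : ι → K) {B : ℝ} (hB : 0 ≤ B)
    (h : ∀ i ∈ s, av v (f i) ≤ B) : av v (∑ i ∈ s, f i) ≤ (s.card : ℝ) ^ cc v * B := by
  cases v with
  | inl w =>
    have hm : w.mult ≠ 0 := w.mult_ne_zero
    have h1 : ∀ i ∈ s, w (f i) ≤ B ^ ((w.mult : ℝ)⁻¹) := by
      intro i hi
      have := h i hi
      change w (f i) ^ w.mult ≤ B at this
      rw [← Real.pow_rpow_inv_natCast (x := w (f i)) (by positivity) hm]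
      exact Real.rpow_le_rpow (by positivity) this (by positivity)
    change w (∑ i ∈ s, f i) ^ w.mult ≤ (s.card : ℝ) ^ w.mult * B
    have h2 : w (∑ i ∈ s, f i) ≤ s.card * B ^ ((w.mult : ℝ)⁻¹) := by
      calc w (∑ i ∈ s, f i) ≤ ∑ i ∈ s, w (f i) := w.1.sum_le s f
        _ ≤ ∑ i ∈ s, B ^ ((w.mult : ℝ)⁻¹) := Finset.sum_le_sum h1
        _ = _ := by simp
    calc w (∑ i ∈ s, f i) ^ w.mult ≤ (s.card * B ^ ((w.mult : ℝ)⁻¹)) ^ w.mult :=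
          pow_le_pow_left₀ (by positivity) h2 _
      _ = _ := by rw [mul_pow, Real.rpow_inv_natCast_pow hB hm]
  | inr p =>
    simp only [cc, pow_zero, one_mul]
    induction s using Finset.induction_on with
    | empty => simpa using hB
    | insert a s ha ih =>
      rw [Finset.sum_insert ha]
      have h1 := NumberField.HeightOneSpectrum.adicAbv_add_le_max K p (f a) (∑ i ∈ s, f i)
      simp only [av_def, ab, ex, pow_one] at h ih ⊢
      have := ih (fun i hi => h i (Finset.mem_insert_of_mem hi))
      exact h1.trans (max_le (h a (Finset.mem_insert_self _ _)) this)

lemma av_add_le (v : Pl K) (x y : K) {B : ℝ} (hx : av v x ≤ B) (hy : av v y ≤ B) :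
    av v (x + y) ≤ 2 ^ cc v * B := by
  have := av_sum_le v (Finset.univ : Finset (Fin 2)) ![x, y] ((av_nonneg v x).trans hx) (by
    intro i _; fin_cases i <;> simpa)
  simpa using this

lemma av_sub_le (v : Pl K) (x y : K) {B : ℝ} (hx : av v x ≤ B) (hy : av v y ≤ B) :
    av v (x - y) ≤ 2 ^ cc v * B := by
  rw [sub_eq_add_neg]
  exact av_add_le v x (-y) hx (by rwa [av_neg])

lemma av_natCast_le (v : Pl K) (n : ℕ) : av v (n : K) ≤ (n : ℝ) ^ cc v := by
  cases v with
  | inl w =>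
    change w (n : K) ^ w.mult ≤ (n : ℝ) ^ w.mult
    simp
  | inr p =>
    simp only [av_def, ab, ex, cc, pow_one, pow_zero]
    exact NumberField.HeightOneSpectrum.adicAbv_natCast_le_one K p n

lemma av_intCast_le (v : Pl K) (n : ℤ) {B : ℝ} (hB : |(n : ℝ)| ≤ B) :
    av v (n : K) ≤ B ^ cc v := by
  have h0 : av v (n : K) = av v ((n.natAbs : ℕ) : K) := by
    rcases Int.natAbs_eq n with h | h
    · conv_lhs => rw [h]
      simp
    · conv_lhs => rw [h]
      rw [Int.cast_neg, av_neg, Int.cast_natCast]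
  rw [h0]
  refine (av_natCast_le v _).trans (pow_le_pow_left₀ (by positivity) ?_ _)
  rwa [Nat.cast_natAbs, Int.cast_abs]

lemma one_lt_norm (p : HeightOneSpectrum (𝓞 K)) : (1 : ℝ) < Ideal.absNorm p.asIdeal := by
  exact_mod_cast NumberField.HeightOneSpectrum.one_lt_absNorm p

lemma log_norm_pos (p : HeightOneSpectrum (𝓞 K)) : 0 < Real.log (Ideal.absNorm p.asIdeal) :=
  Real.log_pos (one_lt_norm p)

lemma valuation_eq_exp (p : HeightOneSpectrum (𝓞 K)) {x : K} (hx : x ≠ 0) :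
    p.valuation K x = WithZero.exp (-ordAt p x) := by
  rw [ordAt, dif_neg hx, neg_neg]
  exact (WithZero.coe_unzero _).symm

lemma av_inr (p : HeightOneSpectrum (𝓞 K)) {x : K} (hx : x ≠ 0) :
    av (.inr p) x = (Ideal.absNorm p.asIdeal : ℝ) ^ (-ordAt p x) := by
  simp only [av_def, ab, ex, pow_one, NumberField.HeightOneSpectrum.adicAbv_def]
  rw [WithZeroMulInt.toNNReal_neg_apply _ ((p.valuation K).ne_zero_iff.mpr hx)]
  rw [ordAt, dif_neg hx, neg_neg]
  push_cast
  rfl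

lemma log_av_inr (p : HeightOneSpectrum (𝓞 K)) {x : K} (hx : x ≠ 0) :
    Real.log (av (.inr p) x) = -(ordAt p x) * Real.log (Ideal.absNorm p.asIdeal) := by
  rw [av_inr p hx, Real.log_zpow]; push_cast; ring

lemma ordAt_mul (p : HeightOneSpectrum (𝓞 K)) {x y : K} (hx : x ≠ 0) (hy : y ≠ 0) :
    ordAt p (x * y) = ordAt p x + ordAt p y := by
  have h := log_av_mul (.inr p) hx hy
  rw [log_av_inr p hx, log_av_inr p hy, log_av_inr p (mul_ne_zero hx hy)] at h
  have h2 := log_norm_pos p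
  have h3 : (ordAt p (x * y) : ℝ) = ordAt p x + ordAt p y := by
    have : (ordAt p (x * y) - ordAt p x - ordAt p y : ℝ) * Real.log (Ideal.absNorm p.asIdeal) =
        0 := by
      linarith
    rcases mul_eq_zero.1 this with h | h <;> linarith
  exact_mod_cast h3

lemma ordAt_pow (p : HeightOneSpectrum (𝓞 K)) {x : K} (hx : x ≠ 0) (n : ℕ) :
    ordAt p (x ^ n) = n * ordAt p x := by
  have h := log_av_pow (.inr p) x n
  rw [log_av_inr p hx, log_av_inr p (pow_ne_zero n hx)] at h
  have h2 := log_norm_pos p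
  have h3 : (ordAt p (x ^ n) : ℝ) = n * ordAt p x := by
    have : (ordAt p (x ^ n) - n * ordAt p x : ℝ) * Real.log (Ideal.absNorm p.asIdeal) = 0 := by
      linarith
    rcases mul_eq_zero.1 this with h | h <;> linarith
  exact_mod_cast h3

lemma ordAt_inv (p : HeightOneSpectrum (𝓞 K)) {x : K} (hx : x ≠ 0) :
    ordAt p x⁻¹ = - ordAt p x := by
  have h1 := ordAt_mul p hx (inv_ne_zero hx)
  rw [mul_inv_cancel₀ hx] at h1
  have h2 := ordAt_mul p (one_ne_zero (α := K)) (one_ne_zero (α := K))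
  rw [mul_one] at h2
  omega

lemma ordAt_div (p : HeightOneSpectrum (𝓞 K)) {x y : K} (hx : x ≠ 0) (hy : y ≠ 0) :
    ordAt p (x / y) = ordAt p x - ordAt p y := by
  rw [div_eq_mul_inv, ordAt_mul p hx (inv_ne_zero hy), ordAt_inv p hy]; ring

lemma av_inr_le_one (p : HeightOneSpectrum (𝓞 K)) {x : K} : av (.inr p) x ≤ 1 ↔ 0 ≤ ordAt p x := by
  by_cases hx : x = 0
  · simp [hx, ordAt]
  · rw [av_inr p hx, zpow_le_one_iff_right₀ (one_lt_norm p)]; omega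

/-- Finite support of a function on places. -/
abbrev FS (f : Pl K → ℝ) : Prop := (Function.support f).Finite

lemma FS_of_fin {f : Pl K → ℝ} (h : {p : HeightOneSpectrum (𝓞 K) | f (.inr p) ≠ 0}.Finite) :
    FS f := by
  refine ((Set.finite_univ (α := InfinitePlace K)).image Sum.inl |>.union
    (h.image Sum.inr)).subset ?_
  intro v hv
  cases v with
  | inl w => left; exact ⟨w, trivial, rfl⟩
  | inr p => right; exact ⟨p, hv, rfl⟩

lemma FS_log_av {x : K} (hx : x ≠ 0) : FS fun v => Real.log (av v x) := by
  apply FS_of_fin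
  have h := NumberField.FinitePlace.hasFiniteMulSupport (K := K) hx
  refine (h.preimage (f := fun p => FinitePlace.mk p)
    (FinitePlace.equivHeightOneSpectrum.symm.injective.injOn)).subset ?_
  intro p hp
  simp only [Set.mem_preimage, Function.mem_mulSupport]
  intro h1
  apply hp
  rw [FinitePlace.mk_apply, FinitePlace.norm_embedding] at h1
  have : av (.inr p) x = 1 := by simpa [av_def, ab, ex] using h1
  simp [this]

lemma FS.add' {f g : Pl K → ℝ} (hf : FS f) (hg : FS g) : FS fun v => f v + g v :=
  (hf.union hg).subset (Function.support_add f g)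

lemma FS.comp' {f : Pl K → ℝ} (hf : FS f) {F : Pl K → ℝ} (h : ∀ v, f v = 0 → F v = 0) : FS F :=
  hf.subset fun v hv => by
    intro h0; exact hv (h v h0)

lemma FS.neg' {f : Pl K → ℝ} (hf : FS f) : FS fun v => - f v :=
  hf.comp' fun v h => by simp [h]

lemma FS.mul_left' {f : Pl K → ℝ} (c : ℝ) (hf : FS f) : FS fun v => c * f v :=
  hf.comp' fun v h => by simp [h]

lemma FS_log_max_one {x : K} : FS fun v => Real.log (max 1 (av v x)) := by
  by_cases hx : x = 0
  · simp [hx, FS, Function.support]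
  refine (FS_log_av hx).comp' fun v h => ?_
  rcases Real.log_eq_zero.1 h with h | h | h
  · exact absurd h (av_ne v hx)
  · simp [h]
  · linarith [av_nonneg v x]

lemma FS_cc : FS fun v : Pl K => (cc v : ℝ) := by
  apply FS_of_fin
  simp [cc]

lemma FS_cc_mul (c : ℝ) : FS fun v : Pl K => (cc v : ℝ) * c :=
  FS_cc.comp' fun v h => by simp [h]

lemma finsum_le_of_FS {f g : Pl K → ℝ} (hf : FS f) (hg : FS g) (h : ∀ v, f v ≤ g v) :
    ∑ᶠ v, f v ≤ ∑ᶠ v, g v := finsum_le_finsum' hf hg h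

lemma finsum_eq_split {f : Pl K → ℝ} (hf : FS f) :
    ∑ᶠ v, f v = (∑ w : InfinitePlace K, f (.inl w)) + ∑ᶠ p : HeightOneSpectrum (𝓞 K),
        f (.inr p) := by
  have hd : Disjoint (Set.range (Sum.inl : InfinitePlace K → Pl K)) (Set.range Sum.inr) :=
    Set.isCompl_range_inl_range_inr.disjoint
  have h := finsum_mem_union' (f := f) hd (hf.subset Set.inter_subset_right)
    (hf.subset Set.inter_subset_right)
  rw [Set.range_inl_union_range_inr, finsum_mem_univ, finsum_mem_range Sum.inl_injective,
    finsum_mem_range Sum.inr_injective] at h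
  rw [h, finsum_eq_sum_of_fintype]

lemma sum_cc : ∑ᶠ v : Pl K, (cc v : ℝ) = Module.finrank ℚ K := by
  rw [finsum_eq_split FS_cc]
  simp only [cc, Nat.cast_zero, finsum_zero, add_zero]
  exact_mod_cast InfinitePlace.sum_mult_eq (K := K)

lemma sum_cc_mul (c : ℝ) : ∑ᶠ v : Pl K, (cc v : ℝ) * c = Module.finrank ℚ K * c := by
  rw [← sum_cc, ← finsum_mul]


/-- The product formula. -/
lemma product_formula {x : K} (hx : x ≠ 0) : ∑ᶠ v, Real.log (av v x) = 0 := by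
  rw [finsum_eq_split (FS_log_av hx)]
  have h := NumberField.prod_abs_eq_one hx
  have hpos : ∀ w : InfinitePlace K, (w x ^ w.mult) ≠ 0 :=
    fun w => pow_ne_zero _ (by simpa using hx)
  have h1 : ∏ᶠ w : FinitePlace K, w x = ∏ᶠ p : HeightOneSpectrum (𝓞 K), av (.inr p) x := by
    refine (finprod_eq_of_bijective (fun p => FinitePlace.mk p)
      FinitePlace.equivHeightOneSpectrum.symm.bijective ?_).symm
    intro p
    rw [FinitePlace.mk_apply, FinitePlace.norm_embedding]
    simp [av_def, ab, ex]
  have hfin : (Function.mulSupport fun p : HeightOneSpectrum (𝓞 K) => av (.inr p) x).Finite := by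
    refine ((FS_log_av hx).preimage (f := Sum.inr) Sum.inr_injective.injOn).subset ?_
    intro p hp
    simp only [Set.mem_preimage, Function.mem_support]
    intro h0
    rcases Real.log_eq_zero.1 h0 with h | h | h
    · exact absurd h (av_ne _ hx)
    · exact hp h
    · linarith [av_nonneg (.inr p) x]
  have h2 : Real.log (∏ᶠ p : HeightOneSpectrum (𝓞 K), av (.inr p) x)
      = ∑ᶠ p : HeightOneSpectrum (𝓞 K), Real.log (av (.inr p) x) := by
    rw [finprod_eq_prod _ hfin, Real.log_prod (fun p _ => av_ne _ hx),
      finsum_eq_sum_of_support_subset]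
    intro p hp
    simp only [Set.Finite.coe_toFinset]
    intro h0
    apply hp
    simp only at h0
    simp [h0]
  rw [h1] at h
  have h3 := congrArg Real.log h
  rw [Real.log_mul (Finset.prod_ne_zero_iff.2 fun w _ => hpos w), h2,
    Real.log_prod (fun w _ => hpos w), Real.log_one] at h3
  · exact h3
  · intro h0; rw [h0] at h; simp at h

/-- Unnormalised logarithmic height. -/
def HH (x : K) : ℝ := ∑ᶠ v : Pl K, Real.log (max 1 (av v x))

lemma log_max_one_nonneg (a : ℝ) : 0 ≤ Real.log (max 1 a) := Real.log_nonneg (le_max_left _ _)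

lemma HH_nonneg (x : K) : 0 ≤ HH x := finsum_nonneg fun _ => log_max_one_nonneg _

lemma log_max_one_pow {a : ℝ} (ha : 0 ≤ a) (n : ℕ) :
    Real.log (max 1 (a ^ n)) = n * Real.log (max 1 a) := by
  rcases le_total 1 a with h | h
  · rw [max_eq_right h, max_eq_right (one_le_pow₀ h), Real.log_pow]
  · rw [max_eq_left h, max_eq_left (pow_le_one₀ ha h)]; simp

lemma wHeight_eq (x : K) : wHeight x = HH x / Module.finrank ℚ K := by
  rw [wHeight, HH, finsum_eq_split FS_log_max_one]
  congr 2
  · refine Finset.sum_congr rfl fun w _ => ?_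
    change _ = Real.log (max 1 (w x ^ w.mult))
    rw [log_max_one_pow (by positivity)]
  · refine finsum_congr fun p => ?_
    by_cases hx : x = 0
    · simp [hx, ordAt]
    have hN := one_lt_norm p
    rw [av_inr p hx]
    rcases le_total 0 (-ordAt p x) with h | h
    · rw [max_eq_right h, max_eq_right (one_le_zpow₀ hN.le h), Real.log_zpow]
    · rw [max_eq_left h, max_eq_left (zpow_le_one_of_nonpos₀ hN.le h)]; simp

lemma HH_eq (x : K) : HH x = Module.finrank ℚ K * wHeight x := by
  rw [wHeight_eq, mul_div_cancel₀]
  exact_mod_cast (Module.finrank_pos (R := ℚ) (M := K)).ne'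

/-- The part of a function outside of a finite set of places. -/
def off (S : Finset (Pl K)) (f : Pl K → ℝ) : Pl K → ℝ := fun v => if v ∈ S then 0 else f v

lemma off_of_notMem {S : Finset (Pl K)} {f : Pl K → ℝ} {v : Pl K} (h : v ∉ S) : off S f v = f v :=
  if_neg h

lemma off_of_mem {S : Finset (Pl K)} {f : Pl K → ℝ} {v : Pl K} (h : v ∈ S) : off S f v = 0 :=
  if_pos h

lemma FS.off {f : Pl K → ℝ} (hf : FS f) (S : Finset (Pl K)) : FS (off S f) :=
  hf.comp' fun v h => by simp only [SuperElliptic.off]; split <;> simp [h]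

lemma finsum_eq_sum_add_off {f : Pl K → ℝ} (hf : FS f) (S : Finset (Pl K)) :
    ∑ᶠ v, f v = ∑ v ∈ S, f v + ∑ᶠ v, off S f v := by
  have h1 : ∑ v ∈ S, f v = ∑ᶠ v, (if v ∈ S then f v else 0) := by
    rw [finsum_eq_sum_of_support_subset (s := S)]
    · exact Finset.sum_congr rfl fun v hv => by simp [hv]
    · intro v hv
      by_contra h
      apply hv
      simp only [Finset.mem_coe] at h
      simp [h]
  rw [h1, ← finsum_add_distrib]
  · exact finsum_congr fun v => by simp only [off]; split <;> simp
  · exact hf.comp' fun v h => by simp [h]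
  · exact hf.off S

lemma sum_le_finsum {f : Pl K → ℝ} (hf : FS f) (h0 : ∀ v, 0 ≤ f v) (S : Finset (Pl K)) :
    ∑ v ∈ S, f v ≤ ∑ᶠ v, f v := by
  rw [finsum_eq_sum_add_off hf S]
  have : 0 ≤ ∑ᶠ v, off S f v := finsum_nonneg fun v => by
    simp only [off]; split
    · exact le_rfl
    · exact h0 v
  linarith

lemma le_finsum {f : Pl K → ℝ} (hf : FS f) (h0 : ∀ v, 0 ≤ f v) (v : Pl K) :
    f v ≤ ∑ᶠ v, f v := by
  simpa using sum_le_finsum hf h0 {v}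

lemma log_max_one_av_le (v : Pl K) (x : K) : Real.log (max 1 (av v x)) ≤ HH x :=
  le_finsum FS_log_max_one (fun _ => log_max_one_nonneg _) v

lemma log_le_log_max_one {a : ℝ} (ha : 0 ≤ a) : Real.log a ≤ Real.log (max 1 a) := by
  rcases ha.eq_or_lt with rfl | h
  · simp
  · exact Real.log_le_log h (le_max_right _ _)

lemma log_max_one_le {a b : ℝ} (hb : 0 ≤ b) (h : Real.log a ≤ b) :
    Real.log (max 1 a) ≤ b := by
  rcases le_total 1 a with h1 | h1
  · rwa [max_eq_right h1]
  · rw [max_eq_left h1]; simpa using hb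

lemma log_max_one_eq (a : ℝ) (ha : 0 ≤ a) : Real.log (max 1 a) = max 0 (Real.log a) := by
  rcases le_total 1 a with h1 | h1
  · rw [max_eq_right h1, max_eq_right (Real.log_nonneg h1)]
  · rw [max_eq_left h1, max_eq_left (Real.log_nonpos ha h1), Real.log_one]

lemma HH_pow (x : K) (n : ℕ) : HH (x ^ n) = n * HH x := by
  rw [HH, HH, mul_finsum]
  exact finsum_congr fun v => by rw [map_pow, log_max_one_pow (av_nonneg v x)]

lemma log_max_one_sub {a : ℝ} (ha : 0 < a) :
    Real.log (max 1 a) - Real.log (max 1 a⁻¹) = Real.log a := by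
  rcases le_total 1 a with h1 | h1
  · rw [max_eq_right h1, max_eq_left (inv_le_one_of_one_le₀ h1)]; simp
  · rw [max_eq_left h1, max_eq_right ((one_le_inv₀ ha).2 h1)]; simp

lemma HH_inv (x : K) : HH x⁻¹ = HH x := by
  by_cases hx : x = 0
  · simp [hx]
  have h : HH x - HH x⁻¹ = 0 := by
    rw [← product_formula hx, HH, HH, ← finsum_sub_distrib FS_log_max_one FS_log_max_one]
    exact finsum_congr fun v => by rw [map_inv₀, log_max_one_sub (av_pos v hx)]
  linarith

/-- The Liouville inequality. -/
lemma neg_HH_le (v : Pl K) {x : K} (hx : x ≠ 0) : - HH x ≤ Real.log (av v x) := by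
  have h := log_max_one_av_le v x⁻¹
  rw [HH_inv, map_inv₀] at h
  have h1 := log_max_one_sub (av_pos v hx)
  have h2 := log_max_one_nonneg (av v x)
  linarith

lemma abs_log_eq {a : ℝ} (ha : 0 < a) :
    |Real.log a| = Real.log (max 1 a) + Real.log (max 1 a⁻¹) := by
  rcases le_total 1 a with h1 | h1
  · rw [max_eq_right h1, max_eq_left (inv_le_one_of_one_le₀ h1), Real.log_one, add_zero,
      abs_of_nonneg (Real.log_nonneg h1)]
  · rw [max_eq_left h1, max_eq_right ((one_le_inv₀ ha).2 h1), Real.log_one, zero_add,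
      abs_of_nonpos (Real.log_nonpos ha.le h1), Real.log_inv]

lemma finsum_abs_log {x : K} (hx : x ≠ 0) : ∑ᶠ v, |Real.log (av v x)| = 2 * HH x := by
  have : ∑ᶠ v, |Real.log (av v x)| = HH x + HH x⁻¹ := by
    rw [HH, HH, ← finsum_add_distrib FS_log_max_one FS_log_max_one]
    exact finsum_congr fun v => by rw [map_inv₀, abs_log_eq (av_pos v hx)]
  rw [this, HH_inv]; ring

/-- Bounding the height of a quotient by local bounds of numerator and denominator. -/
lemma HH_div_le {p q : K} (hq : q ≠ 0) {B : Pl K → ℝ} (hB : FS B)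
    (h1 : ∀ v, Real.log (av v p) ≤ B v ∨ p = 0) (h2 : ∀ v, Real.log (av v q) ≤ B v) :
    HH (p / q) ≤ ∑ᶠ v, B v := by
  have h3 : HH (p / q) ≤ ∑ᶠ v, (B v + - Real.log (av v q)) := by
    refine finsum_le_of_FS FS_log_max_one (hB.add' (FS_log_av hq).neg') fun v => ?_
    have h2' := h2 v
    refine log_max_one_le (by linarith) ?_
    rcases eq_or_ne p 0 with h0 | h0
    · simp only [h0, zero_div, map_zero, Real.log_zero]; linarith
    rcases h1 v with h | h
    · rw [log_av_div v h0 hq]; linarith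
    · exact absurd h h0
  rw [finsum_add_distrib hB (FS_log_av hq).neg', finsum_neg_distrib, product_formula hq] at h3
  linarith

end

section

variable {K : Type*} [Field K] [NumberField K] {E : Type*} [Field E] [NumberField E] [Algebra K E]

variable (K) in
/-- The prime below a prime. -/
def resP (P : HeightOneSpectrum (𝓞 E)) : HeightOneSpectrum (𝓞 K) := P.under (𝓞 K)

lemma resP_liesOver (P : HeightOneSpectrum (𝓞 E)) :
    P.asIdeal.LiesOver (resP K P).asIdeal := ⟨rfl⟩

variable (K) in
/-- The place below a place. -/
def res : Pl E → Pl K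
  | .inl w => .inl (w.comap (algebraMap K E))
  | .inr P => .inr (resP K P)

variable (K) in
/-- Ramification index of a prime. -/
def rid (P : HeightOneSpectrum (𝓞 E)) : ℕ :=
  (resP K P).asIdeal.ramificationIdx' P.asIdeal

variable (K) in
/-- Residue degree of a prime. -/
def fid (P : HeightOneSpectrum (𝓞 E)) : ℕ :=
  (resP K P).asIdeal.inertiaDeg' P.asIdeal

variable (K) in
/-- The local degree of a place over the one below. -/
def dg : Pl E → ℕ
  | .inl w => (w.comap (algebraMap K E)).inertiaDeg w
  | .inr P => rid K P * fid K P

lemma mult_eq (w : InfinitePlace E) :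
    w.mult = (w.comap (algebraMap K E)).inertiaDeg w * (w.comap (algebraMap K E)).mult := by
  have hl : w.LiesOver (w.comap (algebraMap K E)) := ⟨rfl⟩
  by_cases h : w.IsUnramified K
  · rw [InfinitePlace.inertiaDeg_eq_one ⟨hl, h⟩, one_mul, h.eq]
  · rw [InfinitePlace.inertiaDeg_eq_two ⟨hl, h⟩]
    obtain ⟨h1, h2⟩ := InfinitePlace.isRamified_iff.1 h
    have h1' := InfinitePlace.not_isReal_iff_isComplex.2 h1
    simp [InfinitePlace.mult, h1', h2]

lemma norm_resP (P : HeightOneSpectrum (𝓞 E)) :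
    Ideal.absNorm P.asIdeal = Ideal.absNorm (resP K P).asIdeal ^ fid K P := by
  have := resP_liesOver (K := K) P
  have := (resP K P).isPrime
  have := (resP K P).isMaximal
  exact Ideal.absNorm_eq_pow_inertiaDeg'_of_liesOver P.asIdeal (resP K P).asIdeal
    (resP K P).isPrime (resP K P).ne_bot

lemma ordAt_algebraMap (P : HeightOneSpectrum (𝓞 E)) (x : K) :
    ordAt P (algebraMap K E x) = rid K P * ordAt (resP K P) x := by
  by_cases hx : x = 0
  · simp [hx, ordAt]
  have := resP_liesOver (K := K) P
  have h := HeightOneSpectrum.valuation_liesOver E (resP K P) P x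
  rw [valuation_eq_exp _ hx, valuation_eq_exp _ (by simpa using hx), ← WithZero.exp_nsmul,
    WithZero.exp_inj] at h
  simp only [Int.nsmul_eq_mul] at h
  have h' : (rid K P : ℤ) * -ordAt (resP K P) x = -ordAt P (algebraMap K E x) := h
  linarith

lemma av_algebraMap (w : Pl E) (x : K) :
    av w (algebraMap K E x) = av (res K w) x ^ dg K w := by
  cases w with
  | inl w =>
    change w (algebraMap K E x) ^ w.mult = ((w.comap (algebraMap K E)) x ^ _) ^ _
    rw [← pow_mul, InfinitePlace.comap_apply, mul_comm]
    congr 1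
    exact mult_eq w
  | inr P =>
    by_cases hx : x = 0
    · have h1 : dg K (.inr P : Pl E) ≠ 0 := by
        have := resP_liesOver (K := K) P
        have := (resP K P).isMaximal
        have hr : rid K P ≠ 0 :=
          Ideal.IsDedekindDomain.ramificationIdx'_ne_zero_of_liesOver P.asIdeal (resP K P).ne_bot
        have hf : fid K P ≠ 0 := by
          intro h0
          have := norm_resP (K := K) P
          rw [h0, pow_zero] at this
          have h2 := one_lt_norm P
          rw [this] at h2
          simp at h2
        exact mul_ne_zero hr hf
      simp [hx, h1]
    · have hx' : algebraMap K E x ≠ 0 := by simpa using hx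
      simp only [res, dg]
      rw [av_inr P hx', av_inr _ hx, ordAt_algebraMap (K := K), norm_resP (K := K) P]
      push_cast
      rw [← zpow_natCast, ← zpow_natCast, ← zpow_mul, ← zpow_mul]
      congr 1
      push_cast
      ring

lemma fid_pos (P : HeightOneSpectrum (𝓞 E)) : 0 < fid K P := by
  rw [Nat.pos_iff_ne_zero]
  intro h0
  have := norm_resP (K := K) P
  rw [h0, pow_zero] at this
  have h2 := one_lt_norm P
  rw [this] at h2
  simp at h2

lemma rid_pos (P : HeightOneSpectrum (𝓞 E)) : 0 < rid K P := by
  have := resP_liesOver (K := K) P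
  have := (resP K P).isMaximal
  exact Nat.pos_of_ne_zero
    (Ideal.IsDedekindDomain.ramificationIdx'_ne_zero_of_liesOver P.asIdeal (resP K P).ne_bot)

lemma dg_pos (w : Pl E) : 0 < dg K w := by
  cases w with
  | inl w =>
    have h := mult_eq (K := K) w
    rw [Nat.pos_iff_ne_zero]
    intro h0
    simp only [dg] at h0
    rw [h0, zero_mul] at h
    exact w.mult_ne_zero h
  | inr P => exact mul_pos (rid_pos P) (fid_pos P)

/-- The places above a given place. -/
lemma exists_fib (v : Pl K) : ∃ s : Finset (Pl E), (∀ w, w ∈ s ↔ res K w = v) ∧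
    ∑ w ∈ s, dg K w = Module.finrank K E := by
  cases v with
  | inl v =>
    refine ⟨((v.placesOver E).toFinset).map ⟨Sum.inl, Sum.inl_injective⟩, ?_, ?_⟩
    · intro w
      cases w with
      | inl w =>
        simp only [Finset.mem_map, Set.mem_toFinset, Function.Embedding.coeFn_mk, Sum.inl.injEq,
          exists_eq_right, res]
        refine ⟨fun h => ?_, fun h => ⟨by rw [← h]; rfl⟩⟩
        have h : w.LiesOver v := h
        exact InfinitePlace.LiesOver.comap_eq w v
      | inr P => simp [res]
    · rw [Finset.sum_map, ← InfinitePlace.sum_inertiaDeg_eq_finrank K E v]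
      refine Finset.sum_congr (by ext; simp) fun w hw => ?_
      simp only [Function.Embedding.coeFn_mk, dg]
      have hw' : w ∈ v.placesOver E := by simpa using hw
      have : w.LiesOver v := hw'
      have := InfinitePlace.LiesOver.comap_eq w v
      rw [this]
  | inr p =>
    have hp := p.isMaximal
    have key := Ideal.sum_ramification_inertia (R := 𝓞 K) (𝓞 E) K E (p := p.asIdeal) p.ne_bot
    have hmem : ∀ P : HeightOneSpectrum (𝓞 E), resP K P = p ↔
        P.asIdeal ∈ IsDedekindDomain.primesOverFinset p.asIdeal (𝓞 E) := by
      intro P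
      rw [IsDedekindDomain.mem_primesOverFinset_iff p.ne_bot]
      constructor
      · rintro rfl; exact ⟨P.isPrime, resP_liesOver P⟩
      · rintro ⟨_, h⟩
        exact HeightOneSpectrum.ext h.over.symm
    let φ : HeightOneSpectrum (𝓞 E) → Ideal (𝓞 E) := fun P => P.asIdeal
    have hinj : Function.Injective φ := fun P Q h => HeightOneSpectrum.ext h
    let s := (IsDedekindDomain.primesOverFinset p.asIdeal (𝓞 E)).preimage φ hinj.injOn
    refine ⟨s.map ⟨Sum.inr, Sum.inr_injective⟩, ?_, ?_⟩
    · intro w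
      cases w with
      | inl w => simp [res]
      | inr P => simp [s, res, φ, hmem]
    · rw [Finset.sum_map, ← key]
      refine Finset.sum_bij (fun P _ => P.asIdeal) ?_ ?_ ?_ ?_
      · intro P hP; simpa [s] using hP
      · intro P _ Q _ h; exact hinj h
      · intro I hI
        have h2 := (IsDedekindDomain.mem_primesOverFinset_iff p.ne_bot _).1 hI
        have := h2.1
        have := h2.2
        exact ⟨⟨I, h2.1, Ideal.ne_bot_of_mem_primesOver p.ne_bot h2⟩, by simpa [s] using hI, rfl⟩
      · intro P hP
        have : resP K P = p := (hmem P).2 (by simpa [s] using hP)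
        simp only [Function.Embedding.coeFn_mk, dg, rid, fid, this]

/-- The places above a given place. -/
def fib (E : Type*) [Field E] [NumberField E] [Algebra K E] (v : Pl K) : Finset (Pl E) :=
  (exists_fib v).choose

lemma mem_fib {v : Pl K} {w : Pl E} : w ∈ fib E v ↔ res K w = v := (exists_fib v).choose_spec.1 w

lemma sum_fib (v : Pl K) : ∑ w ∈ fib E v, dg K w = Module.finrank K E :=
  (exists_fib v).choose_spec.2

/-- The places above a finite set of places. -/
def above (E : Type*) [Field E] [NumberField E] [Algebra K E] (S : Finset (Pl K)) :
    Finset (Pl E) := S.biUnion (fib E)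

lemma mem_above {S : Finset (Pl K)} {w : Pl E} : w ∈ above E S ↔ res K w ∈ S := by
  simp [above, mem_fib]

lemma sum_above (S : Finset (Pl K)) (f : Pl E → ℝ) :
    ∑ w ∈ above E S, f w = ∑ v ∈ S, ∑ w ∈ fib E v, f w := by
  rw [above, Finset.sum_biUnion]
  intro v _ v' _ h
  rw [Function.onFun, Finset.disjoint_left]
  intro w h1 h2
  rw [mem_fib] at h1 h2
  exact h (h1.symm.trans h2)

lemma sum_above_dg (S : Finset (Pl K)) (f : Pl K → ℝ) :
    ∑ w ∈ above E S, dg K w * f (res K w) = Module.finrank K E * ∑ v ∈ S, f v := by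
  rw [sum_above, Finset.mul_sum]
  refine Finset.sum_congr rfl fun v _ => ?_
  rw [← sum_fib (E := E) v, Nat.cast_sum, Finset.sum_mul]
  exact Finset.sum_congr rfl fun w hw => by rw [mem_fib.1 hw]

lemma card_above (S : Finset (Pl K)) :
    (above E S).card ≤ Module.finrank K E * S.card := by
  have h : ((above E S).card : ℝ) ≤ Module.finrank K E * S.card := by
    have := sum_above_dg (E := E) S (fun _ => 1)
    simp only [mul_one, Finset.sum_const, nsmul_eq_mul] at this
    rw [← this, Finset.cast_card]
    exact Finset.sum_le_sum fun w _ => by exact_mod_cast dg_pos w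
  exact_mod_cast h

lemma FS_res {f : Pl K → ℝ} (hf : FS f) : FS fun w : Pl E => (dg K w : ℝ) * f (res K w) := by
  refine (above E hf.toFinset).finite_toSet.subset fun w hw => ?_
  rw [Finset.mem_coe, mem_above, Set.Finite.mem_toFinset]
  intro h0
  apply hw
  simp [h0]

lemma finsum_res {f : Pl K → ℝ} (hf : FS f) :
    ∑ᶠ w : Pl E, (dg K w : ℝ) * f (res K w) = Module.finrank K E * ∑ᶠ v, f v := by
  rw [finsum_eq_sum_of_support_subset (s := above E hf.toFinset), sum_above_dg,
    finsum_eq_sum _ hf]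
  intro w hw
  rw [Finset.mem_coe, mem_above, Set.Finite.mem_toFinset]
  intro h0
  apply hw
  simp [h0]

lemma log_av_algebraMap (w : Pl E) (x : K) :
    Real.log (av w (algebraMap K E x)) = dg K w * Real.log (av (res K w) x) := by
  rw [av_algebraMap, Real.log_pow]

lemma HH_algebraMap (x : K) : HH (algebraMap K E x) = Module.finrank K E * HH x := by
  rw [HH, HH, ← finsum_res FS_log_max_one]
  exact finsum_congr fun w => by rw [av_algebraMap, log_max_one_pow (av_nonneg _ _)]

lemma finrank_mul : Module.finrank ℚ K * Module.finrank K E = Module.finrank ℚ E :=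
  Module.finrank_mul_finrank ℚ K E

end

section ZeroEstimate

open Polynomial Matrix

variable {K : Type*} [Field K]

/-- The operator `g ↦ X g' + n g`, so that `X^n (shiftEuler n g) = Θ (X^n g)`, `Θ = X d/dX`. -/
def shiftEuler (n : ℕ) : K[X] →ₗ[K] K[X] :=
  LinearMap.mulLeft K (X : K[X]) ∘ₗ derivative + (n : K) • LinearMap.id

lemma coeff_shiftEuler (n : ℕ) (g : K[X]) (k : ℕ) :
    (shiftEuler n g).coeff k = (n + k) * g.coeff k := by
  cases k with
  | zero => simp [shiftEuler]
  | succ k => simp [shiftEuler, coeff_X_mul, coeff_derivative]; ring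

lemma coeff_shiftEuler_pow (n l : ℕ) (g : K[X]) (k : ℕ) :
    ((shiftEuler n ^ l) g).coeff k = (n + k) ^ l * g.coeff k := by
  induction l with
  | zero => simp
  | succ l ih => rw [pow_succ', Module.End.mul_apply, coeff_shiftEuler, ih]; ring

lemma shiftEuler_zero_pow (n l : ℕ) (g : K[X]) :
    (shiftEuler 0 ^ l) (X ^ n * g) = X ^ n * (shiftEuler n ^ l) g := by
  ext k
  rw [coeff_shiftEuler_pow]
  rw [coeff_X_pow_mul', coeff_X_pow_mul', coeff_shiftEuler_pow]
  split_ifs with h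
  · push_cast [h]; ring
  · simp

lemma dvd_shiftEuler_zero_pow (t : K) (N l : ℕ) {f : K[X]} (h : (X - C t) ^ N ∣ f) :
    (X - C t) ^ (N - l) ∣ (shiftEuler 0 ^ l) f := by
  induction l with
  | zero => simpa using h
  | succ l ih =>
    rw [pow_succ', Module.End.mul_apply]
    have := pow_sub_one_dvd_derivative_of_pow_dvd ih
    have h2 : ∀ q : K[X], shiftEuler 0 q = X * derivative q := fun q => by
      simp [shiftEuler]
    rw [h2, ← Nat.sub_sub]
    exact Dvd.dvd.mul_left this X

lemma dvd_det_shiftEuler {p : ℕ} {n : Fin (p + 1) → ℕ} {g : Fin (p + 1) → K[X]}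
    {u : Fin (p + 1) → K} (hu : ∀ i, u i ≠ 0) {t : K} (ht : t ≠ 0) {N : ℕ}
    (h : (X - C t) ^ N ∣ ∑ i, C (u i) * (X ^ n i * g i)) :
    (X - C t) ^ (N - p) ∣
      (Matrix.of fun l i : Fin (p + 1) => (shiftEuler (n i) ^ (l : ℕ)) (g i)).det := by
  set W : Matrix (Fin (p + 1)) (Fin (p + 1)) K[X] :=
    Matrix.of fun l i : Fin (p + 1) => (shiftEuler (n i) ^ (l : ℕ)) (g i) with hW
  have hcol : W *ᵥ (fun i => C (u i) * X ^ n i) = fun l : Fin (p + 1) =>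
      (shiftEuler 0 ^ (l : ℕ)) (∑ i, C (u i) * (X ^ n i * g i)) := by
    ext1 l
    rw [map_sum, Matrix.mulVec, dotProduct]
    refine Finset.sum_congr rfl fun i _ => ?_
    rw [C_mul' (u i) (X ^ n i * g i), map_smul, shiftEuler_zero_pow, ← C_mul', hW, Matrix.of_apply]
    ring
  have hcop : IsCoprime ((X - C t) ^ (N - p)) (C (u 0) * X ^ n 0) := by
    refine IsCoprime.pow_left (IsCoprime.mul_right ?_ (IsCoprime.pow_right ?_))
    · exact ⟨0, C (u 0)⁻¹, by rw [zero_mul, zero_add, ← C_mul, inv_mul_cancel₀ (hu 0), C_1]⟩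
    · have := isCoprime_X_sub_C_of_isUnit_sub (R := K) (a := t) (b := 0) (by simpa using ht.isUnit)
      simpa using this
  refine hcop.dvd_of_dvd_mul_left ?_
  have h2 := Matrix.cramer_apply W (W *ᵥ (fun i => C (u i) * X ^ n i)) 0
  rw [Matrix.cramer_eq_adjugate_mulVec, Matrix.mulVec_mulVec, Matrix.adjugate_mul,
    Matrix.smul_mulVec, Matrix.one_mulVec] at h2
  simp only [Pi.smul_apply, smul_eq_mul] at h2
  rw [mul_comm, h2, hcol, Matrix.det_succ_column _ 0]
  refine Finset.dvd_sum fun i _ => Dvd.dvd.mul_right (Dvd.dvd.mul_left ?_ _) _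
  rw [Matrix.updateCol_self]
  exact (pow_dvd_pow _ (by omega)).trans (dvd_shiftEuler_zero_pow t N i h)

lemma zero_estimate [CharZero K] {p D N N' : ℕ} {n : Fin (p + 1) → ℕ} (hn : Function.Injective n)
    {g : Fin (p + 1) → K[X]} (hg : ∀ i, (g i).coeff 0 ≠ 0) (hD : ∀ i, (g i).natDegree ≤ D)
    {u u' : Fin (p + 1) → K} (hu : ∀ i, u i ≠ 0) (hu' : ∀ i, u' i ≠ 0)
    {t t' : K} (ht : t ≠ 0) (ht' : t' ≠ 0) (htt : t ≠ t')
    (h : (X - C t) ^ N ∣ ∑ i, C (u i) * (X ^ n i * g i))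
    (h' : (X - C t') ^ N' ∣ ∑ i, C (u' i) * (X ^ n i * g i)) :
    (N - p) + (N' - p) ≤ (p + 1) * D := by
  set W : Matrix (Fin (p + 1)) (Fin (p + 1)) K[X] :=
    Matrix.of fun l i : Fin (p + 1) => (shiftEuler (n i) ^ (l : ℕ)) (g i) with hW
  have h0 : W.det ≠ 0 := by
    intro h0
    have h1 : (constantCoeff (R := K)) W.det = 0 := by rw [h0, map_zero]
    rw [RingHom.map_det] at h1
    have h2 : (constantCoeff (R := K)).mapMatrix W =
        (Matrix.vandermonde fun i => (n i : K)).transpose * Matrix.diagonal fun i =>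
            (g i).coeff 0 := by
      ext l i
      rw [Matrix.mul_diagonal]
      simp [hW, coeff_shiftEuler_pow, Matrix.vandermonde]
    rw [h2, Matrix.det_mul, Matrix.det_transpose, Matrix.det_diagonal] at h1
    rcases mul_eq_zero.1 h1 with h3 | h3
    · exact Matrix.det_vandermonde_ne_zero_iff.2 (fun i j hij => hn (by exact_mod_cast hij)) h3
    · obtain ⟨i, _, hi⟩ := Finset.prod_eq_zero_iff.1 h3
      exact hg i hi
  have hcop : IsCoprime ((X - C t) ^ (N - p)) ((X - C t') ^ (N' - p)) :=
    (isCoprime_X_sub_C_of_isUnit_sub (sub_ne_zero.2 htt).isUnit).pow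
  have hdvd := hcop.mul_dvd (dvd_det_shiftEuler hu ht h) (dvd_det_shiftEuler hu' ht' h')
  have h1 := natDegree_le_of_dvd hdvd h0
  rw [natDegree_mul (pow_ne_zero _ (X_sub_C_ne_zero _)) (pow_ne_zero _ (X_sub_C_ne_zero _)),
    natDegree_pow, natDegree_pow, natDegree_X_sub_C, natDegree_X_sub_C, mul_one, mul_one] at h1
  refine h1.trans ?_
  rw [Matrix.det_apply]
  refine natDegree_sum_le_of_forall_le _ _ fun σ _ => ?_
  refine (natDegree_smul_le _ _).trans ((natDegree_prod_le _ _).trans ?_)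
  refine (Finset.sum_le_card_nsmul _ _ D fun i _ => ?_).trans (by simp)
  rw [natDegree_le_iff_coeff_eq_zero]
  intro k hk
  rw [Matrix.of_apply, coeff_shiftEuler_pow, coeff_eq_zero_of_natDegree_lt ((hD i).trans_lt hk),
    mul_zero]

end ZeroEstimate

section Auxiliary

open Polynomial

variable {K : Type*} [Field K]

lemma X_sub_C_pow_dvd_of_sum_eq_zero {β : Type*} [Fintype β] (n : β → ℕ) (d : β → K) {t : K}
    (ht : t ≠ 0) {N : ℕ} (h : ∀ l < N, ∑ p, d p * (n p).choose l * t ^ n p = 0) :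
    (X - C t) ^ N ∣ ∑ p, monomial (n p) (d p) := by
  rw [X_sub_C_pow_dvd_iff, ← taylor_apply, X_pow_dvd_iff]
  intro l hl
  rw [taylor_coeff, map_sum, eval_finsetSum]
  have h1 := h l hl
  rw [← mul_right_inj' (pow_ne_zero l ht), mul_zero, ← h1, Finset.mul_sum]
  refine Finset.sum_congr rfl fun p _ => ?_
  rw [hasseDeriv_monomial, eval_monomial]
  by_cases hp : l ≤ n p
  · rw [← Nat.add_sub_cancel' hp, pow_add, Nat.add_sub_cancel' hp]
    ring
  · rw [Nat.choose_eq_zero_of_lt (not_le.1 hp)]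
    simp

lemma sum_choose_mul_pow {β : Type*} [Fintype β] (n : β → ℕ) (d : β → K) (t : K) {N : ℕ}
    (hN : ∀ p, n p ≤ N) (l : ℕ) :
    ∑ p, d p * (n p).choose l * t ^ n p = t ^ l * ∑ i ∈ Finset.range (N + 1),
      (∑ p, d p * (n p).choose l * (n p - l).choose i) * (t - 1) ^ i := by
  simp_rw [Finset.sum_mul]
  rw [Finset.sum_comm, Finset.mul_sum]
  refine Finset.sum_congr rfl fun p _ => ?_
  by_cases hp : l ≤ n p
  · have h1 : t ^ (n p - l) =
      ∑ i ∈ Finset.range (N + 1), ((n p - l).choose i : K) * (t - 1) ^ i := by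
      conv_lhs => rw [← sub_add_cancel t 1, add_pow]
      refine Finset.sum_subset_zero_on_sdiff (Finset.range_mono ?_) ?_ ?_
      · have := hN p; omega
      · intro i hi
        rw [Finset.mem_sdiff, Finset.mem_range, Finset.mem_range] at hi
        rw [Nat.choose_eq_zero_of_lt (by omega)]
        simp
      · intro i _
        rw [one_pow, mul_one, mul_comm]
    rw [← Nat.add_sub_cancel' hp, pow_add, Nat.add_sub_cancel' hp, h1, Finset.mul_sum,
      Finset.mul_sum, Finset.mul_sum]
    refine Finset.sum_congr rfl fun i _ => ?_
    ring
  · rw [Nat.choose_eq_zero_of_lt (not_le.1 hp)]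
    simp

lemma exists_sum_ne_zero [CharZero K] {r M D k₁ L : ℕ} (hr : D < r)
    (hk : (M + 1) * D < (k₁ - M) + (L - M))
    {c : Fin (M + 1) × Fin (D + 1) → ℤ} (hc : c ≠ 0)
    (h1 : ∀ l < k₁, ∑ p, c p * (r * p.1 + p.2 : ℕ).choose l = 0)
    {t A : K} (ht : t ≠ 0) (ht1 : t ≠ 1) (hA : A ≠ 0) :
    ∃ l < L, ∑ p, (c p : K) * (r * p.1 + p.2 : ℕ).choose l * (A ^ (p.1 : ℕ) * t ^ (p.2 : ℕ)) ≠
        0 := by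
  by_contra! hcon
  set f : Fin (M + 1) → K[X] := fun i => ∑ j : Fin (D + 1), monomial (j : ℕ) (c (i, j) : K) with hf
  have hfc : ∀ i (j : Fin (D + 1)), (f i).coeff j = c (i, j) := by
    intro i j
    simp only [hf, finsetSum_coeff, coeff_monomial]
    rw [Finset.sum_eq_single j]
    · simp
    · intro b _ hb
      rw [if_neg (fun h => hb (Fin.ext h))]
    · simp
  have hfd : ∀ i, (f i).natDegree ≤ D := fun i =>
    natDegree_sum_le_of_forall_le _ _ fun j _ => (natDegree_monomial_le _).trans (by omega)
  set I : Finset (Fin (M + 1)) := Finset.univ.filter fun i => f i ≠ 0 with hI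
  obtain ⟨p, hp⟩ : ∃ p, I.card = p + 1 := by
    obtain ⟨⟨i, j⟩, hij⟩ := Function.ne_iff.1 hc
    have : i ∈ I := by
      simp only [hI, Finset.mem_filter, Finset.mem_univ, true_and]
      intro h
      have := hfc i j
      rw [h, coeff_zero] at this
      exact hij (by exact_mod_cast this.symm)
    exact ⟨I.card - 1, by have := Finset.card_pos.2 ⟨i, this⟩; omega⟩
  have hpM : p ≤ M := by
    have := Finset.card_le_univ I
    rw [hp, Fintype.card_fin] at this
    omega
  have hfac : ∀ i, ∃ e : ℕ, ∃ g : K[X], f i ≠ 0 → f i = X ^ e * g ∧ g.coeff 0 ≠ 0 := by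
    intro i
    by_cases h : f i = 0
    · exact ⟨0, 0, fun h' => (h' h).elim⟩
    · obtain ⟨g, hg, hg'⟩ := exists_eq_pow_rootMultiplicity_mul_and_not_dvd (f i) h 0
      rw [C_0, sub_zero] at hg hg'
      exact ⟨_, g, fun _ => ⟨hg, fun h0 => hg' (X_dvd_iff.2 h0)⟩⟩
  choose e g hg using hfac
  let q : Fin (p + 1) → Fin (M + 1) := I.orderEmbOfFin hp
  have hqI : ∀ i, f (q i) ≠ 0 := fun i => by
    exact (Finset.mem_filter.1 (I.orderEmbOfFin_mem hp i)).2
  have hdeg : ∀ i, e (q i) + (g (q i)).natDegree ≤ D := by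
    intro i
    have h2 := hfd (q i)
    obtain ⟨h3, h4⟩ := hg (q i) (hqI i)
    have h5 : g (q i) ≠ 0 := by rintro h; rw [h] at h4; simp at h4
    rw [h3, natDegree_mul (pow_ne_zero _ X_ne_zero) h5, natDegree_X_pow] at h2
    exact h2
  have hsum : ∀ a : K, ∑ i, C (a ^ (q i : ℕ)) * (X ^ (r * q i + e (q i)) * g (q i)) =
      ∑ x : Fin (M + 1) × Fin (D + 1),
          monomial (r * x.1 + x.2 : ℕ) ((c x : K) * a ^ (x.1 : ℕ)) := by
    intro a
    have h2 : ∀ i : Fin (p + 1), C (a ^ (q i : ℕ)) * (X ^ (r * q i + e (q i)) * g (q i)) =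
        C (a ^ (q i : ℕ)) * (X ^ (r * (q i : ℕ)) * f (q i)) := by
      intro i
      rw [(hg (q i) (hqI i)).1, pow_add, mul_assoc (X ^ (r * (q i : ℕ)))]
    rw [Finset.sum_congr rfl fun i _ => h2 i, Fintype.sum_prod_type]
    have h3 : ∀ i : Fin (M + 1), ∑ j : Fin (D + 1),
        monomial (r * i + j : ℕ) ((c (i, j) : K) * a ^ (i : ℕ)) =
        C (a ^ (i : ℕ)) * (X ^ (r * (i : ℕ)) * f i) := by
      intro i
      simp only [hf]
      rw [Finset.mul_sum, Finset.mul_sum]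
      refine Finset.sum_congr rfl fun j _ => ?_
      rw [X_pow_mul_monomial, C_mul_monomial, mul_comm (a ^ _), add_comm]
    rw [Finset.sum_congr rfl fun i _ => h3 i]
    have h4 : ∑ i, C (a ^ (q i : ℕ)) * (X ^ (r * (q i : ℕ)) * f (q i)) =
        ∑ i ∈ I, C (a ^ (i : ℕ)) * (X ^ (r * (i : ℕ)) * f i) := by
      have h5 : I = Finset.univ.map (I.orderEmbOfFin hp).toEmbedding := by simp
      conv_rhs => rw [h5, Finset.sum_map]
      rfl
    rw [h4]
    refine Finset.sum_subset (Finset.subset_univ _) fun i _ hi => ?_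
    have : f i = 0 := by simpa [hI] using hi
    rw [this]; simp
  have hu : A * t⁻¹ ^ r ≠ 0 := mul_ne_zero hA (pow_ne_zero _ (inv_ne_zero ht))
  have key := zero_estimate (D := D) (N := k₁) (N' := L) (n := fun i => r * (q i : ℕ) + e (q i))
    (g := fun i => g (q i))
    (u := fun i => 1 ^ (q i : ℕ)) (u' := fun i => (A * t⁻¹ ^ r) ^ (q i : ℕ)) (t := 1) (t' := t)
    ?_ (fun i => (hg _ (hqI i)).2) (fun i => by have := hdeg i; omega) (fun i => by simp)
    (fun i => pow_ne_zero _ hu) one_ne_zero ht ht1.symm ?_ ?_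
  · have h2 : (p + 1) * D ≤ (M + 1) * D := Nat.mul_le_mul_right _ (by omega)
    omega
  · intro i j hij
    have hij : r * (q i : ℕ) + e (q i) = r * (q j : ℕ) + e (q j) := hij
    have h2 := hdeg i
    have h3 := hdeg j
    have h4 : (q i : ℕ) = q j := by
      have h5 := congrArg (· / r) hij
      simp only [Nat.mul_add_div (show 0 < r by omega),
          Nat.div_eq_of_lt (show e (q i) < r by omega),
        Nat.div_eq_of_lt (show e (q j) < r by omega)] at h5
      simpa using h5
    exact (I.orderEmbOfFin hp).injective (Fin.ext h4)
  · rw [hsum]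
    refine X_sub_C_pow_dvd_of_sum_eq_zero _ _ one_ne_zero fun l hl => ?_
    have := congrArg (Int.cast : ℤ → K) (h1 l hl)
    push_cast at this
    simpa using this
  · rw [hsum]
    refine X_sub_C_pow_dvd_of_sum_eq_zero _ _ ht fun l hl => ?_
    rw [← hcon l hl]
    refine Finset.sum_congr rfl fun x _ => ?_
    have h2 : (A * t⁻¹ ^ r) ^ (x.1 : ℕ) * t ^ (r * x.1 + x.2 : ℕ) =
        A ^ (x.1 : ℕ) * t ^ (x.2 : ℕ) := by
      rw [mul_pow, pow_add, ← pow_mul, inv_pow]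
      field_simp
    rw [← h2]
    ring

open Matrix in
/-- Siegel's lemma for the vanishing conditions at `1`, with exponent `2`. -/
lemma exists_coeff {k D r M : ℕ} (hk : 0 < k) (hM : M + 1 = 3 * k) {B : ℝ} (hB : 1 ≤ B)
    (h : ∀ l < 2 * k * (D + 1), ∀ n ≤ r * M + D, (n.choose l : ℝ) ≤ B) :
    ∃ c : Fin (M + 1) × Fin (D + 1) → ℤ, c ≠ 0 ∧
      (∀ l < 2 * k * (D + 1), ∑ p, c p * (r * p.1 + p.2 : ℕ).choose l = 0) ∧
      ∀ p, |(c p : ℝ)| ≤ (3 * k * (D + 1) * B) ^ 2 := by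
  let Am : Matrix (Fin (2 * k * (D + 1))) (Fin (M + 1) × Fin (D + 1)) ℤ :=
    Matrix.of fun l p => ((r * p.1 + p.2 : ℕ).choose l : ℤ)
  have hcard : Fintype.card (Fin (M + 1) × Fin (D + 1)) = 3 * k * (D + 1) := by
    rw [Fintype.card_prod, Fintype.card_fin, Fintype.card_fin, hM]
  have hkD : 0 < k * (D + 1) := by positivity
  obtain ⟨c, hc, hAc, hn⟩ := Int.Matrix.exists_ne_zero_int_vec_norm_le Am
    (by rw [hcard, Fintype.card_fin]; nlinarith) (by rw [Fintype.card_fin]; nlinarith)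
  refine ⟨c, hc, ?_, ?_⟩
  · intro l hl
    have := congrFun hAc ⟨l, hl⟩
    simp only [Matrix.mulVec, dotProduct, Am, Matrix.of_apply, Pi.zero_apply] at this
    rw [← this]
    exact Finset.sum_congr rfl fun p _ => mul_comm _ _
  · intro p
    have h1 : |(c p : ℝ)| ≤ ‖c‖ := by
      have := norm_le_pi_norm c p
      rwa [Int.norm_eq_abs] at this
    refine (h1.trans hn).trans ?_
    rw [hcard, Fintype.card_fin]
    have h2 : ((2 * k * (D + 1) : ℕ) : ℝ) /
        (((3 * k * (D + 1) : ℕ) : ℝ) - ((2 * k * (D + 1) : ℕ) : ℝ))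
        = (2 : ℕ) := by
      have : (k * (D + 1) : ℝ) ≠ 0 := by exact_mod_cast hkD.ne'
      rw [div_eq_iff]
      · push_cast; ring
      · push_cast
        intro h0
        apply this
        linarith
    rw [h2, Real.rpow_natCast]
    refine pow_le_pow_left₀ (by positivity) ?_ 2
    push_cast
    refine mul_le_mul_of_nonneg_left (max_le hB ?_) (by positivity)
    rw [Matrix.norm_le_iff (by linarith)]
    intro l p
    rw [Int.norm_eq_abs]
    simp only [Am, Matrix.of_apply, Int.cast_natCast, Nat.abs_cast]
    refine h l l.2 _ ?_
    have h3 := p.1.2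
    have h4 := p.2.2
    have h5 : r * (p.1 : ℕ) ≤ r * M := Nat.mul_le_mul_left _ (by omega)
    omega

end Auxiliary

section TwoLogs

variable {K : Type*} [Field K] [NumberField K]

local notation "gg" => (Module.finrank ℚ K : ℝ)

lemma choose_le_exp {y : ℝ} (hy : 0 < y) (n i : ℕ) :
    (n.choose i : ℝ) ≤ Real.exp (y * n - i * Real.log y) := by
  have h1 : y ^ i * (n.choose i : ℝ) ≤ (y + 1) ^ n := by
    by_cases hi : i ≤ n
    · rw [add_pow]
      refine le_trans ?_ (Finset.single_le_sum
        (f := fun m => y ^ m * 1 ^ (n - m) * (n.choose m : ℝ))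
        (fun j _ => by positivity) (Finset.mem_range.2 (Nat.lt_succ_of_le hi)))
      simp
    · rw [Nat.choose_eq_zero_of_lt (not_le.1 hi)]
      simp only [Nat.cast_zero, mul_zero]
      positivity
  have h2 : (y + 1) ^ n ≤ Real.exp (y * n) := by
    rw [mul_comm, Real.exp_nat_mul]
    exact pow_le_pow_left₀ (by positivity) (Real.add_one_le_exp y) n
  rw [Real.exp_sub, Real.exp_nat_mul, Real.exp_log hy, le_div_iff₀ (by positivity), mul_comm]
  exact h1.trans h2

lemma pow_cc_eq (v : Pl K) {x : ℝ} (hx : 0 < x) : x ^ cc v = Real.exp (cc v * Real.log x) := by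
  rw [Real.exp_nat_mul, Real.exp_log hx]

lemma cc_le_finrank (v : Pl K) : (cc v : ℝ) ≤ gg := by
  rw [← sum_cc]
  exact le_finsum FS_cc (fun v => Nat.cast_nonneg _) v

lemma one_le_finrank : (1 : ℝ) ≤ gg := by
  exact_mod_cast Nat.one_le_iff_ne_zero.2 Module.finrank_pos.ne'

/-- A value close to `1` has absolute value close to `1`. -/
lemma av_le_of_sub_one {v : Pl K} {t : K} {l : ℝ} (hl : 0 ≤ l)
    (h : av v (t - 1) ≤ Real.exp (-(gg * l))) : av v t ≤ Real.exp (cc v * Real.exp (-l)) := by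
  cases v with
  | inl w =>
    have h0 : w.mult ≠ 0 := w.mult_ne_zero
    have h1 : w (t - 1) ≤ Real.exp (-l) := by
      rw [← pow_le_pow_iff_left₀ (by positivity) (by positivity) h0]
      refine (show w (t - 1) ^ w.mult ≤ _ from h).trans ?_
      rw [← Real.exp_nat_mul]
      have := mul_le_mul_of_nonneg_right (cc_le_finrank (.inl w : Pl K)) hl
      simp only [cc] at this
      exact Real.exp_le_exp.2 (by linarith)
    change w t ^ w.mult ≤ Real.exp (w.mult * _)
    rw [Real.exp_nat_mul]
    refine pow_le_pow_left₀ (by positivity) ?_ _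
    have h2 : w t ≤ w (t - 1) + w 1 := by
      have h3 := w.1.add_le (t - 1) 1
      rw [sub_add_cancel] at h3
      exact h3
    rw [map_one] at h2
    linarith [Real.add_one_le_exp (Real.exp (-l))]
  | inr p =>
    have h1 := av_add_le (.inr p) (t - 1) 1 (B := 1) (h.trans (Real.exp_le_one_iff.2
      (by linarith [mul_nonneg (zero_le_one.trans (one_le_finrank (K := K))) hl])))
      (by simp)
    simpa [cc] using h1

set_option maxHeartbeats 1600000 in
lemma two_logs_estimate (w : Pl K) {t A : K} (ht : t ≠ 0) (ht1 : t ≠ 1) (hA : A ≠ 0)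
    {k r D M : ℕ} (hk : 0 < k) (hM : M + 1 = 3 * k) (hr : D < r)
    {B B₂ y l U : ℝ} (hB : 1 ≤ B) (hB₂ : 1 ≤ B₂)
    (hy : 0 < y) (hy1 : y ≤ 1) (hl : -Real.log y ≤ l) (hU : 0 ≤ U)
    (h1 : ∀ i < 2 * k * (D + 1), ∀ n ≤ r * M + D, (n.choose i : ℝ) ≤ B)
    (h2 : ∀ i < k * (D + 4), ∀ n ≤ r * M + D, (n.choose i : ℝ) ≤ B₂)
    (hw : av w (t - 1) ≤ Real.exp (-(gg * l)))
    (hw' : av w (A * t⁻¹ ^ r - 1) ≤ Real.exp (-U)) :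
    0 ≤ gg * (3 * Real.log (3 * k * (D + 1)) + 2 * Real.log B + Real.log B₂) +
      M * HH A + D * HH t + max
      (gg * (Real.log 2 + (r * M + D : ℕ) * Real.exp (-l) +
        Real.log ((r * M + D : ℕ) + 1) + y * (r * M + D : ℕ) -
        (k * (D - 2) : ℕ) * Real.log y) - gg * l * (k * (D - 2) : ℕ))
      (gg * (Real.log 2 + (r * M + D : ℕ) * Real.exp (-l) +
        M * Real.log 4) - U) := by
  have hlog : 0 ≤ -Real.log y := by have := Real.log_nonpos hy.le hy1; linarith
  have hl0 : 0 ≤ l := by linarith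
  have hg1 := one_le_finrank (K := K)
  obtain ⟨c, hc0, hc1, hc2⟩ := exists_coeff hk hM hB h1
  obtain ⟨i₀, hi₀, hΦ⟩ := exists_sum_ne_zero (K := K) (L := k * (D + 4)) hr (by
    obtain ⟨k, rfl⟩ : ∃ k', k = k' + 1 := ⟨k - 1, by omega⟩
    obtain rfl : M = 3 * k + 2 := by omega
    have e2 : 2 * (k + 1) * (D + 1) - (3 * k + 2) + ((k + 1) * (D + 4) - (3 * k + 2))
        ≥ 2 * (k + 1) * (D + 1) + (k + 1) * (D + 4) - 2 * (3 * k + 2) := by omega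
    refine lt_of_lt_of_le ?_ e2
    rw [Nat.lt_sub_iff_add_lt]
    nlinarith) hc0 hc1 ht ht1 hA
  set N := r * M + D with hN
  set Y : ℝ := 3 * Real.log (3 * k * (D + 1)) + 2 * Real.log B + Real.log B₂ with hY
  set Φ : K := ∑ p, (c p : K) * (r * p.1 + p.2 : ℕ).choose i₀ *
      (A ^ (p.1 : ℕ) * t ^ (p.2 : ℕ)) with hΦdef
  have hk1 : (1 : ℝ) ≤ k := by exact_mod_cast hk
  set n₀ : ℝ := 3 * k * (D + 1) with hn₀
  have hn₀1 : 1 ≤ n₀ := by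
    have : (0:ℝ) ≤ D := Nat.cast_nonneg _
    exact one_le_mul_of_one_le_of_one_le (by linarith only [hk1]) (by linarith only [this])
  have hcard : (Fintype.card (Fin (M + 1) × Fin (D + 1)) : ℝ) = n₀ := by
    rw [Fintype.card_prod, Fintype.card_fin, Fintype.card_fin, hM]
    push_cast; rw [hn₀]
  have hnp : ∀ p : Fin (M + 1) × Fin (D + 1), r * (p.1 : ℕ) + p.2 ≤ N := by
    intro p
    have h3 := p.1.2
    have h4 := p.2.2
    have h5 : r * (p.1 : ℕ) ≤ r * M := Nat.mul_le_mul_left _ (by omega)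
    omega
  have hYexp : Real.exp Y = n₀ * ((n₀ * B) ^ 2 * B₂) := by
    rw [hY, Real.exp_add, Real.exp_add, Real.exp_log (by linarith),
      show (3 : ℝ) * Real.log n₀ = (3 : ℕ) * Real.log n₀ by norm_num,
      show (2 : ℝ) * Real.log B = (2 : ℕ) * Real.log B by norm_num, Real.exp_nat_mul,
      Real.exp_nat_mul, Real.exp_log (by linarith), Real.exp_log (by linarith)]
    ring
  have hY0 : 0 ≤ Y := by
    have := Real.log_nonneg hB; have := Real.log_nonneg hB₂; have := Real.log_nonneg hn₀1
    rw [hY]; linarith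
  have hcoef : ∀ v : Pl K, ∀ p, av v ((c p : K) * (r * p.1 + p.2 : ℕ).choose i₀) ≤
      ((n₀ * B) ^ 2 * B₂) ^ cc v := by
    intro v p
    rw [map_mul, mul_pow]
    refine mul_le_mul (av_intCast_le v _ (hc2 p)) ?_ (av_nonneg _ _) (by positivity)
    exact (av_natCast_le v _).trans (pow_le_pow_left₀ (by positivity) (h2 _ hi₀ _ (hnp p)) _)
  have hcc0 : ∀ v : Pl K, (0 : ℝ) ≤ cc v := fun v => Nat.cast_nonneg _
  -- the trivial bound at an arbitrary place
  have hall : ∀ v : Pl K, Real.log (av v Φ) ≤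
      cc v * Y + (M * Real.log (max 1 (av v A)) + D * Real.log (max 1 (av v t))) := by
    intro v
    rw [← Real.log_exp (cc v * Y + _)]
    refine Real.log_le_log (av_pos v hΦ) ?_
    rw [Real.exp_add, Real.exp_nat_mul, hYexp, Real.exp_add, Real.exp_nat_mul, Real.exp_nat_mul,
      Real.exp_log (by positivity), Real.exp_log (by positivity), mul_pow, mul_assoc]
    have := av_sum_le v Finset.univ (fun p : Fin (M + 1) × Fin (D + 1) =>
      (c p : K) * (r * p.1 + p.2 : ℕ).choose i₀ * (A ^ (p.1 : ℕ) * t ^ (p.2 : ℕ)))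
      (B := ((n₀ * B) ^ 2 * B₂) ^ cc v * (max 1 (av v A) ^ M * max 1 (av v t) ^ D))
          (by positivity) ?_
    · rwa [Finset.card_univ, hcard] at this
    · intro p _
      rw [map_mul, map_mul _ (A ^ _), map_pow, map_pow]
      refine mul_le_mul (hcoef v p) ?_ (by have := av_nonneg v A; have := av_nonneg v t; positivity)
        (by positivity)
      refine mul_le_mul ?_ ?_ (by have := av_nonneg v t; positivity) (by positivity)
      · exact (pow_le_pow_left₀ (av_nonneg _ _) (le_max_right 1 _) _).trans
          (pow_le_pow_right₀ (le_max_left _ _) (by omega))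
      · exact (pow_le_pow_left₀ (av_nonneg _ _) (le_max_right 1 _) _).trans
          (pow_le_pow_right₀ (le_max_left _ _) (by omega))
  -- the bound at `w`
  set e₁ : ℝ := N * Real.exp (-l) with he₁
  have he₁0 : 0 ≤ e₁ := by positivity
  have htn : ∀ n ≤ N, av w t ^ n ≤ Real.exp (cc w * e₁) := by
    intro n hn
    have h3 : av w t ≤ Real.exp (cc w * Real.exp (-l)) := av_le_of_sub_one hl0 hw
    refine (pow_le_pow_left₀ (av_nonneg _ _) h3 n).trans ?_
    rw [← Real.exp_nat_mul]
    refine Real.exp_le_exp.2 ?_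
    rw [he₁]
    have : (n : ℝ) ≤ N := by exact_mod_cast hn
    have h4 : 0 ≤ cc w * Real.exp (-l) := mul_nonneg (hcc0 w) (Real.exp_pos _).le
    nlinarith
  set X₁ : ℝ := cc w * (e₁ + Real.log (N + 1) + y * N - (k * (D - 2) : ℕ) * Real.log y) -
    gg * l * (k * (D - 2) : ℕ) with hX₁
  set X₂ : ℝ := cc w * (e₁ + M * Real.log 4) - U with hX₂
  set S₁ : K := ∑ p, (c p : K) * (r * p.1 + p.2 : ℕ).choose i₀ * t ^ (r * p.1 + p.2 : ℕ) with hS₁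
  set S₂ : K := ∑ p, (c p : K) * (r * p.1 + p.2 : ℕ).choose i₀ * t ^ (r * p.1 + p.2 : ℕ) *
    ((A * t⁻¹ ^ r) ^ (p.1 : ℕ) - 1) with hS₂
  have hΦS : Φ = S₁ + S₂ := by
    rw [hΦdef, hS₁, hS₂, ← Finset.sum_add_distrib]
    refine Finset.sum_congr rfl fun p _ => ?_
    have h3 : t ^ (r * p.1 + p.2 : ℕ) * (A * t⁻¹ ^ r) ^ (p.1 : ℕ) =
        A ^ (p.1 : ℕ) * t ^ (p.2 : ℕ) := by
      rw [mul_pow, pow_add, ← pow_mul, inv_pow]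
      field_simp
    rw [← h3]
    ring
  have hS₁b : av w S₁ ≤ Real.exp (cc w * Y + X₁) := by
    rw [hS₁, sum_choose_mul_pow _ _ t hnp, map_mul, map_pow]
    have h3 : ∀ i ∈ Finset.range (N + 1), av w ((∑ p, (c p : K) * (r * p.1 + p.2 : ℕ).choose i₀ *
        (r * p.1 + p.2 - i₀ : ℕ).choose i) * (t - 1) ^ i) ≤
        Real.exp (cc w * (Y + y * N - (k * (D - 2) : ℕ) * Real.log y) -
          gg * l * (k * (D - 2) : ℕ)) := by
      intro i _
      by_cases hi : i < k * (D - 2)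
      · have h4 : (∑ p, (c p : K) * (r * p.1 + p.2 : ℕ).choose i₀ *
            (r * p.1 + p.2 - i₀ : ℕ).choose i) = 0 := by
          have h5 : ∀ p : Fin (M + 1) × Fin (D + 1), (c p : K) * (r * p.1 + p.2 : ℕ).choose i₀ *
            (r * p.1 + p.2 - i₀ : ℕ).choose i =
            ((c p * (r * p.1 + p.2 : ℕ).choose (i₀ + i) : ℤ) : K) * (i₀ + i).choose i₀ := by
            intro p
            by_cases h6 : i₀ + i ≤ r * p.1 + p.2
            · have h7 := Nat.choose_mul (n := r * p.1 + p.2) (k := i₀ + i) (s := i₀) (by omega)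
              rw [Nat.add_sub_cancel_left] at h7
              have h8 := congrArg (Nat.cast : ℕ → K) h7
              push_cast at h8 ⊢
              rw [mul_assoc, ← h8]
              ring
            · have h7 : (r * p.1 + p.2 : ℕ).choose (i₀ + i) = 0 :=
                Nat.choose_eq_zero_of_lt (by omega)
              rw [h7]
              by_cases h8 : i₀ ≤ r * p.1 + p.2
              · rw [Nat.choose_eq_zero_of_lt (show r * p.1 + p.2 - i₀ < i by omega)]
                simp
              · rw [Nat.choose_eq_zero_of_lt (show r * p.1 + p.2 < i₀ by omega)]
                simp
          rw [Finset.sum_congr rfl fun p _ => h5 p, ← Finset.sum_mul, ← Int.cast_sum, hc1 (i₀ + i)]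
          · simp
          · have h6 : k * (D - 2) + k * (D + 4) ≤ 2 * k * (D + 1) ∨ D < 2 := by
              by_cases hD : D < 2
              · exact Or.inr hD
              · obtain ⟨D', rfl⟩ : ∃ D', D = D' + 2 := ⟨D - 2, by omega⟩
                left
                rw [Nat.add_sub_cancel]
                nlinarith
            rcases h6 with h6 | h6
            · omega
            · rw [show D - 2 = 0 by omega] at hi
              omega
        rw [h4, zero_mul, map_zero]
        exact (Real.exp_pos _).le
      · have hi : ((k * (D - 2) : ℕ) : ℝ) ≤ i := by exact_mod_cast not_lt.1 hi
        rw [map_mul, map_pow]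
        have h4 : av w (∑ p, (c p : K) * (r * p.1 + p.2 : ℕ).choose i₀ *
            (r * p.1 + p.2 - i₀ : ℕ).choose i) ≤
                Real.exp (cc w * (Y + (y * N - i * Real.log y))) := by
          have := av_sum_le w Finset.univ (fun p : Fin (M + 1) × Fin (D + 1) =>
            (c p : K) * (r * p.1 + p.2 : ℕ).choose i₀ * (r * p.1 + p.2 - i₀ : ℕ).choose i)
            (B := ((n₀ * B) ^ 2 * B₂) ^ cc w * (Real.exp (y * N - i * Real.log y)) ^ cc w)
            (by positivity) ?_
          · rw [Finset.card_univ, hcard, ← mul_assoc, ← mul_pow, ← hYexp] at this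
            rwa [Real.exp_nat_mul, Real.exp_add, mul_pow]
          · intro p _
            rw [map_mul]
            refine mul_le_mul (hcoef w p) ?_ (av_nonneg _ _) (by positivity)
            refine (av_natCast_le w _).trans (pow_le_pow_left₀ (by positivity) ?_ _)
            refine (choose_le_exp hy _ _).trans (Real.exp_le_exp.2 ?_)
            have : ((r * p.1 + p.2 - i₀ : ℕ) : ℝ) ≤ N := by
              have := hnp p
              exact_mod_cast (by omega : (r * p.1 + p.2 - i₀ : ℕ) ≤ N)
            nlinarith
        have h5 : av w (t - 1) ^ i ≤ Real.exp (-(gg * l) * i) := by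
          rw [mul_comm, Real.exp_nat_mul]
          exact pow_le_pow_left₀ (av_nonneg _ _) hw i
        refine (mul_le_mul h4 h5 (by have := av_nonneg w (t - 1); positivity)
          (Real.exp_pos _).le).trans ?_
        rw [← Real.exp_add]
        refine Real.exp_le_exp.2 ?_
        have h6 : cc w * -Real.log y ≤ gg * l :=
          mul_le_mul (cc_le_finrank w) hl hlog (by linarith)
        nlinarith
    have h4 := av_sum_le w (Finset.range (N + 1)) _ (Real.exp_pos _).le h3
    have h5 := htn i₀
    have hi₀N : av w t ^ i₀ ≤ Real.exp (cc w * e₁) ∨ N < i₀ := by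
      by_cases h : i₀ ≤ N
      · exact Or.inl (htn _ h)
      · exact Or.inr (not_le.1 h)
    rcases hi₀N with h6 | h6
    · refine (mul_le_mul h6 h4 (av_nonneg _ _) (Real.exp_pos _).le).trans ?_
      rw [Finset.card_range, pow_cc_eq w (by positivity), ← Real.exp_add, ← Real.exp_add]
      refine Real.exp_le_exp.2 (le_of_eq ?_)
      push_cast
      rw [hX₁]; push_cast; ring
    · have h7 : ∑ i ∈ Finset.range (N + 1), (∑ p, (c p : K) * (r * p.1 + p.2 : ℕ).choose i₀ *
        (r * p.1 + p.2 - i₀ : ℕ).choose i) * (t - 1) ^ i = 0 := by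
        refine Finset.sum_eq_zero fun i _ => ?_
        rw [Finset.sum_eq_zero, zero_mul]
        intro p _
        rw [Nat.choose_eq_zero_of_lt (lt_of_le_of_lt (hnp p) h6)]
        simp
      rw [h7, map_zero, mul_zero]
      exact (Real.exp_pos _).le
  have hS₂b : av w S₂ ≤ Real.exp (cc w * Y + X₂) := by
    set u := A * t⁻¹ ^ r with hu
    have hu2 : av w u ≤ 2 ^ cc w := by
      have := av_add_le w (u - 1) 1 (B := 1) (hw'.trans (Real.exp_le_one_iff.2 (by linarith)))
        (by simp)
      simpa using this
    have hup : ∀ i ≤ M, av w (u ^ i - 1) ≤ (4 ^ M) ^ cc w * Real.exp (-U) := by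
      intro i hi
      rw [← geom_sum_mul, map_mul]
      refine mul_le_mul ?_ hw' (av_nonneg _ _) (by positivity)
      have h3 := av_sum_le w (Finset.range i) (fun j => u ^ j)
        (B := (2 ^ M) ^ cc w) (by positivity) ?_
      · refine h3.trans ?_
        rw [Finset.card_range, ← mul_pow]
        refine pow_le_pow_left₀ (by positivity) ?_ _
        rw [show (4 : ℝ) = 2 * 2 by norm_num, mul_pow]
        refine mul_le_mul_of_nonneg_right ?_ (by positivity)
        have h4 : (i : ℝ) ≤ M := by exact_mod_cast hi
        have h5 : (M : ℝ) < 2 ^ M := by exact_mod_cast Nat.lt_two_pow_self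
        linarith
      · intro j hj
        have hj := Finset.mem_range.1 hj
        rw [map_pow]
        refine (pow_le_pow_left₀ (av_nonneg _ _) hu2 j).trans ?_
        rw [← pow_mul, mul_comm, pow_mul]
        exact pow_le_pow_left₀ (by positivity) (pow_le_pow_right₀ (by norm_num) (by omega)) _
    have := av_sum_le w Finset.univ (fun p : Fin (M + 1) × Fin (D + 1) =>
      (c p : K) * (r * p.1 + p.2 : ℕ).choose i₀ * t ^ (r * p.1 + p.2 : ℕ) * (u ^ (p.1 : ℕ) - 1))
      (B := ((n₀ * B) ^ 2 * B₂) ^ cc w * Real.exp (cc w * e₁) * ((4 ^ M) ^ cc w * Real.exp (-U)))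
      (by positivity) ?_
    · refine this.trans (le_of_eq ?_)
      rw [Finset.card_univ, hcard, ← mul_assoc, ← mul_assoc, ← mul_assoc, ← mul_pow, ← hYexp,
        ← Real.exp_nat_mul, pow_cc_eq w (by positivity), Real.log_pow, ← Real.exp_add,
        ← Real.exp_add, ← Real.exp_add]
      congr 1
      rw [hX₂]; ring
    · intro p _
      rw [map_mul, map_mul, map_pow]
      have h9 := p.1.2
      refine mul_le_mul (mul_le_mul (hcoef w p) (htn _ (hnp p))
          (by have := av_nonneg w t; positivity)
        (by positivity)) (hup _ (by omega)) (av_nonneg _ _) (by positivity)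
  have hwb : Real.log (av w Φ) ≤ cc w * Y + (cc w * Real.log 2 + max X₁ X₂) := by
    rw [← Real.log_exp (cc w * Y + _)]
    refine Real.log_le_log (av_pos w hΦ) ?_
    rw [hΦS]
    refine (av_add_le w S₁ S₂ (B := Real.exp (cc w * Y + max X₁ X₂))
      (hS₁b.trans (Real.exp_le_exp.2 (by linarith [le_max_left X₁ X₂])))
      (hS₂b.trans (Real.exp_le_exp.2 (by linarith [le_max_right X₁ X₂])))).trans (le_of_eq ?_)
    rw [pow_cc_eq w (by norm_num), ← Real.exp_add]
    congr 1
    ring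
  -- summation
  set Z := max
      (gg * (Real.log 2 + e₁ + Real.log (N + 1) + y * N -
        (k * (D - 2) : ℕ) * Real.log y) - gg * l * (k * (D - 2) : ℕ))
      (gg * (Real.log 2 + e₁ + M * Real.log 4) - U) with hZ
  have hXZ : cc w * Real.log 2 + max X₁ X₂ ≤ Z := by
    have hlg2 : (0:ℝ) ≤ Real.log 2 := Real.log_nonneg (by norm_num)
    have hlg4 : (0:ℝ) ≤ Real.log 4 := Real.log_nonneg (by norm_num)
    have hlgN : (0:ℝ) ≤ Real.log (N + 1) := Real.log_nonneg (by
      have : (0:ℝ) ≤ N := Nat.cast_nonneg _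
      linarith)
    have hcg := cc_le_finrank w
    have q1 : (0:ℝ) ≤ (k * (D - 2) : ℕ) * -Real.log y := mul_nonneg (Nat.cast_nonneg _) hlog
    have q2 : (0:ℝ) ≤ y * N := by positivity
    have q3 : (0:ℝ) ≤ M * Real.log 4 := by positivity
    rw [← max_add_add_left]
    refine max_le_max ?_ ?_
    · have := mul_le_mul_of_nonneg_right hcg (show 0 ≤ Real.log 2 + e₁ + Real.log (N + 1) + y * N -
        (k * (D - 2) : ℕ) * Real.log y by linarith)
      rw [hX₁]; linarith
    · have := mul_le_mul_of_nonneg_right hcg (show 0 ≤ Real.log 2 + e₁ + M * Real.log 4 by linarith)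
      rw [hX₂]; linarith
  have hFS1 : FS fun v : Pl K => cc v * Y + (M * Real.log (max 1 (av v A)) +
      D * Real.log (max 1 (av v t))) :=
    (FS_cc_mul Y).add' ((FS_log_max_one.mul_left' _).add' (FS_log_max_one.mul_left' _))
  have hFS2 : FS fun v : Pl K => if v = w then Z else 0 :=
    (Set.finite_singleton w).subset fun v hv => by
      by_contra h
      exact hv (if_neg h)
  have hsum : ∑ᶠ v : Pl K, Real.log (av v Φ) ≤ ∑ᶠ v : Pl K, ((cc v * Y +
      (M * Real.log (max 1 (av v A)) + D * Real.log (max 1 (av v t)))) +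
        if v = w then Z else 0) := by
    refine finsum_le_of_FS (FS_log_av hΦ) (hFS1.add' hFS2) fun v => ?_
    split_ifs with h
    · subst h
      have := log_max_one_nonneg (av v A)
      have := log_max_one_nonneg (av v t)
      have q1 : 0 ≤ M * Real.log (max 1 (av v A)) := by positivity
      have q2 : 0 ≤ D * Real.log (max 1 (av v t)) := by positivity
      linarith
    · rw [add_zero]; exact hall v
  rw [product_formula hΦ, finsum_add_distrib hFS1 hFS2, finsum_add_distrib (FS_cc_mul Y)
    ((FS_log_max_one.mul_left' _).add' (FS_log_max_one.mul_left' _)),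
    finsum_add_distrib (FS_log_max_one.mul_left' _) (FS_log_max_one.mul_left' _), sum_cc_mul,
    ← mul_finsum, ← mul_finsum, ← HH, ← HH, finsum_eq_single _ w
      (fun v hv => if_neg hv), if_pos rfl] at hsum
  linarith

end TwoLogs

section TwoLogsNumeric

variable {K : Type*} [Field K] [NumberField K]

local notation "gg" => (Module.finrank ℚ K : ℝ)

lemma log_le_div_add {x : ℝ} (hx : 0 < x) : Real.log x ≤ x / 300 + 5 := by
  have h1 := Real.log_le_sub_one_of_pos (x := x / 300) (by positivity)
  rw [Real.log_div hx.ne' (by norm_num)] at h1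
  have h2 : Real.log 300 ≤ 6 := by
    rw [Real.log_le_iff_le_exp (by norm_num)]
    have h3 := Real.exp_one_gt_d9
    have h4 : Real.exp 6 = Real.exp 1 ^ 6 := by rw [← Real.exp_nat_mul]; norm_num
    rw [h4]
    have : (2.7 : ℝ) ^ 6 ≤ Real.exp 1 ^ 6 := pow_le_pow_left₀ (by norm_num) (by linarith) 6
    refine le_trans (by norm_num) this
  linarith

lemma log_le_of_le_exp_nat {x : ℝ} (n : ℕ) (hx : 0 < x) (h : x ≤ 2.7 ^ n) : Real.log x ≤ n := by
  rw [Real.log_le_iff_le_exp hx]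
  have h4 : Real.exp n = Real.exp 1 ^ n := by rw [← Real.exp_nat_mul]; norm_num
  rw [h4]
  have h3 := Real.exp_one_gt_d9
  exact h.trans (pow_le_pow_left₀ (by norm_num) (by linarith) n)

lemma log_natCast_le {P : ℝ} (hP : 12 ≤ P) : Real.log P ≤ P / 12 + 2 := by
  have h1 := Real.log_le_sub_one_of_pos (x := P / 12) (by positivity)
  rw [Real.log_div (by positivity) (by norm_num)] at h1
  have h2 : Real.log 12 ≤ 3 := by
    exact_mod_cast log_le_of_le_exp_nat (x := 12) 3 (by norm_num) (by norm_num)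
  linarith

/-- The closeness exponent used in the application of `two_logs_estimate`. -/
def closeExp (P : ℝ) : ℝ := 11 + 4 * Real.log (18 * P ^ 2) + 2 * Real.log (36 * P ^ 2)

set_option maxHeartbeats 800000 in
lemma two_logs_false (w : Pl K) {t A : K} (ht : t ≠ 0) (ht1 : t ≠ 1) (hA : A ≠ 0)
    {k r P : ℕ} (hk : 0 < k) (hP : 12 ≤ P) (hr : 10 ^ 8 * P ^ 4 ≤ r)
    (hHA : HH A ≤ gg * (r / (36 * P ^ 2))) (hHt : HH t ≤ 2 * gg * k)
    (hw : av w (t - 1) ≤ Real.exp (-(gg * closeExp P)))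
    (hw' : av w (A * t⁻¹ ^ r - 1) ≤ Real.exp (-(gg * (k * r / (2 * P))))) : False := by
  have hg := one_le_finrank (K := K)
  have hk1 : (1 : ℝ) ≤ k := by exact_mod_cast hk
  have hP1 : (12 : ℝ) ≤ P := by exact_mod_cast hP
  have hr1 : (10 : ℝ) ^ 8 * P ^ 4 ≤ r := by exact_mod_cast hr
  set a : ℝ := r / (12 * P ^ 2) with ha
  have hra : (r : ℝ) = 12 * P ^ 2 * a := by rw [ha]; field_simp
  have haP : 8 * 10 ^ 6 * (P : ℝ) ^ 2 ≤ a := by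
    rw [ha, le_div_iff₀ (by positivity)]
    nlinarith [pow_pos (show (0 : ℝ) < P by linarith) 4]
  have hr0 : (0 : ℝ) < r := lt_of_lt_of_le (by positivity) hr1
  have ha0 : 0 < a := lt_of_lt_of_le (by positivity) haP
  set D : ℕ := r / (12 * P ^ 2) with hD
  have hDa : (D : ℝ) ≤ a := by
    have := Nat.cast_div_le (α := ℝ) (m := r) (n := 12 * P ^ 2)
    push_cast at this
    exact this
  have haD : a ≤ D + 1 := by
    rw [ha, div_le_iff₀ (by positivity)]
    have := Nat.lt_div_mul_add (a := r) (b := 12 * P ^ 2) (by positivity)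
    have h2 : (r : ℝ) < D * (12 * P ^ 2) + 12 * P ^ 2 := by exact_mod_cast this
    linarith
  have hDr : D < r := by
    have : (D : ℝ) < r := by
      rw [hra]
      nlinarith [mul_pos (show (0 : ℝ) < 12 * P ^ 2 - 1 by nlinarith) ha0]
    exact_mod_cast this
  obtain ⟨M, hM⟩ : ∃ M, M + 1 = 3 * k := ⟨3 * k - 1, by omega⟩
  have hMr : (M : ℝ) + 1 = 3 * k := by exact_mod_cast hM
  set L₁ := Real.log (18 * P ^ 2) with hL₁
  set L₂ := Real.log (36 * P ^ 2) with hL₂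
  have hlogP := log_natCast_le hP1
  have hL1 : L₁ ≤ P / 6 + 7 := by
    rw [hL₁, Real.log_mul (by norm_num) (by positivity), Real.log_pow]
    have : Real.log 18 ≤ 3 := by
      exact_mod_cast log_le_of_le_exp_nat (x := 18) 3 (by norm_num) (by norm_num)
    push_cast; linarith
  have hL2 : L₂ ≤ P / 6 + 8 := by
    rw [hL₂, Real.log_mul (by norm_num) (by positivity), Real.log_pow]
    have : Real.log 36 ≤ 4 := by
      exact_mod_cast log_le_of_le_exp_nat (x := 36) 4 (by norm_num) (by norm_num)
    push_cast; linarith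
  have hP2 : (1 : ℝ) ≤ (P : ℝ) ^ 2 := one_le_pow₀ (by linarith only [hP1])
  have hL1' : 0 ≤ L₁ := Real.log_nonneg (by linarith only [hP2])
  have hL2' : 0 ≤ L₂ := Real.log_nonneg (by linarith only [hP2])
  have hN : ((r * M + D : ℕ) : ℝ) + 1 ≤ 3 * k * r := by
    have : r * M + D + 1 ≤ r * (M + 1) := by rw [mul_add]; omega
    rw [hM] at this
    have h2 : ((r * M + D : ℕ) : ℝ) + 1 ≤ r * (3 * k) := by exact_mod_cast this
    linarith
  have hN0 : (0 : ℝ) ≤ ((r * M + D : ℕ) : ℝ) := Nat.cast_nonneg _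
  have hy1 : Real.log ((18 * (P : ℝ) ^ 2)⁻¹) = -L₁ := by rw [Real.log_inv]
  have hy2 : Real.log ((36 * (P : ℝ) ^ 2)⁻¹) = -L₂ := by rw [Real.log_inv]
  have hNy1 : (18 * (P : ℝ) ^ 2)⁻¹ * ((r * M + D : ℕ) : ℝ) ≤ 2 * k * a := by
    rw [inv_mul_le_iff₀ (by positivity)]
    rw [hra] at hN
    linarith
  have hNy2 : (36 * (P : ℝ) ^ 2)⁻¹ * ((r * M + D : ℕ) : ℝ) ≤ k * a := by
    rw [inv_mul_le_iff₀ (by positivity)]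
    rw [hra] at hN
    linarith
  have hlog1 : Real.log (3 * k * (D + 1)) ≤ k * (a / 100 + 6) := by
    rw [mul_comm (3 : ℝ), mul_assoc, Real.log_mul (by positivity) (by positivity)]
    have h1 := Real.log_le_sub_one_of_pos (x := (k : ℝ)) (by positivity)
    have h2 := log_le_div_add (x := 3 * ((D : ℝ) + 1)) (by positivity)
    have h3 := mul_le_mul_of_nonneg_right hk1 (show 0 ≤ a / 100 + 5 by positivity)
    linarith only [h1, h2, h3, hDa]
  have hlog2 : Real.log (((r * M + D : ℕ) : ℝ) + 1) ≤ k * (a / 300 + 6 + L₂) := by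
    refine (Real.log_le_log (by positivity) hN).trans ?_
    rw [hra, show 3 * (k : ℝ) * (12 * P ^ 2 * a) = k * (36 * P ^ 2 * a) by ring,
      Real.log_mul (by positivity) (by positivity), Real.log_mul (by positivity) (by positivity)]
    have h1 := Real.log_le_sub_one_of_pos (x := (k : ℝ)) (by positivity)
    have h2 := log_le_div_add ha0
    have h3 := mul_le_mul_of_nonneg_right hk1 (show 0 ≤ a / 300 + 5 + L₂ by positivity)
    linarith only [h1, h2, h3, hk1]
  have hl2 : Real.log 2 ≤ 1 := by linarith [Real.log_two_lt_d9]
  have hl4 : Real.log 4 ≤ 2 := by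
    exact_mod_cast log_le_of_le_exp_nat (x := 4) 2 (by norm_num) (by norm_num)
  set l := closeExp P with hl
  have hlL : l = 11 + 4 * L₁ + 2 * L₂ := rfl
  have hexp : Real.exp (-l) ≤ (36 * (P : ℝ) ^ 2)⁻¹ := by
    rw [Real.exp_neg, inv_le_inv₀ (Real.exp_pos _) (by positivity),
        ← Real.log_le_iff_le_exp (by positivity)]
    rw [hlL]; linarith
  have hNe : ((r * M + D : ℕ) : ℝ) * Real.exp (-l) ≤ k * a := by
    refine (mul_le_mul_of_nonneg_left hexp hN0).trans ?_
    rw [mul_comm]; exact hNy2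
  have key := two_logs_estimate w ht ht1 hA hk hM hDr
    (B := Real.exp (2 * k * a + 2 * k * (a + 1) * L₁))
    (B₂ := Real.exp (k * a + k * (a + 4) * L₂)) (y := (36 * (P : ℝ) ^ 2)⁻¹) (l := l)
    (U := gg * (k * r / (2 * P))) (Real.one_le_exp (by positivity))
        (Real.one_le_exp (by positivity))
    (by positivity) (inv_le_one_of_one_le₀ (by linarith only [hP2])) (by rw [hy2, hlL]; linarith)
    (by positivity) ?_ ?_ hw hw'
  · rw [Real.log_exp, Real.log_exp, hy2] at key
    have hD2 : 2 ≤ D := by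
      have : (2 : ℝ) ≤ D := by linarith only [haD, haP, hP2]
      exact_mod_cast this
    have hDk : k * (a - 3) ≤ ((k * (D - 2) : ℕ) : ℝ) := by
      rw [Nat.cast_mul, Nat.cast_sub hD2]
      push_cast
      exact mul_le_mul_of_nonneg_left (by linarith) (by positivity)
    have hMH : M * HH A ≤ gg * (k * a) := by
      calc (M : ℝ) * HH A ≤ (3 * k) * (gg * (r / (36 * P ^ 2))) :=
            mul_le_mul (by linarith) hHA (HH_nonneg _) (by positivity)
        _ = gg * (k * a) := by rw [ha]; ring
    have hDH : D * HH t ≤ gg * (2 * (k * a)) := by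
      calc (D : ℝ) * HH t ≤ a * (2 * gg * k) := mul_le_mul hDa hHt (HH_nonneg _) ha0.le
        _ = gg * (2 * (k * a)) := by ring
    have haP' : 8 * 10 ^ 6 * (12 * (P : ℝ)) ≤ a := by
      have h := mul_le_mul_of_nonneg_right hP1 (show (0 : ℝ) ≤ P by positivity)
      linarith only [h, haP]
    rcases le_total (gg * (Real.log 2 + (r * M + D : ℕ) * Real.exp (-l) +
        Real.log ((r * M + D : ℕ) + 1) + (36 * (P : ℝ) ^ 2)⁻¹ * (r * M + D : ℕ) -
        (k * (D - 2) : ℕ) * -L₂) - gg * l * (k * (D - 2) : ℕ))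
      (gg * (Real.log 2 + (r * M + D : ℕ) * Real.exp (-l) +
        M * Real.log 4) - gg * (k * r / (2 * P))) with h | h
    · rw [max_eq_right h] at key
      have hMl : M * Real.log 4 ≤ 3 * k * 2 :=
        mul_le_mul (by linarith) hl4 (Real.log_nonneg (by norm_num)) (by positivity)
      have hkr : (k : ℝ) * r / (2 * P) = k * (6 * P * a) := by rw [hra]; field_simp; ring
      rw [hkr] at key
      have h3 : 0 ≤ gg * (k * (3 * (a / 100 + 6) + 2 * (2 * a + 2 * (a + 1) * L₁) +
          (a + (a + 4) * L₂) + a + 2 * a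
          + 1 + a + 6 - 6 * P * a)) := by
        refine key.trans ?_
        have : 3 * Real.log (3 * k * (D + 1)) + 2 * (2 * k * a + 2 * k * (a + 1) * L₁) +
            (k * a + k * (a + 4) * L₂)
            + k * a + 2 * (k * a) + (Real.log 2 + (r * M + D : ℕ) * Real.exp (-l) +
            M * Real.log 4) - k * (6 * P * a) ≤
                k * (3 * (a / 100 + 6) + 2 * (2 * a + 2 * (a + 1) * L₁) +
            (a + (a + 4) * L₂) + a + 2 * a + 1 + a + 6 - 6 * P * a) := by
          linarith
        have h4 := mul_le_mul_of_nonneg_left this (zero_le_one.trans hg)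
        linarith
      have h4 := nonneg_of_mul_nonneg_right h3 (by linarith)
      have h5 := nonneg_of_mul_nonneg_right h4 (by linarith)
      have h6 : L₁ * a ≤ (P / 6 + 7) * a := mul_le_mul_of_nonneg_right hL1 ha0.le
      have h7 : L₂ * a ≤ (P / 6 + 8) * a := mul_le_mul_of_nonneg_right hL2 ha0.le
      linarith [mul_le_mul_of_nonneg_right hP1 ha0.le]
    · rw [max_eq_left h] at key
      have h9 : k * (a - 3) * (11 + 4 * L₁ + L₂) ≤ ((k * (D - 2) : ℕ) : ℝ) * (11 + 4 * L₁ + L₂) :=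
        mul_le_mul_of_nonneg_right hDk (by positivity)
      have h3 : 0 ≤ gg * (k * (3 * (a / 100 + 6) + 2 * (2 * a + 2 * (a + 1) * L₁) +
          (a + (a + 4) * L₂) + a + 2 * a
          + 1 + a + (a / 300 + 6 + L₂) + a - (a - 3) * (11 + 4 * L₁ + L₂))) := by
        refine key.trans ?_
        have : 3 * Real.log (3 * k * (D + 1)) + 2 * (2 * k * a + 2 * k * (a + 1) * L₁) +
            (k * a + k * (a + 4) * L₂)
            + k * a + 2 * (k * a) + (Real.log 2 + (r * M + D : ℕ) * Real.exp (-l) +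
            Real.log ((r * M + D : ℕ) + 1) + (36 * (P : ℝ) ^ 2)⁻¹ * (r * M + D : ℕ) -
            (k * (D - 2) : ℕ) * -L₂) - l * (k * (D - 2) : ℕ) ≤
                k * (3 * (a / 100 + 6) + 2 * (2 * a + 2 * (a + 1) * L₁) +
            (a + (a + 4) * L₂) + a + 2 * a + 1 + a + (a / 300 + 6 + L₂) + a -
                (a - 3) * (11 + 4 * L₁ + L₂)) := by
          have h10 : l * ((k * (D - 2) : ℕ) : ℝ) =
              (11 + 4 * L₁ + 2 * L₂) * ((k * (D - 2) : ℕ) : ℝ) := by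
            rw [hlL]
          linarith
        have h4 := mul_le_mul_of_nonneg_left this (zero_le_one.trans hg)
        linarith
      have h4 := nonneg_of_mul_nonneg_right h3 (by linarith)
      have h5 := nonneg_of_mul_nonneg_right h4 (by linarith)
      linarith
  · intro i hi n hn
    refine (choose_le_exp (y := (18 * (P : ℝ) ^ 2)⁻¹) (by positivity) n i).trans
        (Real.exp_le_exp.2 ?_)
    have h3 : (n : ℝ) ≤ (r * M + D : ℕ) := by exact_mod_cast hn
    have h4 : (i : ℝ) ≤ 2 * k * (a + 1) := by
      have : (i : ℝ) ≤ 2 * k * (D + 1) := by exact_mod_cast hi.le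
      refine this.trans (mul_le_mul_of_nonneg_left (by linarith) (by positivity))
    have h5 := mul_le_mul_of_nonneg_right h4 hL1'
    have h6 := mul_le_mul_of_nonneg_left h3 (show 0 ≤ (18 * (P : ℝ) ^ 2)⁻¹ by positivity)
    rw [hy1]
    linarith
  · intro i hi n hn
    refine (choose_le_exp (y := (36 * (P : ℝ) ^ 2)⁻¹) (by positivity) n i).trans
        (Real.exp_le_exp.2 ?_)
    have h3 : (n : ℝ) ≤ (r * M + D : ℕ) := by exact_mod_cast hn
    have h4 : (i : ℝ) ≤ k * (a + 4) := by
      have : (i : ℝ) ≤ k * (D + 4) := by exact_mod_cast hi.le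
      refine this.trans (mul_le_mul_of_nonneg_left (by linarith) (by positivity))
    have h5 := mul_le_mul_of_nonneg_right h4 hL2'
    have h6 := mul_le_mul_of_nonneg_left h3 (show 0 ≤ (36 * (P : ℝ) ^ 2)⁻¹ by positivity)
    rw [hy2]
    linarith

end TwoLogsNumeric

section Counting

variable {K : Type*} [Field K] [NumberField K]

lemma ordAt_pos_of_mem {p : HeightOneSpectrum (𝓞 K)} {x : 𝓞 K} (hx : x ≠ 0) (h : x ∈ p.asIdeal) :
    0 < ordAt p (x : K) := by
  have hx' : (x : K) ≠ 0 := by simpa using hx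
  have h1 : p.valuation K (x : K) < 1 := by
    rw [show ((x : K)) = algebraMap (𝓞 K) K x from rfl, HeightOneSpectrum.valuation_lt_one_iff_mem]
    exact h
  rw [valuation_eq_exp p hx', ← WithZero.exp_zero, WithZero.exp_lt_exp] at h1
  omega

/-- A natural number lying in the prime `p`. -/
def below (p : HeightOneSpectrum (𝓞 K)) : ℕ := Ideal.absNorm (Ideal.under ℤ p.asIdeal)

lemma below_prime (p : HeightOneSpectrum (𝓞 K)) : (below p).Prime := by
  have : NeZero p.asIdeal := ⟨p.ne_bot⟩
  exact Nat.absNorm_under_prime p.asIdeal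

lemma below_mem (p : HeightOneSpectrum (𝓞 K)) : ((below p : ℕ) : 𝓞 K) ∈ p.asIdeal := by
  have := Int.absNorm_under_mem p.asIdeal
  exact_mod_cast this

lemma below_le (p : HeightOneSpectrum (𝓞 K)) : below p ≤ Ideal.absNorm p.asIdeal := by
  refine Nat.le_of_dvd ?_ (Int.absNorm_under_dvd_absNorm p.asIdeal)
  have := one_lt_norm p
  have h : 1 < Ideal.absNorm p.asIdeal := by exact_mod_cast this
  omega

lemma sum_neg_log_av_natCast_le {n : ℕ} (hn : n ≠ 0) (U : Finset (HeightOneSpectrum (𝓞 K))) :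
    ∑ p ∈ U, -Real.log (av (.inr p) (n : K)) ≤ Module.finrank ℚ K * Real.log n := by
  have hn' : (n : K) ≠ 0 := by exact_mod_cast hn
  have h1 := product_formula hn'
  have h2 : ∑ᶠ v : Pl K, -Real.log (av v (n : K)) = 0 := by rw [finsum_neg_distrib, h1, neg_zero]
  have h3 := sum_le_finsum (f := fun v : Pl K => cc v * Real.log n + -Real.log (av v (n : K)))
    ((FS_cc_mul _).add' (FS_log_av hn').neg') (fun v => by
      have := Real.log_le_log (av_pos v hn') (av_natCast_le v n)
      rw [Real.log_pow] at this
      linarith) (U.map ⟨Sum.inr, Sum.inr_injective⟩)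
  rw [finsum_add_distrib (FS_cc_mul _) (FS_log_av hn').neg', h2, sum_cc_mul, add_zero,
    Finset.sum_map] at h3
  simpa [cc] using h3

lemma card_below_le (U : Finset (HeightOneSpectrum (𝓞 K))) {ℓ : ℕ} (h : ∀ p ∈ U, below p = ℓ) :
    U.card ≤ Module.finrank ℚ K := by
  rcases U.eq_empty_or_nonempty with rfl | ⟨p₀, hp₀⟩
  · simp
  have hℓ : ℓ.Prime := h p₀ hp₀ ▸ below_prime p₀
  have hlog : 0 < Real.log ℓ := Real.log_pos (by exact_mod_cast hℓ.one_lt)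
  have h1 := sum_neg_log_av_natCast_le (K := K) hℓ.ne_zero U
  have h2 : U.card * Real.log ℓ ≤ ∑ p ∈ U, -Real.log (av (.inr p) (ℓ : K)) := by
    rw [← nsmul_eq_mul]
    refine Finset.card_nsmul_le_sum _ _ _ fun p hp => ?_
    have h0 : ((ℓ : ℕ) : 𝓞 K) ≠ 0 := by exact_mod_cast hℓ.ne_zero
    have h3 := ordAt_pos_of_mem (p := p) h0 (by rw [← h p hp]; exact below_mem p)
    rw [show (((ℓ : ℕ) : 𝓞 K) : K) = (ℓ : K) by simp] at h3
    rw [log_av_inr p (by exact_mod_cast hℓ.ne_zero)]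
    have h4 : Real.log ℓ ≤ Real.log (Ideal.absNorm p.asIdeal) := by
      refine Real.log_le_log (by exact_mod_cast hℓ.pos) ?_
      exact_mod_cast (h p hp) ▸ below_le p
    have h5 : (1 : ℝ) ≤ ordAt p (ℓ : K) := by exact_mod_cast h3
    nlinarith
  have h3 := le_of_mul_le_mul_right (h2.trans h1) hlog
  exact_mod_cast h3

lemma prod_inv_one_sub_le_two (s : Finset ℕ) (hs : ∀ n ∈ s, 2 ≤ n) :
    ∏ n ∈ s, (1 - ((n : ℝ) ^ 2)⁻¹)⁻¹ ≤ 2 := by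
  have h1 : ∀ N : ℕ, ∏ n ∈ Finset.Ico 2 (N + 2), (1 - ((n : ℝ) ^ 2)⁻¹)⁻¹ =
      2 * (N + 1) / (N + 2) := by
    intro N
    induction N with
    | zero => simp
    | succ N ih =>
      rw [Finset.prod_Ico_succ_top (by omega), ih]
      push_cast
      have : (1 : ℝ) - ((N + 2 : ℝ) ^ 2)⁻¹ = (N + 1) * (N + 3) / (N + 2) ^ 2 := by
        field_simp; ring
      rw [this]
      field_simp
      ring
  have hpos : ∀ n : ℕ, 2 ≤ n → 1 ≤ (1 - ((n : ℝ) ^ 2)⁻¹)⁻¹ := by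
    intro n hn
    have h2 : (2 : ℝ) ≤ n := by exact_mod_cast hn
    have h3 : ((n : ℝ) ^ 2)⁻¹ < 1 := inv_lt_one_of_one_lt₀ (by nlinarith)
    refine (one_le_inv₀ (by linarith)).2 ?_
    have : 0 ≤ ((n : ℝ) ^ 2)⁻¹ := by positivity
    linarith
  obtain ⟨N, hN⟩ : ∃ N, s ⊆ Finset.Ico 2 (N + 2) := by
    refine ⟨s.sup id, fun n hn => Finset.mem_Ico.2 ⟨hs n hn, ?_⟩⟩
    have := Finset.le_sup (f := id) hn
    simp only [id] at this
    omega
  calc _ ≤ ∏ n ∈ Finset.Ico 2 (N + 2), (1 - ((n : ℝ) ^ 2)⁻¹)⁻¹ := by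
        rw [← Finset.prod_sdiff hN]
        refine le_mul_of_one_le_left (Finset.prod_nonneg fun n hn => zero_le_one.trans
          (hpos n (hs n hn))) ?_
        refine Finset.prod_induction _ (fun x : ℝ => 1 ≤ x)
          (fun _ _ => one_le_mul_of_one_le_of_one_le)
          le_rfl fun n hn => hpos n ?_
        exact (Finset.mem_Ico.1 (Finset.mem_sdiff.1 hn).1).1
    _ = 2 * (N + 1) / (N + 2) := h1 N
    _ ≤ 2 := by rw [div_le_iff₀ (by positivity)]; linarith

/-- The number of exponent vectors (integral ideals) of bounded norm. -/
lemma card_exponents_le (U : Finset (HeightOneSpectrum (𝓞 K))) (T : Finset (U → ℕ)) {R : ℝ}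
    (h : ∀ f ∈ T, ∑ p, f p * Real.log (Ideal.absNorm p.1.asIdeal) ≤ R) :
    (T.card : ℝ) ≤ Real.exp (2 * R) * 2 ^ Module.finrank ℚ K := by
  set x : HeightOneSpectrum (𝓞 K) → ℝ := fun p => ((Ideal.absNorm p.asIdeal : ℝ) ^ 2)⁻¹ with hx
  have hx0 : ∀ p, 0 ≤ x p := fun p => by positivity
  have hx1 : ∀ p, x p ≤ ((below p : ℝ) ^ 2)⁻¹ := fun p => by
    have h1 : (0 : ℝ) < below p := by exact_mod_cast (below_prime p).pos
    have h2 : (below p : ℝ) ≤ Ideal.absNorm p.asIdeal := by exact_mod_cast below_le p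
    exact inv_anti₀ (by positivity) (by gcongr)
  have hb1 : ∀ p : HeightOneSpectrum (𝓞 K), ((below p : ℝ) ^ 2)⁻¹ < 1 := fun p => by
    have h2 : (2 : ℝ) ≤ below p := by exact_mod_cast (below_prime p).two_le
    exact inv_lt_one_of_one_lt₀ (by nlinarith)
  have hgeom : ∀ p, ∀ M : ℕ, ∑ i ∈ Finset.range M, x p ^ i ≤ (1 - ((below p : ℝ) ^ 2)⁻¹)⁻¹ := by
    intro p M
    have hlt : x p < 1 := (hx1 p).trans_lt (hb1 p)
    rw [← one_div, le_div_iff₀ (by linarith [hb1 p])]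
    have h1 := mul_neg_geom_sum (x p) M
    have h2 : 0 ≤ ∑ i ∈ Finset.range M, x p ^ i := Finset.sum_nonneg fun i _ => pow_nonneg (hx0 p) i
    nlinarith [hx1 p, pow_nonneg (hx0 p) M]
  obtain ⟨M, hM⟩ : ∃ M, ∀ f ∈ T, ∀ p, f p < M := by
    refine ⟨T.sup (fun f => Finset.univ.sup f) + 1, fun f hf p => Nat.lt_succ_of_le ?_⟩
    exact (Finset.le_sup (f := f) (Finset.mem_univ p)).trans
      (Finset.le_sup (f := fun f : U → ℕ => Finset.univ.sup f) hf)
  have hprod : ∏ p : U, (1 - ((below p.1 : ℝ) ^ 2)⁻¹)⁻¹ ≤ 2 ^ Module.finrank ℚ K := by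
    rw [Finset.prod_coe_sort U (fun p => (1 - ((below p : ℝ) ^ 2)⁻¹)⁻¹),
      ← Finset.prod_fiberwise_of_maps_to (t := U.image below) (g := below)
        (fun p hp => Finset.mem_image_of_mem _ hp)]
    calc _ ≤ ∏ n ∈ U.image below, ((1 - ((n : ℝ) ^ 2)⁻¹)⁻¹) ^ Module.finrank ℚ K := by
          refine Finset.prod_le_prod (fun n _ => Finset.prod_nonneg fun p _ =>
            inv_nonneg.2 (by linarith [hb1 p])) fun n hn => ?_
          obtain ⟨p₀, hp₀, rfl⟩ := Finset.mem_image.1 hn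
          rw [Finset.prod_congr rfl (g := fun _ => (1 - ((below p₀ : ℝ) ^ 2)⁻¹)⁻¹)
            (fun p hp => by rw [(Finset.mem_filter.1 hp).2]), Finset.prod_const]
          refine pow_le_pow_right₀ ?_ (card_below_le (ℓ := below p₀) _
            fun p hp => (Finset.mem_filter.1 hp).2)
          refine (one_le_inv₀ (by linarith [hb1 p₀])).2 ?_
          have : 0 ≤ ((below p₀ : ℝ) ^ 2)⁻¹ := by positivity
          linarith
      _ = (∏ n ∈ U.image below, (1 - ((n : ℝ) ^ 2)⁻¹)⁻¹) ^ Module.finrank ℚ K := by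
          rw [Finset.prod_pow]
      _ ≤ _ := by
          refine pow_le_pow_left₀ (Finset.prod_nonneg fun n hn => ?_)
            (prod_inv_one_sub_le_two _ ?_) _
          · obtain ⟨p, _, rfl⟩ := Finset.mem_image.1 hn
            exact inv_nonneg.2 (by linarith [hb1 p])
          · intro n hn
            obtain ⟨p, _, rfl⟩ := Finset.mem_image.1 hn
            exact (below_prime p).two_le
  have h1 : T.card * Real.exp (-(2 * R)) ≤ ∑ f ∈ T, ∏ p : U, x p.1 ^ f p := by
    rw [← nsmul_eq_mul]
    refine Finset.card_nsmul_le_sum _ _ _ fun f hf => ?_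
    have h2 : ∏ p : U, x p.1 ^ f p =
        Real.exp (-(2 * ∑ p, f p * Real.log (Ideal.absNorm p.1.asIdeal))) := by
      rw [Finset.mul_sum, ← Finset.sum_neg_distrib, Real.exp_sum]
      refine Finset.prod_congr rfl fun p _ => ?_
      have h3 := zero_lt_one.trans (one_lt_norm p.1)
      have h4 : x p.1 = Real.exp (-(2 * Real.log (Ideal.absNorm p.1.asIdeal))) := by
        rw [Real.exp_neg, two_mul, Real.exp_add, Real.exp_log h3, hx]
        ring_nf
      rw [h4, ← Real.exp_nat_mul]
      ring_nf
    rw [h2, Real.exp_le_exp]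
    linarith [h f hf]
  have h2 : ∑ f ∈ T, ∏ p : U, x p.1 ^ f p ≤ 2 ^ Module.finrank ℚ K := by
    calc _ ≤ ∑ f ∈ Fintype.piFinset (fun _ : U => Finset.range M), ∏ p : U, x p.1 ^ f p := by
          refine Finset.sum_le_sum_of_subset_of_nonneg (fun f hf => ?_)
            (fun f _ _ => Finset.prod_nonneg fun p _ => pow_nonneg (hx0 _) _)
          simpa using hM f hf
      _ = ∏ p : U, ∑ i ∈ Finset.range M, x p.1 ^ i := by rw [Finset.prod_univ_sum]
      _ ≤ ∏ p : U, (1 - ((below p.1 : ℝ) ^ 2)⁻¹)⁻¹ :=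
          Finset.prod_le_prod (fun p _ => Finset.sum_nonneg fun i _ => pow_nonneg (hx0 _) _)
            fun p _ => hgeom p.1 M
      _ ≤ _ := hprod
  have h3 := h1.trans h2
  rw [Real.exp_neg, ← div_eq_mul_inv, div_le_iff₀ (Real.exp_pos _)] at h3
  linarith

end Counting

section

variable {K : Type*} [Field K] [NumberField K]

/-- The logarithm of the norm of a finite place, `0` at infinite places. -/
def lq : Pl K → ℝ
  | .inl _ => 0
  | .inr p => Real.log (Ideal.absNorm p.asIdeal)

lemma lq_nonneg (v : Pl K) : 0 ≤ lq v := by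
  cases v with
  | inl w => exact le_rfl
  | inr p => exact (log_norm_pos p).le

section Color

lemma half_lt_log_norm (p : HeightOneSpectrum (𝓞 K)) :
    2 / 3 ≤ Real.log (Ideal.absNorm p.asIdeal) := by
  have h1 : (2 : ℝ) ≤ Ideal.absNorm p.asIdeal := by exact_mod_cast one_lt_norm p
  have h2 := Real.log_le_log two_pos h1
  linarith [Real.log_two_gt_d9]

lemma exists_color_finite (p : HeightOneSpectrum (𝓞 K)) {R Λ : ℝ} (hR : 0 ≤ R) (hΛ : 0 ≤ Λ) :
    ∃ (col : K → ℤ × ℤ) (C : Finset (ℤ × ℤ)),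
      (C.card : ℝ) ≤ 120 * (R + 1) * Real.exp (lq (.inr p)) * Real.exp Λ ∧
      (∀ x, x ≠ 0 → |Real.log (av (.inr p) x)| ≤ R → col x ∈ C) ∧
      ∀ x y, x ≠ 0 → y ≠ 0 → col x = col y → av (.inr p) (x / y - 1) ≤ Real.exp (-Λ) := by
  set N : ℝ := (Ideal.absNorm p.asIdeal : ℝ) with hN
  have hN1 : 1 < N := one_lt_norm p
  have hN0 : 0 < N := by linarith
  have hlN : 0 < Real.log N := log_norm_pos p
  set k : ℕ := ⌈Λ / Real.log N⌉₊ with hk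
  have hk1 : Λ ≤ k * Real.log N := by
    have := Nat.le_ceil (Λ / Real.log N)
    rwa [div_le_iff₀ hlN] at this
  have hk2 : k * Real.log N ≤ Λ + Real.log N := by
    have := (Nat.ceil_lt_add_one (div_nonneg hΛ hlN.le)).le
    calc (k : ℝ) * Real.log N ≤ (Λ / Real.log N + 1) * Real.log N := by gcongr
      _ = _ := by field_simp
  obtain ⟨ϖ, hϖ⟩ := p.valuation_exists_uniformizer K
  have hϖ0 : ϖ ≠ 0 := by
    rintro rfl
    rw [map_zero] at hϖ
    exact WithZero.exp_ne_zero hϖ.symm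
  have hunit : ∀ x : K, x ≠ 0 → p.valuation K (x * ϖ ^ (-ordAt p x)) = 1 := by
    intro x hx
    rw [map_mul, map_zpow₀, hϖ, valuation_eq_exp p hx, ← WithZero.exp_zsmul, ← WithZero.exp_add]
    simp
  have hex : ∀ x : K, x ≠ 0 → ∃ a : 𝓞 K,
      p.valuation K (algebraMap (𝓞 K) K a - x * ϖ ^ (-ordAt p x)) ≤ WithZero.exp (-(k : ℤ)) := by
    intro x hx
    obtain ⟨a, ha⟩ := p.exists_valuation_sub_lt_of_integer (hunit x hx).le
      (Units.mk0 (WithZero.exp (-(k : ℤ))) WithZero.exp_ne_zero)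
    exact ⟨a, ha.le⟩
  choose! a ha using hex
  have hfin : Finite (𝓞 K ⧸ p.asIdeal ^ k) :=
    Ideal.finiteQuotientOfFreeOfNeBot _ (pow_ne_zero k p.ne_bot)
  have := Fintype.ofFinite (𝓞 K ⧸ p.asIdeal ^ k)
  have hcard : (Fintype.card (𝓞 K ⧸ p.asIdeal ^ k) : ℝ) = N ^ k := by
    rw [hN, ← Nat.cast_pow, ← map_pow, Ideal.absNorm_apply, Submodule.cardQuot_apply,
      Nat.card_eq_fintype_card]
  set e := Fintype.equivFin (𝓞 K ⧸ p.asIdeal ^ k)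
  set B : ℕ := ⌊R / Real.log N⌋₊
  refine ⟨fun x => (ordAt p x, ((e (Ideal.Quotient.mk _ (a x))).val : ℤ)),
    Finset.Icc (-B : ℤ) B ×ˢ Finset.Ico (0 : ℤ) (Fintype.card (𝓞 K ⧸ p.asIdeal ^ k)), ?_, ?_, ?_⟩
  · rw [Finset.card_product, Int.card_Icc, Int.card_Ico]
    have h1 : ((B + 1 - -B : ℤ)).toNat = 2 * B + 1 := by omega
    rw [h1, sub_zero, Int.toNat_natCast]
    push_cast
    rw [hcard]
    have h2 : N ^ k ≤ Real.exp (lq (.inr p)) * Real.exp Λ := by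
      rw [← Real.exp_add, ← Real.log_le_iff_le_exp (by positivity), Real.log_pow]
      simp only [lq]
      linarith
    have h3 : (2 * B + 1 : ℝ) ≤ 120 * (R + 1) := by
      have h4 : (B : ℝ) ≤ R / Real.log N := Nat.floor_le (by positivity)
      rw [le_div_iff₀ hlN] at h4
      have h5 : (B : ℝ) * (2 / 3) ≤ B * Real.log N := by
        gcongr
        exact half_lt_log_norm p
      linarith
    rw [mul_assoc (120 * (R + 1))]
    gcongr
  · intro x hx h
    rw [log_av_inr p hx, abs_mul, abs_neg, abs_of_pos hlN, ← le_div_iff₀ hlN] at h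
    have h1 : |ordAt p x| ≤ B := by
      have h2 : (((|ordAt p x|).toNat : ℕ) : ℝ) ≤ R / Real.log N := by
        have : (((|ordAt p x|).toNat : ℤ) : ℝ) = |(ordAt p x : ℝ)| := by
          rw [Int.toNat_of_nonneg (abs_nonneg _), Int.cast_abs]
        rw [Int.cast_natCast] at this
        rwa [this]
      have h3 := Nat.le_floor h2
      have := abs_nonneg (ordAt p x)
      omega
    rw [abs_le] at h1
    rw [Finset.mem_product, Finset.mem_Icc, Finset.mem_Ico]
    refine ⟨h1, by simp, ?_⟩
    dsimp only
    exact_mod_cast (e (Ideal.Quotient.mk _ (a x))).isLt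
  · intro x y hx hy hxy
    simp only [Prod.mk.injEq, Nat.cast_inj] at hxy
    obtain ⟨h1, h2⟩ := hxy
    have h3 := e.injective (Fin.ext h2)
    rw [Ideal.Quotient.eq, ← p.intValuation_le_pow_iff_mem, ← p.valuation_of_algebraMap (K := K)]
      at h3
    change p.valuation K (algebraMap (𝓞 K) K (a x - a y)) ≤ _ at h3
    rw [map_sub] at h3
    by_cases hz : x / y - 1 = 0
    · rw [hz, map_zero]; positivity
    set z := x * ϖ ^ (-ordAt p x) - y * ϖ ^ (-ordAt p y) with hzdef
    have h4 : p.valuation K z ≤ WithZero.exp (-(k : ℤ)) := by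
      have : z = (algebraMap (𝓞 K) K (a x) - algebraMap (𝓞 K) K (a y))
          - (algebraMap (𝓞 K) K (a x) - x * ϖ ^ (-ordAt p x))
          + (algebraMap (𝓞 K) K (a y) - y * ϖ ^ (-ordAt p y)) := by rw [hzdef]; ring
      rw [this]
      exact (p.valuation K).map_add_le ((p.valuation K).map_sub_le h3 (ha x hx)) (ha y hy)
    have h5 : x / y - 1 = z / (y * ϖ ^ (-ordAt p y)) := by
      have : ϖ ^ (-ordAt p y) ≠ 0 := zpow_ne_zero _ hϖ0
      rw [hzdef, h1]
      field_simp
    have h6 : p.valuation K (x / y - 1) ≤ WithZero.exp (-(k : ℤ)) := by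
      rw [h5, map_div₀, hunit y hy, div_one]
      exact h4
    rw [valuation_eq_exp p hz, WithZero.exp_le_exp] at h6
    rw [← Real.log_le_iff_le_exp (av_pos _ hz), log_av_inr p hz]
    have h7 : (k : ℝ) ≤ ordAt p (x / y - 1) := by exact_mod_cast (by omega : (k : ℤ) ≤ _)
    have := mul_le_mul_of_nonneg_right h7 hlN.le
    linarith

lemma norm_div_sub_one_le {z z' : ℂ} (hz : z ≠ 0) (hz' : z' ≠ 0) {ε : ℝ} (hε : ε ≤ 1)
    (h1 : |Real.log ‖z‖ - Real.log ‖z'‖| ≤ ε / 4) (h2 : |z.arg - z'.arg| ≤ ε / 4) :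
    ‖z / z' - 1‖ ≤ ε := by
  have h3 : z / z' = Complex.exp (Complex.log z - Complex.log z') := by
    rw [Complex.exp_sub, Complex.exp_log hz, Complex.exp_log hz']
  have h4 : ‖Complex.log z - Complex.log z'‖ ≤ ε / 2 := by
    refine (Complex.norm_le_abs_re_add_abs_im _).trans ?_
    rw [Complex.sub_re, Complex.sub_im, Complex.log_re, Complex.log_re, Complex.log_im,
      Complex.log_im]
    linarith
  rw [h3]
  refine (Complex.norm_exp_sub_one_le (by linarith)).trans (by linarith)

lemma abs_sub_le_of_floor_eq {a b ε : ℝ} (hε : 0 < ε) (h : ⌊a / ε⌋ = ⌊b / ε⌋) : |a - b| ≤ ε := by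
  have h1 := (Int.abs_sub_lt_one_of_floor_eq_floor h).le
  rw [← sub_div, abs_div, abs_of_pos hε, div_le_one hε] at h1
  exact h1

lemma floor_mem_Icc {a ε B : ℝ} (hε : 0 < ε) (h : |a| ≤ B) :
    ⌊a / ε⌋ ∈ Finset.Icc (-(⌈B / ε⌉₊ : ℤ)) ⌈B / ε⌉₊ := by
  rw [abs_le] at h
  have h1 := Nat.le_ceil (B / ε)
  rw [Finset.mem_Icc, Int.le_floor]
  constructor
  · push_cast
    have : -(B / ε) ≤ a / ε := by rw [← neg_div]; gcongr; exact h.1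
    linarith
  · have h2 : (⌊a / ε⌋ : ℝ) ≤ (⌈B / ε⌉₊ : ℝ) := by
      refine (Int.floor_le _).trans (le_trans ?_ h1)
      gcongr; exact h.2
    exact_mod_cast h2

lemma card_Icc_ceil_le {B ε : ℝ} (hε : 0 < ε) (hB : 0 ≤ B) :
    ((Finset.Icc (-(⌈B / ε⌉₊ : ℤ)) ⌈B / ε⌉₊).card : ℝ) ≤ 2 * (B / ε) + 3 := by
  rw [Int.card_Icc]
  have h1 : ((⌈B / ε⌉₊ : ℤ) + 1 - -(⌈B / ε⌉₊ : ℤ)).toNat = 2 * ⌈B / ε⌉₊ + 1 := by omega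
  rw [h1]
  push_cast
  linarith [Nat.ceil_lt_add_one (div_nonneg hB hε.le)]

lemma exists_color_infinite (w : InfinitePlace K) {R Λ : ℝ} (hR : 0 ≤ R) (hΛ : 0 ≤ Λ) :
    ∃ (col : K → ℤ × ℤ) (C : Finset (ℤ × ℤ)),
      (C.card : ℝ) ≤ 120 * (R + 1) * Real.exp Λ ∧
      (∀ x, x ≠ 0 → |Real.log (av (.inl w) x)| ≤ R → col x ∈ C) ∧
      ∀ x y, x ≠ 0 → y ≠ 0 → col x = col y → av (.inl w) (x / y - 1) ≤ Real.exp (-Λ) := by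
  set M : ℝ := (w.mult : ℝ) with hM
  have hM1 : 1 ≤ M := by rw [hM]; exact_mod_cast w.mult_pos
  have hM0 : 0 < M := by linarith
  set ε : ℝ := Real.exp (-(Λ / M)) with hε
  have hε0 : 0 < ε := Real.exp_pos _
  have hε1 : ε ≤ 1 := by
    rw [hε, Real.exp_le_one_iff]
    have := div_nonneg hΛ hM0.le
    linarith
  have hε4 : 0 < ε / 4 := by positivity
  have hεM : ε ^ w.mult = Real.exp (-Λ) := by
    rw [hε, ← Real.exp_nat_mul]
    congr 1
    rw [← hM]
    field_simp
  have hnorm : ∀ x, ‖w.embedding x‖ = w x := fun x => w.norm_embedding_eq x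
  have hlog : ∀ x, Real.log (av (.inl w) x) = M * Real.log ‖w.embedding x‖ := by
    intro x
    rw [log_av_eq, hnorm]; rfl
  have hclose : ∀ x y : K, x ≠ 0 → y ≠ 0 →
      |Real.log ‖w.embedding x‖ - Real.log ‖w.embedding y‖| ≤ ε / 4 →
      |(w.embedding x).arg - (w.embedding y).arg| ≤ ε / 4 →
      av (.inl w) (x / y - 1) ≤ Real.exp (-Λ) := by
    intro x y hx hy h1 h2
    have h3 := norm_div_sub_one_le (by simpa using hx) (by simpa using hy) hε1 h1 h2
    rw [← hεM]
    have h4 : w (x / y - 1) ≤ ε := by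
      rw [← hnorm]
      simpa using h3
    exact pow_le_pow_left₀ (apply_nonneg _ _) h4 _
  have hinv : ε⁻¹ ^ w.mult = Real.exp Λ := by
    rw [inv_pow, hεM, Real.exp_neg, inv_inv]
  have hmem : ∀ x, |Real.log (av (.inl w) x)| ≤ R → |Real.log ‖w.embedding x‖| ≤ R / M := by
    intro x h
    rw [hlog, abs_mul, abs_of_pos hM0] at h
    rwa [le_div_iff₀ hM0, mul_comm]
  have hε5 : 1 ≤ ε⁻¹ := (one_le_inv₀ hε0).2 hε1
  have hRM := div_nonneg hR hM0.le
  have hdiv : ∀ B, B / (ε / 4) = 4 * B * ε⁻¹ := fun B => by field_simp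
  by_cases hw : w.IsReal
  · have hmult : w.mult = 1 := by rw [InfinitePlace.mult, if_pos hw]
    refine ⟨fun x => (⌊Real.log ‖w.embedding x‖ / (ε / 4)⌋,
      if (w.embedding x).arg = 0 then 0 else 1),
      Finset.Icc (-(⌈(R / M) / (ε / 4)⌉₊ : ℤ)) ⌈(R / M) / (ε / 4)⌉₊ ×ˢ {0, 1}, ?_, ?_, ?_⟩
    · rw [Finset.card_product]
      have h1 := card_Icc_ceil_le hε4 hRM
      rw [hdiv] at h1
      have h2 : M = 1 := by rw [hM, hmult]; simp
      have h3 : ((({0, 1} : Finset ℤ)).card : ℝ) = 2 := by norm_num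
      rw [hmult, pow_one] at hinv
      push_cast
      rw [h3, ← hinv]
      rw [h2, div_one] at h1
      rw [h2, div_one, hdiv]
      nlinarith [mul_nonneg hR (by linarith : 0 ≤ ε⁻¹)]
    · intro x hx h
      rw [Finset.mem_product]
      refine ⟨floor_mem_Icc hε4 (hmem x h), ?_⟩
      dsimp only
      split_ifs <;> simp
    · intro x y hx hy hxy
      simp only [Prod.mk.injEq] at hxy
      refine hclose x y hx hy (abs_sub_le_of_floor_eq hε4 hxy.1) ?_
      have harg : ∀ x : K, (w.embedding x).arg = 0 ∨ (w.embedding x).arg = Real.pi := by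
        intro x
        have h1 := InfinitePlace.embedding_of_isReal_apply hw x
        rw [← h1]
        rcases le_or_gt 0 (InfinitePlace.embedding_of_isReal hw x) with h | h
        · left; exact Complex.arg_ofReal_of_nonneg h
        · right; exact Complex.arg_ofReal_of_neg h
      have hpi := Real.pi_ne_zero
      have h2 : (w.embedding x).arg = (w.embedding y).arg := by
        rcases harg x with h | h <;> rcases harg y with h' | h' <;> simp_all
      rw [h2, sub_self, abs_zero]
      exact hε4.le
  · have hmult : w.mult = 2 := by rw [InfinitePlace.mult, if_neg hw]
    refine ⟨fun x => (⌊Real.log ‖w.embedding x‖ / (ε / 4)⌋, ⌊(w.embedding x).arg / (ε / 4)⌋),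
      Finset.Icc (-(⌈(R / M) / (ε / 4)⌉₊ : ℤ)) ⌈(R / M) / (ε / 4)⌉₊ ×ˢ
        Finset.Icc (-(⌈Real.pi / (ε / 4)⌉₊ : ℤ)) ⌈Real.pi / (ε / 4)⌉₊, ?_, ?_, ?_⟩
    · rw [Finset.card_product]
      have h1 := card_Icc_ceil_le hε4 hRM
      have h1' := card_Icc_ceil_le hε4 Real.pi_pos.le
      have h2 : M = 2 := by rw [hM, hmult]; simp
      rw [hmult] at hinv
      push_cast
      rw [← hinv]
      calc _ ≤ (2 * (R / M / (ε / 4)) + 3) * (2 * (Real.pi / (ε / 4)) + 3) := by gcongr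
        _ = (4 * R * ε⁻¹ + 3) * (8 * Real.pi * ε⁻¹ + 3) := by rw [hdiv, hdiv, h2]; ring
        _ ≤ ((4 * R + 3) * ε⁻¹) * (29 * ε⁻¹) := by
            have h5 : 8 * Real.pi * ε⁻¹ + 3 ≤ 29 * ε⁻¹ := by
              nlinarith [mul_le_mul_of_nonneg_right Real.pi_lt_d2.le (zero_le_one.trans hε5)]
            have h6 : 4 * R * ε⁻¹ + 3 ≤ (4 * R + 3) * ε⁻¹ := by linarith
            have h7 : 0 ≤ 8 * Real.pi * ε⁻¹ + 3 := by positivity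
            gcongr
        _ ≤ _ := by nlinarith [mul_nonneg hR (sq_nonneg ε⁻¹), sq_nonneg ε⁻¹]
    · intro x hx h
      rw [Finset.mem_product]
      exact ⟨floor_mem_Icc hε4 (hmem x h), floor_mem_Icc hε4 (Complex.abs_arg_le_pi _)⟩
    · intro x y hx hy hxy
      simp only [Prod.mk.injEq] at hxy
      exact hclose x y hx hy (abs_sub_le_of_floor_eq hε4 hxy.1) (abs_sub_le_of_floor_eq hε4 hxy.2)

lemma exists_color (w : Pl K) {R Λ : ℝ} (hR : 0 ≤ R) (hΛ : 0 ≤ Λ) :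
    ∃ (col : K → ℤ × ℤ) (C : Finset (ℤ × ℤ)),
      (C.card : ℝ) ≤ 120 * (R + 1) * Real.exp (lq w) * Real.exp Λ ∧
      (∀ x, x ≠ 0 → |Real.log (av w x)| ≤ R → col x ∈ C) ∧
      ∀ x y, x ≠ 0 → y ≠ 0 → col x = col y → av w (x / y - 1) ≤ Real.exp (-Λ) := by
  cases w with
  | inl w => simpa [lq] using exists_color_infinite w hR hΛ
  | inr p => exact exists_color_finite p hR hΛ

end Color

end

section

variable {K : Type*} [Field K] [NumberField K]

section Minkowski

open FractionalIdeal nonZeroDivisors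

lemma count_spanSingleton (p : HeightOneSpectrum (𝓞 K)) {x : K} (hx : x ≠ 0) :
    count K p (spanSingleton (𝓞 K)⁰ x) = ordAt p x := by
  have h : ∀ r : 𝓞 K, r ≠ 0 → (ordAt p (algebraMap (𝓞 K) K r) : ℤ) =
      (Associates.mk p.asIdeal).count (Associates.mk (Ideal.span {r})).factors := by
    intro r hr
    have h1 : algebraMap (𝓞 K) K r ≠ 0 := by simpa using hr
    have h2 := valuation_eq_exp p h1
    rw [p.valuation_of_algebraMap, p.intValuation_if_neg hr, WithZero.exp_inj] at h2
    omega
  obtain ⟨r, s, hs, rfl⟩ := IsFractionRing.div_surjective (A := 𝓞 K) x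
  have hs0 : s ≠ 0 := nonZeroDivisors.ne_zero hs
  have hs1 : algebraMap (𝓞 K) K s ≠ 0 := by simpa using hs0
  have hr1 : algebraMap (𝓞 K) K r ≠ 0 := fun h => hx (by rw [h, zero_div])
  have hr0 : r ≠ 0 := by rintro rfl; simp at hr1
  rw [count_well_defined K p (a := s) (J := Ideal.span {r}) (spanSingleton_ne_zero_iff.2 hx),
    ordAt_div p hr1 hs1,
    h r hr0, h s hs0]
  rw [coeIdeal_span_singleton, spanSingleton_mul_spanSingleton, div_eq_inv_mul]

lemma exists_small (U : Finset (HeightOneSpectrum (𝓞 K))) (n : HeightOneSpectrum (𝓞 K) → ℤ)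
    (b : InfinitePlace K → ℝ)
    (h : Real.log |(NumberField.discr K : ℝ)| / 2 +
      ∑ p ∈ U, n p * Real.log (Ideal.absNorm p.asIdeal) < ∑ w, b w) :
    ∃ x : K, x ≠ 0 ∧ (∀ w : InfinitePlace K, Real.log (av (.inl w) x) ≤ b w) ∧
      ∀ p, (if p ∈ U then n p else 0) ≤ ordAt p x := by
  have hp0 : ∀ p : HeightOneSpectrum (𝓞 K), (p.asIdeal : FractionalIdeal (𝓞 K)⁰ K) ≠ 0 :=
    fun p => coeIdeal_ne_zero.2 p.ne_bot
  set J : FractionalIdeal (𝓞 K)⁰ K := ∏ p ∈ U, (p.asIdeal : FractionalIdeal (𝓞 K)⁰ K) ^ n p with hJ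
  have hJ0 : J ≠ 0 := Finset.prod_ne_zero_iff.2 fun p _ => zpow_ne_zero _ (hp0 p)
  have hcount : ∀ p, count K p J = if p ∈ U then n p else 0 := by
    intro p
    rw [hJ, count_prod K p _ _ (fun q _ => zpow_ne_zero _ (hp0 q))]
    have : ∀ q ∈ U, count K p ((q.asIdeal : FractionalIdeal (𝓞 K)⁰ K) ^ n q) =
        if p = q then n q else 0 := by
      intro q _
      split_ifs with h
      · rw [h, count_zpow_self]
      · rw [count_zpow, count_maximal_coprime K p (Ne.symm h), mul_zero]
    rw [Finset.sum_congr rfl this, Finset.sum_ite_eq]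
  have hnorm : (absNorm J : ℝ) =
      Real.exp (∑ p ∈ U, n p * Real.log (Ideal.absNorm p.asIdeal)) := by
    rw [hJ, map_prod, Real.exp_sum]
    push_cast
    refine Finset.prod_congr rfl fun p _ => ?_
    have hN := zero_lt_one.trans (one_lt_norm p)
    rw [map_zpow₀, coeIdeal_absNorm, mul_comm, ← Real.rpow_def_of_pos hN, Real.rpow_intCast]
    push_cast
    rfl
  set f : InfinitePlace K → NNReal := fun w => ⟨Real.exp (b w / w.mult), (Real.exp_pos _).le⟩
  obtain ⟨x, hxJ, hx0, hx⟩ :=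
      mixedEmbedding.exists_ne_zero_mem_ideal_lt K (f := f) (Units.mk0 J hJ0) (by
    have hfin : MeasureTheory.volume (mixedEmbedding.convexBodyLT K f) ≠ ⊤ := by
      rw [mixedEmbedding.convexBodyLT_volume]
      exact ENNReal.mul_ne_top ENNReal.coe_ne_top ENNReal.coe_ne_top
    rw [← ENNReal.toReal_lt_toReal (mixedEmbedding.minkowskiBound_lt_top K _).ne hfin,
      mixedEmbedding.convexBodyLT_volume, mixedEmbedding.minkowskiBound,
      mixedEmbedding.volume_fundamentalDomain_fractionalIdealLatticeBasis,
      mixedEmbedding.volume_fundamentalDomain_latticeBasis, mixedEmbedding.finrank]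
    simp only [ENNReal.toReal_mul, ENNReal.toReal_pow, ENNReal.toReal_inv, ENNReal.coe_toReal,
      ENNReal.toReal_ofNat, Units.val_mk0]
    rw [ENNReal.toReal_ofReal (Rat.cast_nonneg.mpr (absNorm_nonneg J)), hnorm,
      ← InfinitePlace.card_add_two_mul_card_eq_rank]
    have hΔ : Real.sqrt |(NumberField.discr K : ℝ)| =
        Real.exp (Real.log |(NumberField.discr K : ℝ)| / 2) := by
      have h0 : 0 < |(NumberField.discr K : ℝ)| :=
        abs_pos.2 (by exact_mod_cast NumberField.discr_ne_zero K)
      rw [Real.exp_half, Real.exp_log h0]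
    have hprod : ((∏ w, f w ^ w.mult : NNReal) : ℝ) = Real.exp (∑ w, b w) := by
      push_cast
      rw [Real.exp_sum]
      refine Finset.prod_congr rfl fun w _ => ?_
      have hw : (w.mult : ℝ) ≠ 0 := by exact_mod_cast w.mult_ne_zero
      change Real.exp (b w / w.mult) ^ w.mult = _
      rw [← Real.exp_nat_mul]
      congr 1
      field_simp
    rw [hprod]
    have hd : ((NNReal.sqrt ‖NumberField.discr K‖₊ : NNReal) : ℝ) =
        Real.sqrt |(NumberField.discr K : ℝ)| := by
      rw [Real.coe_sqrt, coe_nnnorm, Int.norm_eq_abs]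
    rw [hd, hΔ]
    push_cast
    set r1 := InfinitePlace.nrRealPlaces K
    set r2 := InfinitePlace.nrComplexPlaces K
    have h1 : (2 : ℝ)⁻¹ ^ r2 * 2 ^ (r1 + 2 * r2) = 2 ^ r1 * 2 ^ r2 := by
      rw [pow_add, pow_mul', sq, inv_pow]
      field_simp
    have h2 : (2 : ℝ) ^ r1 * 2 ^ r2 ≤ 2 ^ r1 * Real.pi ^ r2 := by
      gcongr
      exact Real.two_le_pi
    have h3 := Real.exp_lt_exp.2 h
    rw [Real.exp_add] at h3
    rw [NNReal.coe_real_pi]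
    calc _ = (2 : ℝ)⁻¹ ^ r2 * 2 ^ (r1 + 2 * r2) *
          (Real.exp (Real.log |(NumberField.discr K : ℝ)| / 2) *
          Real.exp (∑ p ∈ U, n p * Real.log (Ideal.absNorm p.asIdeal))) := by ring
      _ < 2 ^ r1 * 2 ^ r2 * Real.exp (∑ w, b w) := by rw [h1]; gcongr
      _ ≤ _ := by gcongr)
  refine ⟨x, hx0, fun w => ?_, fun p => ?_⟩
  · have h1 : w x ≤ Real.exp (b w / w.mult) := (hx w).le
    have hw : 0 < w x := InfinitePlace.pos_iff.2 hx0
    rw [← Real.log_le_iff_le_exp hw, le_div_iff₀ (by exact_mod_cast w.mult_pos)] at h1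
    rw [log_av_eq, mul_comm]
    exact h1
  · rw [← hcount, ← count_spanSingleton p hx0]
    refine count_mono K p (spanSingleton_ne_zero_iff.2 hx0) ?_
    rw [spanSingleton_le_iff_mem]
    exact hxJ

end Minkowski

section Approx

variable (K) in
/-- Half the logarithm of the discriminant, plus one. -/
def halfLogDiscr : ℝ := Real.log |(NumberField.discr K : ℝ)| / 2 + 1

variable (K) in
lemma one_le_abs_discr : (1 : ℝ) ≤ |(NumberField.discr K : ℝ)| := by
  have := Int.one_le_abs (NumberField.discr_ne_zero K)
  exact_mod_cast this

variable (K) in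
lemma one_le_halfLogDiscr : 1 ≤ halfLogDiscr K := by
  have := Real.log_nonneg (one_le_abs_discr K)
  unfold halfLogDiscr
  linarith

lemma sum_eq_inl_add_inr {S : Finset (Pl K)} (hS : ∀ w, .inl w ∈ S) (f : Pl K → ℝ) :
    ∑ v ∈ S, f v = ∑ w, f (.inl w) + ∑ p ∈ S.toRight, f (.inr p) := by
  conv_lhs => rw [← Finset.toLeft_disjSum_toRight (u := S)]
  rw [Finset.sum_disjSum]
  congr 2
  ext w
  simpa using hS w

theorem exists_approx {S : Finset (Pl K)} (hS : ∀ w, .inl w ∈ S) (τ : Pl K → ℝ) :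
    ∃ γ : K, γ ≠ 0 ∧
      (∀ v ∈ S, |Real.log (av v γ) - τ v| ≤
        halfLogDiscr K + ∑ v ∈ S, lq v + |∑ v ∈ S, τ v|) ∧
      (∀ v ∉ S, av v γ ≤ 1) ∧
      - ∑ᶠ v, off S (fun v => Real.log (av v γ)) v ≤ halfLogDiscr K := by
  set R1 := halfLogDiscr K with hR1
  have hR1' := one_le_halfLogDiscr K
  rw [← hR1] at hR1'
  set n : HeightOneSpectrum (𝓞 K) → ℤ := fun p =>
    ⌈-τ (.inr p) / Real.log (Ideal.absNorm p.asIdeal)⌉ with hn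
  set b' : Pl K → ℝ := Sum.elim (fun w => τ (.inl w))
    (fun p => -(n p * Real.log (Ideal.absNorm p.asIdeal))) with hb'
  have hb'1 : ∀ v, b' v ≤ τ v := by
    rintro (w | p)
    · exact le_rfl
    · simp only [hb', Sum.elim_inr, hn]
      have h1 := Int.le_ceil (-τ (.inr p) / Real.log (Ideal.absNorm p.asIdeal))
      rw [div_le_iff₀ (log_norm_pos p)] at h1
      linarith
  have hb'2 : ∀ v, τ v - lq v ≤ b' v := by
    rintro (w | p)
    · simp [hb', lq]
    · simp only [hb', Sum.elim_inr, hn, lq]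
      have h0 := log_norm_pos p
      have h1 := (Int.ceil_lt_add_one (-τ (.inr p) / Real.log (Ideal.absNorm p.asIdeal))).le
      have h2 := mul_le_mul_of_nonneg_right h1 h0.le
      rw [add_mul, div_mul_cancel₀ _ h0.ne'] at h2
      linarith
  obtain ⟨w0⟩ := (inferInstance : Nonempty (InfinitePlace K))
  set X := ∑ v ∈ S, b' v with hX
  have hX1 : X ≤ ∑ v ∈ S, τ v := Finset.sum_le_sum fun v _ => hb'1 v
  have hX2 : ∑ v ∈ S, τ v - ∑ v ∈ S, lq v ≤ X := by
    rw [← Finset.sum_sub_distrib]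
    exact Finset.sum_le_sum fun v _ => hb'2 v
  set b : Pl K → ℝ := fun v => b' v + if v = .inl w0 then R1 - X else 0 with hb
  have hbS : ∑ v ∈ S, b v = R1 := by
    rw [hb, Finset.sum_add_distrib, Finset.sum_ite_eq', if_pos (hS w0), ← hX]
    ring
  have hbr : ∀ p, b (.inr p) = -(n p * Real.log (Ideal.absNorm p.asIdeal)) := fun p => by
    simp [hb, hb']
  obtain ⟨γ, hγ0, hγi, hγp⟩ := exists_small S.toRight n (fun w => b (.inl w)) (by
    have h1 := sum_eq_inl_add_inr hS b
    rw [hbS] at h1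
    simp only [hbr, Finset.sum_neg_distrib] at h1
    simp only [hR1, halfLogDiscr] at h1
    linarith)
  have hup : ∀ v ∈ S, Real.log (av v γ) ≤ b v := by
    rintro (w | p) hv
    · exact hγi w
    · have h1 := hγp p
      rw [if_pos (by simpa using hv)] at h1
      rw [log_av_inr p hγ0, hbr]
      have h2 : (n p : ℝ) ≤ ordAt p γ := by exact_mod_cast h1
      have := mul_le_mul_of_nonneg_right h2 (log_norm_pos p).le
      linarith
  have hout : ∀ v ∉ S, av v γ ≤ 1 := by
    rintro (w | p) hv
    · exact absurd (hS w) hv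
    · have h1 := hγp p
      rw [if_neg (by simpa using hv)] at h1
      exact (av_inr_le_one p).2 h1
  have hpf := finsum_eq_sum_add_off (FS_log_av hγ0) S
  rw [product_formula hγ0] at hpf
  have hoff : ∑ᶠ v, off S (fun v => Real.log (av v γ)) v ≤ 0 := by
    have : 0 ≤ ∑ᶠ v, - off S (fun v => Real.log (av v γ)) v := by
      refine finsum_nonneg fun v => ?_
      by_cases hv : v ∈ S
      · rw [off_of_mem hv, neg_zero]
      · rw [off_of_notMem hv]
        linarith [Real.log_nonpos (av_nonneg v γ) (hout v hv)]
    rw [finsum_neg_distrib] at this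
    linarith
  have hsum := Finset.sum_le_sum hup
  rw [hbS] at hsum
  have hlow : ∀ v ∈ S, b v - R1 ≤ Real.log (av v γ) := by
    intro v hv
    have h1 := Finset.sum_le_sum fun u (hu : u ∈ S.erase v) => hup u (Finset.mem_of_mem_erase hu)
    have h2 := Finset.add_sum_erase S (fun v => Real.log (av v γ)) hv
    have h3 := Finset.add_sum_erase S b hv
    linarith
  refine ⟨γ, hγ0, fun v hv => ?_, hout, by linarith⟩
  have h1 := hup v hv
  have h2 := hlow v hv
  have h3 := le_abs_self (∑ v ∈ S, τ v)
  have h4 := neg_abs_le (∑ v ∈ S, τ v)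
  have h5 := Finset.single_le_sum (fun u _ => lq_nonneg u) hv
  have h6 := lq_nonneg v
  have h7 := hb'1 v
  have h8 := hb'2 v
  rw [abs_le]
  simp only [hb] at h1 h2
  by_cases hv0 : v = .inl w0
  · rw [if_pos hv0] at h1 h2
    have h9 : lq v = 0 := by rw [hv0]; rfl
    constructor <;> linarith
  · rw [if_neg hv0] at h1 h2
    constructor <;> linarith

end Approx

end

section

variable {K : Type*} [Field K] [NumberField K]

local notation "gg" => (Module.finrank ℚ K : ℝ)

section Pigeonhole

lemma finite_ordAt_ne_zero {x : K} (hx : x ≠ 0) :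
    {p : HeightOneSpectrum (𝓞 K) | ordAt p x ≠ 0}.Finite := by
  refine ((FS_log_av hx).preimage (Sum.inr_injective.injOn)).subset fun p hp => ?_
  simp only [Set.mem_preimage, Function.mem_support, log_av_inr p hx]
  exact mul_ne_zero (neg_ne_zero.2 (Int.cast_ne_zero.2 hp)) (log_norm_pos p).ne'

/-- The number of cells for the normalised logarithms of approximants. -/
def cellScale (S : Finset (Pl K)) : ℝ := (halfLogDiscr K + ∑ v ∈ S, lq v) / gg + 1

lemma one_le_cellScale (S : Finset (Pl K)) : 1 ≤ cellScale S := by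
  have h1 := one_le_halfLogDiscr K
  have h2 : 0 ≤ ∑ v ∈ S, lq v := Finset.sum_nonneg fun v _ => lq_nonneg v
  have h3 : 0 ≤ (halfLogDiscr K + ∑ v ∈ S, lq v) / gg := by positivity
  unfold cellScale
  linarith

lemma exists_ratio {S : Finset (Pl K)} (hS : ∀ w, .inl w ∈ S) {w : Pl K} (hw : w ∈ S) {N0 : ℕ}
    (τ : ℕ → Pl K → ℝ) (hτw : ∀ q, τ q w = 0) (hτ : ∀ q ≤ N0, |∑ v ∈ S, τ q v| ≤ gg)
    {ε : ℝ} (hε : 0 < ε) (hε1 : ε ≤ 1) {Λ : ℝ} (hΛ : 0 ≤ Λ)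
    (hN : Real.exp (2 * halfLogDiscr K) * 2 ^ Module.finrank ℚ K *
      (5 * cellScale S / ε) ^ S.card *
      (120 * (gg * cellScale S + 1) * Real.exp (lq w) * Real.exp Λ) ≤ N0) :
    ∃ q q', q' < q ∧ q ≤ N0 ∧ ∃ η : K, η ≠ 0 ∧ (∀ v ∉ S, Real.log (av v η) = 0) ∧
      (∀ v ∈ S, |Real.log (av v η) - (τ q v - τ q' v)| ≤ gg * ε) ∧
      av w (η⁻¹ - 1) ≤ Real.exp (-Λ) := by
  have hg := one_le_finrank (K := K)
  have hg0 : 0 < gg := by linarith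
  set W := cellScale S with hW
  have hW1 : 1 ≤ W := one_le_cellScale S
  have hR : halfLogDiscr K + ∑ v ∈ S, lq v + gg = gg * W := by
    rw [hW, cellScale]
    field_simp
  choose γ hγ0 hγS hγout hγoff using fun q => exists_approx hS (τ q)
  have hγS' : ∀ q ≤ N0, ∀ v ∈ S, |Real.log (av v (γ q)) - τ q v| ≤ gg * W := by
    intro q hq v hv
    rw [← hR]
    linarith [hγS q v hv, hτ q hq]
  have hγw : ∀ q ≤ N0, |Real.log (av w (γ q))| ≤ gg * W := by
    intro q hq
    have := hγS' q hq w hw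
    rwa [hτw, sub_zero] at this
  obtain ⟨col, C, hC, hcol, hcol'⟩ := exists_color w (R := gg * W) (by positivity) hΛ
  set U : Finset (HeightOneSpectrum (𝓞 K)) :=
    (Finset.range (N0 + 1)).biUnion fun q =>
      (finite_ordAt_ne_zero (hγ0 q)).toFinset.filter fun p => Sum.inr p ∉ S with hU
  have hUS : ∀ p : U, (Sum.inr p.1 : Pl K) ∉ S := by
    rintro ⟨p, hp⟩
    simp only [hU, Finset.mem_biUnion, Finset.mem_filter] at hp
    obtain ⟨q, _, _, h⟩ := hp
    exact h
  have hord0 : ∀ q, ∀ p : U, 0 ≤ ordAt p.1 (γ q) := fun q p =>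
    (av_inr_le_one p.1).1 (hγout q _ (hUS p))
  set expo : ℕ → U → ℕ := fun q p => (ordAt p.1 (γ q)).toNat with hexpo
  have hexpo_cast : ∀ q p, ((expo q p : ℕ) : ℝ) = ordAt p.1 (γ q) := by
    intro q p
    have := Int.toNat_of_nonneg (hord0 q p)
    exact_mod_cast this
  set T1 := (Finset.range (N0 + 1)).image expo with hT1
  have hT1card : (T1.card : ℝ) ≤ Real.exp (2 * halfLogDiscr K) * 2 ^ Module.finrank ℚ K := by
    refine card_exponents_le U T1 fun f hf => ?_
    obtain ⟨q, _, rfl⟩ := Finset.mem_image.1 hf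
    refine le_trans ?_ (hγoff q)
    rw [← finsum_neg_distrib]
    have h1 := sum_le_finsum (f := fun v => - off S (fun v => Real.log (av v (γ q))) v)
      ((FS_log_av (hγ0 q)).off S).neg' (fun v => by
        by_cases hv : v ∈ S
        · rw [off_of_mem hv, neg_zero]
        · rw [off_of_notMem hv]
          linarith [Real.log_nonpos (av_nonneg v (γ q)) (hγout q v hv)])
      (U.map ⟨Sum.inr, Sum.inr_injective⟩)
    refine le_trans (le_of_eq ?_) h1
    rw [Finset.sum_map, ← Finset.sum_coe_sort U]
    refine Finset.sum_congr rfl fun p _ => ?_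
    rw [Function.Embedding.coeFn_mk, off_of_notMem (hUS p), log_av_inr _ (hγ0 q), hexpo_cast]
    ring
  set B : Finset ℤ := Finset.Icc (-(⌈gg * W / (gg * ε)⌉₊ : ℤ)) ⌈gg * W / (gg * ε)⌉₊ with hB
  have hgε : 0 < gg * ε := by positivity
  have hBcard : (B.card : ℝ) ≤ 5 * W / ε := by
    refine (card_Icc_ceil_le hgε (by positivity)).trans ?_
    rw [mul_div_mul_left _ _ hg0.ne', mul_div_assoc]
    have : 1 ≤ W / ε := by rw [le_div_iff₀ hε]; linarith
    linarith
  set cell : ℕ → S → ℤ := fun q v => ⌊(Real.log (av v.1 (γ q)) - τ q v.1) / (gg * ε)⌋ with hcell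
  set T2 : Finset (S → ℤ) := Fintype.piFinset fun _ => B with hT2
  have hT2card : (T2.card : ℝ) ≤ (5 * W / ε) ^ S.card := by
    have h1 : T2.card = B.card ^ S.card := by simp [hT2]
    rw [h1]
    push_cast
    gcongr
  have hcardlt : (T1 ×ˢ T2 ×ˢ C).card < (Finset.range (N0 + 1)).card := by
    rw [Finset.card_range, Nat.lt_succ_iff, Finset.card_product, Finset.card_product]
    have h1 : ((T1.card * (T2.card * C.card) : ℕ) : ℝ) ≤ N0 := by
      refine le_trans ?_ hN
      push_cast
      rw [← mul_assoc]
      gcongr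
    exact_mod_cast h1
  obtain ⟨q, hq, q', hq', hne, heq⟩ := Finset.exists_ne_map_eq_of_card_lt_of_maps_to hcardlt
    (f := fun q => (expo q, cell q, col (γ q))) (fun q hq => by
      have hqN : q ≤ N0 := Nat.lt_succ_iff.1 (Finset.mem_range.1 hq)
      simp only [Finset.coe_product, Set.mem_prod, Finset.mem_coe]
      refine ⟨Finset.mem_image_of_mem _ hq, ?_, hcol _ (hγ0 q) (hγw q hqN)⟩
      rw [hT2, Fintype.mem_piFinset]
      intro v
      exact floor_mem_Icc hgε (hγS' q hqN v.1 v.2))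
  have key : ∀ q ∈ Finset.range (N0 + 1), ∀ q' ∈ Finset.range (N0 + 1), q' < q →
      (expo q, cell q, col (γ q)) = (expo q', cell q', col (γ q')) →
      ∃ q q', q' < q ∧ q ≤ N0 ∧ ∃ η : K, η ≠ 0 ∧ (∀ v ∉ S, Real.log (av v η) = 0) ∧
      (∀ v ∈ S, |Real.log (av v η) - (τ q v - τ q' v)| ≤ gg * ε) ∧
      av w (η⁻¹ - 1) ≤ Real.exp (-Λ) := by
    intro q hq q' hq' hlt heq
    simp only [Prod.mk.injEq] at heq
    obtain ⟨h1, h2, h3⟩ := heq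
    refine ⟨q, q', hlt, Nat.lt_succ_iff.1 (Finset.mem_range.1 hq), γ q / γ q',
      div_ne_zero (hγ0 q) (hγ0 q'), ?_, ?_, ?_⟩
    · rintro (v | p) hv
      · exact absurd (hS v) hv
      · rw [log_av_div _ (hγ0 q) (hγ0 q'), log_av_inr p (hγ0 q), log_av_inr p (hγ0 q')]
        have h4 : ordAt p (γ q) = ordAt p (γ q') := by
          by_cases hp : p ∈ U
          · have h5 := congrFun h1 ⟨p, hp⟩
            have h6 := hord0 q ⟨p, hp⟩
            have h7 := hord0 q' ⟨p, hp⟩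
            simp only [hexpo] at h5
            dsimp only at h6 h7
            omega
          · have h5 : ∀ q ∈ Finset.range (N0 + 1), ordAt p (γ q) = 0 := by
              intro q hq
              by_contra h
              exact hp (Finset.mem_biUnion.2 ⟨q, hq, by simpa using ⟨h, hv⟩⟩)
            rw [h5 q hq, h5 q' hq']
        rw [h4, sub_self]
    · intro v hv
      have h4 := abs_sub_le_of_floor_eq hgε (congrFun h2 ⟨v, hv⟩)
      dsimp only at h4
      rw [log_av_div _ (hγ0 q) (hγ0 q')]
      convert h4 using 2
      ring
    · rw [inv_div]
      exact hcol' _ _ (hγ0 q') (hγ0 q) h3.symm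
  rcases lt_or_gt_of_ne hne with h | h
  · exact key q' hq' q hq h heq.symm
  · exact key q hq q' hq' h heq

end Pigeonhole

end

section

variable {K : Type*} [Field K] [NumberField K]

local notation "gg" => (Module.finrank ℚ K : ℝ)

section CoreBound

lemma FS_ite (S : Finset (Pl K)) (c : ℝ) : FS fun v => if v ∈ S then c else 0 :=
  S.finite_toSet.subset fun v hv => by
    by_contra h
    exact hv (if_neg h)

lemma finsum_ite (S : Finset (Pl K)) (c : ℝ) :
    ∑ᶠ v, (if v ∈ S then c else 0) = S.card * c := by
  rw [finsum_eq_sum_of_support_subset (s := S)]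
  · rw [Finset.sum_congr rfl fun v hv => if_pos hv, Finset.sum_const, nsmul_eq_mul]
  · intro v hv
    by_contra h
    exact hv (if_neg h)

lemma abs_finsum_off_le {f : Pl K → ℝ} (hf : FS f) (S : Finset (Pl K)) :
    |∑ᶠ v, off S f v| ≤ ∑ᶠ v, off S (fun v => |f v|) v := by
  have hf' : FS fun v => |f v| := hf.comp' fun v h => by simp [h]
  rw [abs_le]
  constructor
  · rw [neg_le, ← finsum_neg_distrib]
    refine finsum_le_of_FS (hf.off S).neg' (hf'.off S) fun v => ?_
    simp only [off]
    split
    · simp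
    · exact neg_le_abs _
  · refine finsum_le_of_FS (hf.off S) (hf'.off S) fun v => ?_
    simp only [off]
    split
    · simp
    · exact le_abs_self _

set_option maxHeartbeats 2000000 in
theorem HH_le_of_close {S : Finset (Pl K)} (hS : ∀ w, .inl w ∈ S) {w : Pl K} (hw : w ∈ S)
    {P N0 : ℕ} (hP : 12 ≤ P) (hSP : S.card ≤ P) {u : K} (hu : u ≠ 0) {E : ℝ} (hE : 0 ≤ E)
    (hoff : ∑ᶠ v, off (S.erase w) (fun v => |Real.log (av v u)|) v ≤ gg * E)
    (hclose : Real.log (av w (1 - u)) ≤ -(HH u / (2 * P)))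
    (hN0 : 10 ^ 7 * P ^ 2 ≤ N0)
    (hN : Real.exp (2 * halfLogDiscr K) * 2 ^ Module.finrank ℚ K *
      (5 * cellScale S / (1 / (108 * P ^ 3))) ^ S.card *
      (120 * (gg * cellScale S + 1) * Real.exp (lq w) * Real.exp (gg * closeExp P)) ≤ N0) :
    HH u ≤ gg * (50 * P ^ 2 * N0 * (N0 + E)) := by
  by_contra hcon
  push Not at hcon
  have hg := one_le_finrank (K := K)
  have hg0 : 0 < gg := by linarith
  have hP1 : (12 : ℝ) ≤ P := by exact_mod_cast hP
  have hN1 : (10 : ℝ) ^ 7 * P ^ 2 ≤ N0 := by exact_mod_cast hN0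
  have hNpos : (0 : ℝ) < N0 := lt_of_lt_of_le (by positivity) hN1
  have hPP : (144 : ℝ) ≤ P ^ 2 := by
    have h := pow_le_pow_left₀ (by norm_num) hP1 2
    linarith only [h]
  have hN1' : (1 : ℝ) ≤ N0 := by linarith only [hN1, hPP]
  set T : ℝ := HH u / gg with hT
  have hHT : HH u = gg * T := by rw [hT]; field_simp
  have hTbig : 50 * P ^ 2 * N0 * (N0 + E) < T := by
    rw [hHT] at hcon
    exact lt_of_mul_lt_mul_left hcon hg0.le
  have hT0 : 0 < T := lt_of_le_of_lt (by positivity) hTbig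
  have hTE : 2 * N0 * (N0 + E) ≤ T := by
    refine le_trans ?_ hTbig.le
    gcongr
    linarith
  have hu1 : 1 - u ≠ 0 := by
    intro h
    have : u = 1 := (sub_eq_zero.1 h).symm
    rw [this] at hHT
    have h1 : HH (1 : K) = 0 := by simp [HH]
    rw [h1] at hHT
    exact (mul_pos hg0 hT0).ne hHT
  set ε : ℝ := 1 / (108 * P ^ 3) with hεdef
  have hε : 0 < ε := by positivity
  have hPε : P * ε = 1 / (108 * P ^ 2) := by rw [hεdef]; field_simp
  have hSε : S.card * ε ≤ 1 / (108 * P ^ 2) := by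
    rw [← hPε]; gcongr
  have h108 : 1 / (108 * (P : ℝ) ^ 2) ≤ 1 / 100 := by
    apply one_div_le_one_div_of_le (by norm_num)
    linarith only [hPP]
  have hε1 : ε ≤ 1 := by
    have : ε ≤ P * ε := le_mul_of_one_le_left hε.le (by linarith only [hP1])
    linarith
  set ℓ : Pl K → ℝ := fun v => Real.log (av v u) with hℓ
  have hFSℓ : FS ℓ := FS_log_av hu
  have hFSabs : FS fun v => |ℓ v| := hFSℓ.comp' fun v h => by simp [h]
  have hsumabs : ∑ᶠ v, |ℓ v| = 2 * (gg * T) := by rw [← hHT]; exact finsum_abs_log hu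
  have hsumS : |∑ v ∈ S.erase w, ℓ v| ≤ gg * E := by
    have h1 := finsum_eq_sum_add_off hFSℓ (S.erase w)
    have h2 : ∑ᶠ v, ℓ v = 0 := product_formula hu
    have h3 := abs_finsum_off_le hFSℓ (S.erase w)
    have h4 : ∑ v ∈ S.erase w, ℓ v = - ∑ᶠ v, off (S.erase w) ℓ v := by linarith
    rw [h4, abs_neg]
    exact h3.trans hoff
  set τ : ℕ → Pl K → ℝ := fun q v => if v = w then 0 else q / T * ℓ v with hτ
  have hclose_pos : 0 ≤ closeExp P := by
    have h1 : 0 ≤ Real.log (18 * (P : ℝ) ^ 2) := Real.log_nonneg (by linarith only [hPP])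
    have h2 : 0 ≤ Real.log (36 * (P : ℝ) ^ 2) := Real.log_nonneg (by linarith only [hPP])
    unfold closeExp
    linarith
  obtain ⟨q, q', hqq, hqN, η, hη0, hηout, hηS, hηw⟩ := exists_ratio hS hw (N0 := N0) τ
    (fun q => if_pos rfl) (fun q hq => by
      have hq' : (q : ℝ) ≤ N0 := by exact_mod_cast hq
      rw [← Finset.add_sum_erase S _ hw]
      have h1 : ∑ v ∈ S.erase w, τ q v = q / T * ∑ v ∈ S.erase w, ℓ v := by
        rw [Finset.mul_sum]
        exact Finset.sum_congr rfl fun v hv => if_neg (Finset.ne_of_mem_erase hv)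
      rw [h1]
      simp only [hτ, if_true, zero_add]
      rw [abs_mul, abs_of_nonneg (by positivity)]
      calc (q : ℝ) / T * |∑ v ∈ S.erase w, ℓ v| ≤ N0 / T * (gg * E) := by gcongr
        _ = gg * (N0 * E / T) := by ring
        _ ≤ gg * 1 := by
            gcongr
            rw [div_le_one hT0]
            have h0 : 0 ≤ N0 * E := by positivity
            have h2 : (0 : ℝ) ≤ N0 * N0 := by positivity
            linarith only [h0, h2, hTE]
        _ = gg := mul_one _)
    hε hε1 (by positivity) hN
  obtain ⟨k, rfl⟩ : ∃ k, q = q' + k := ⟨q - q', by omega⟩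
  have hk : 0 < k := by omega
  have hk1 : (1 : ℝ) ≤ k := by exact_mod_cast hk
  have hkN : (k : ℝ) ≤ N0 := by exact_mod_cast (show k ≤ N0 by omega)
  have hηS' : ∀ v ∈ S, v ≠ w → |Real.log (av v η) - k / T * ℓ v| ≤ gg * ε := by
    intro v hv hvw
    have h := hηS v hv
    simp only [hτ, if_neg hvw] at h
    convert h using 2
    push_cast
    ring
  have hηw' : |Real.log (av w η)| ≤ gg * ε := by
    have h := hηS w hw
    simp only [hτ, if_true, sub_zero] at h
    exact h
  have hgε : 0 ≤ gg * ε := by positivity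
  have hFS1 : FS fun v => k / T * |ℓ v| := hFSabs.mul_left' _
  have hsum1 : ∑ᶠ v, k / T * |ℓ v| = 2 * gg * k := by
    rw [← mul_finsum, hsumabs]
    field_simp
  have hHη : HH η ≤ 2 * gg * k := by
    have h1 : 2 * HH η ≤ 2 * gg * k + S.card * (gg * ε) := by
      rw [← finsum_abs_log hη0, ← hsum1, ← finsum_ite, ← finsum_add_distrib hFS1 (FS_ite _ _)]
      refine finsum_le_of_FS ((FS_log_av hη0).comp' fun v h => by simp [h])
        (hFS1.add' (FS_ite _ _)) fun v => ?_
      by_cases hv : v ∈ S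
      · rw [if_pos hv]
        by_cases hvw : v = w
        · subst hvw
          have : 0 ≤ k / T * |ℓ v| := by positivity
          linarith
        · have h2 := hηS' v hv hvw
          have h3 : |k / T * ℓ v| = k / T * |ℓ v| := by
            rw [abs_mul, abs_of_nonneg (by positivity)]
          have h4 := abs_add_le (Real.log (av v η) - k / T * ℓ v) (k / T * ℓ v)
          rw [sub_add_cancel, h3] at h4
          linarith
      · rw [if_neg hv, hηout v hv, abs_zero, add_zero]
        positivity
    have h2 : gg * (S.card * ε) ≤ gg * 1 := mul_le_mul_of_nonneg_left (by linarith) hg0.le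
    have h3 : gg * 1 ≤ gg * k := mul_le_mul_of_nonneg_left hk1 hg0.le
    linarith only [h1, h2, h3]
  have hη1 : η ≠ 1 := by
    rintro rfl
    have h1 : ∑ v ∈ S.erase w, k / T * |ℓ v| ≤ S.card * (gg * ε) := by
      refine (Finset.sum_le_card_nsmul _ _ (gg * ε) fun v hv => ?_).trans ?_
      · have h2 := hηS' v (Finset.mem_of_mem_erase hv) (Finset.ne_of_mem_erase hv)
        rwa [map_one, Real.log_one, zero_sub, abs_neg, abs_mul,
          abs_of_nonneg (show (0 : ℝ) ≤ k / T by positivity)] at h2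
      · rw [nsmul_eq_mul]
        gcongr
        exact Finset.erase_subset _ _
    have h2 := finsum_eq_sum_add_off hFSabs (S.erase w)
    rw [hsumabs] at h2
    rw [← Finset.mul_sum] at h1
    have h3 : 2 * (gg * T) - gg * E ≤ ∑ v ∈ S.erase w, |ℓ v| := by
      have h4 : ∑ᶠ v, off (S.erase w) (fun v => |ℓ v|) v ≤ gg * E := hoff
      linarith
    have h4 : k / T * (2 * (gg * T) - gg * E) ≤ S.card * (gg * ε) :=
      le_trans (by gcongr) h1
    have h5 : k / T * (2 * (gg * T) - gg * E) = gg * (2 * k - k * E / T) := by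
      field_simp
    have h6 : k * E / T ≤ 1 / 2 := by
      rw [div_le_iff₀ hT0]
      have h0 : (0 : ℝ) ≤ N0 * N0 := by positivity
      linarith only [mul_le_mul_of_nonneg_right hkN hE, h0, hTE]
    rw [h5, show S.card * (gg * ε) = gg * (S.card * ε) by ring] at h4
    have h7 := le_of_mul_le_mul_left h4 hg0
    linarith
  set r : ℕ := ⌊T / k⌋₊ with hr
  have hkpos : (0 : ℝ) < k := by linarith
  have hr1 : (r : ℝ) ≤ T / k := Nat.floor_le (by positivity)
  have hr2 : T / k < r + 1 := Nat.lt_floor_add_one _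
  have hkr : k * r ≤ T := by
    rw [le_div_iff₀ hkpos] at hr1
    linarith
  have hrbig : 48 * P ^ 2 * (N0 + E) ≤ r := by
    have h1 : 50 * P ^ 2 * (N0 + E) ≤ T / k := by
      rw [le_div_iff₀ hkpos]
      refine le_trans ?_ hTbig.le
      linarith only [mul_le_mul_of_nonneg_left hkN
        (show (0 : ℝ) ≤ 50 * P ^ 2 * (N0 + E) by positivity)]
    have h2 : 144 * 1 ≤ (P : ℝ) ^ 2 * (N0 + E) := by
      gcongr
      linarith
    linarith
  have hηi : η⁻¹ ≠ 0 := inv_ne_zero hη0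
  have hA0 : u * η⁻¹ ^ r ≠ 0 := mul_ne_zero hu (pow_ne_zero _ hηi)
  refine two_logs_false w (t := η⁻¹) (A := u * η⁻¹ ^ r) (r := r) hηi
    (fun h => hη1 (inv_eq_one.1 h)) hA0 hk hP ?_ ?_ (by rwa [HH_inv]) hηw ?_
  · have h1 : (10 : ℝ) ^ 8 * P ^ 4 ≤ r := by
      refine le_trans ?_ hrbig
      calc (10 : ℝ) ^ 8 * P ^ 4 ≤ 48 * P ^ 2 * (10 ^ 7 * P ^ 2) := by
            nlinarith [pow_pos (show (0 : ℝ) < P by linarith) 4]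
        _ ≤ 48 * P ^ 2 * (N0 + E) := by gcongr; linarith
    exact_mod_cast h1
  · have hlogA : ∀ v, Real.log (av v (u * η⁻¹ ^ r)) = ℓ v - r * Real.log (av v η) := by
      intro v
      rw [log_av_mul v hu (pow_ne_zero _ hηi), log_av_pow, log_av_inv]
      ring
    have h1 : 2 * HH (u * η⁻¹ ^ r) ≤ 2 * gg * k + gg * E + S.card * (r * (gg * ε)) := by
      have hFS2 : FS (off (S.erase w) fun v => |ℓ v|) := hFSabs.off _
      refine le_trans ?_ (add_le_add_left (add_le_add_right hoff _) _)
      rw [← finsum_abs_log hA0, ← hsum1, ← finsum_ite, ← finsum_add_distrib hFS1 hFS2,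
        ← finsum_add_distrib (hFS1.add' hFS2) (FS_ite _ _)]
      refine finsum_le_of_FS ((FS_log_av hA0).comp' fun v h => abs_eq_zero.2 h)
        ((hFS1.add' hFS2).add' (FS_ite _ _)) fun v => ?_
      have hp : 0 ≤ k / T * |ℓ v| := by positivity
      rw [hlogA]
      by_cases hv : v ∈ S
      · rw [if_pos hv]
        by_cases hvw : v = w
        · subst hvw
          rw [off_of_notMem (Finset.notMem_erase _ _)]
          have h2 := abs_sub (ℓ v) (r * Real.log (av v η))
          have h3 : |r * Real.log (av v η)| ≤ r * (gg * ε) := by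
            rw [abs_mul, abs_of_nonneg (by positivity)]
            gcongr
          linarith
        · rw [off_of_mem (Finset.mem_erase.2 ⟨hvw, hv⟩)]
          have h2 := hηS' v hv hvw
          have h3 : ℓ v - r * Real.log (av v η) =
              (1 - r * (k / T)) * ℓ v - r * (Real.log (av v η) - k / T * ℓ v) := by ring
          have h4 := abs_sub ((1 - r * (k / T)) * ℓ v) (r * (Real.log (av v η) - k / T * ℓ v))
          have h5 : |r * (Real.log (av v η) - k / T * ℓ v)| ≤ r * (gg * ε) := by
            rw [abs_mul, abs_of_nonneg (by positivity)]
            gcongr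
          have h6 : |(1 - r * (k / T)) * ℓ v| ≤ k / T * |ℓ v| := by
            have h7 : 0 ≤ 1 - r * (k / T) := by
              rw [sub_nonneg, ← mul_div_assoc, div_le_one hT0]
              linarith
            rw [abs_mul, abs_of_nonneg h7]
            gcongr
            rw [div_lt_iff₀ hkpos] at hr2
            have h8 : k / T + r * (k / T) = (r + 1) * k / T := by ring
            rw [sub_le_iff_le_add, h8, le_div_iff₀ hT0]
            linarith
          rw [h3]
          linarith
      · rw [if_neg hv, hηout v hv, off_of_notMem (fun h => hv (Finset.mem_of_mem_erase h)),
          mul_zero, sub_zero]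
        linarith
    have h2 : S.card * (r * (gg * ε)) ≤ gg * (r * (1 / (108 * P ^ 2))) := by
      calc S.card * (r * (gg * ε)) = gg * (r * (S.card * ε)) := by ring
        _ ≤ _ := by gcongr
    have h3 : 2 * k + E ≤ 2 * (r / (48 * P ^ 2)) := by
      have : N0 + E ≤ r / (48 * P ^ 2) := by
        rw [le_div_iff₀ (by positivity)]
        linarith
      linarith
    have h4 : gg * (2 * k + E) ≤ gg * (2 * (r / (48 * P ^ 2))) := by gcongr
    set X : ℝ := r / P ^ 2 with hX
    have hX0 : 0 ≤ gg * X := by positivity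
    have e1 : (r : ℝ) / (48 * P ^ 2) = X / 48 := by rw [hX]; field_simp
    have e2 : (r : ℝ) * (1 / (108 * P ^ 2)) = X / 108 := by rw [hX]; field_simp
    have e3 : (r : ℝ) / (36 * P ^ 2) = X / 36 := by rw [hX]; field_simp
    rw [e1] at h4
    rw [e2] at h2
    rw [e3]
    linarith
  · have h1 : u * η⁻¹ ^ r * η⁻¹⁻¹ ^ r = u := by
      rw [inv_inv, mul_assoc, ← mul_pow, inv_mul_cancel₀ hη0, one_pow, mul_one]
    rw [h1, av_sub_comm, ← Real.exp_log (av_pos w hu1)]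
    apply Real.exp_le_exp.2
    refine hclose.trans (neg_le_neg ?_)
    rw [hHT, mul_div_assoc gg]
    have h2 : (k : ℝ) * r / (2 * P) ≤ T / (2 * P) := by gcongr
    exact mul_le_mul_of_nonneg_left h2 hg0.le

end CoreBound

end

section

variable {K : Type*} [Field K] [NumberField K]
variable {E : Type*} [Field E] [NumberField E] [Algebra K E]

section Different

open FractionalIdeal nonZeroDivisors Polynomial

variable (K) in
/-- The exponent of a prime in the relative different. -/
def dexp (P : HeightOneSpectrum (𝓞 E)) : ℤ :=
  count E P (differentIdeal (𝓞 K) (𝓞 E) : FractionalIdeal (𝓞 E)⁰ E)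

lemma log_absNorm_eq {I : Ideal (𝓞 K)} (hI : I ≠ 0) :
    {p | count K p (I : FractionalIdeal (𝓞 K)⁰ K) ≠ 0}.Finite ∧
    Real.log (Ideal.absNorm I) = ∑ᶠ p : HeightOneSpectrum (𝓞 K),
      (count K p (I : FractionalIdeal (𝓞 K)⁰ K) : ℝ) * Real.log (Ideal.absNorm p.asIdeal) := by
  have hfin : {p | count K p (I : FractionalIdeal (𝓞 K)⁰ K) ≠ 0}.Finite :=
    finite_factors (I : FractionalIdeal (𝓞 K)⁰ K)
  refine ⟨hfin, ?_⟩
  have h1 := finprod_heightOneSpectrum_factorization' K (coeIdeal_ne_zero.2 hI)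
  have h2 : (Ideal.absNorm I : ℚ) = ∏ p ∈ hfin.toFinset,
      (Ideal.absNorm p.asIdeal : ℚ) ^ count K p (I : FractionalIdeal (𝓞 K)⁰ K) := by
    rw [← coeIdeal_absNorm (K := K), ← congrArg absNorm h1,
      finprod_eq_prod_of_mulSupport_subset (s := hfin.toFinset), map_prod]
    · exact Finset.prod_congr rfl fun p _ => by rw [map_zpow₀, coeIdeal_absNorm]
    · intro p hp
      rw [Finset.mem_coe, Set.Finite.mem_toFinset]
      intro h
      exact hp (by simp only [h, zpow_zero])
  have h3 : (Ideal.absNorm I : ℝ) = ∏ p ∈ hfin.toFinset,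
      (Ideal.absNorm p.asIdeal : ℝ) ^ count K p (I : FractionalIdeal (𝓞 K)⁰ K) := by
    have h4 := congrArg (fun q : ℚ => (q : ℝ)) h2
    push_cast at h4
    exact h4
  have hpos : ∀ p : HeightOneSpectrum (𝓞 K), (0 : ℝ) < Ideal.absNorm p.asIdeal := fun p =>
    lt_trans one_pos (by exact_mod_cast one_lt_norm p)
  rw [h3, Real.log_prod fun p _ => (zpow_pos (hpos p) _).ne',
    finsum_eq_sum_of_support_subset (s := hfin.toFinset)]
  · exact Finset.sum_congr rfl fun p _ => Real.log_zpow _ _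
  · intro p hp
    rw [Finset.mem_coe, Set.Finite.mem_toFinset]
    intro h
    exact hp (by simp only [h, Int.cast_zero, zero_mul])

variable (K E) in
lemma finite_dexp : {P : HeightOneSpectrum (𝓞 E) | dexp K P ≠ 0}.Finite :=
  finite_factors (differentIdeal (𝓞 K) (𝓞 E) : FractionalIdeal (𝓞 E)⁰ E)

variable (K E) in
lemma log_discr_tower : Real.log |(discr E : ℝ)| =
    Module.finrank K E * Real.log |(discr K : ℝ)| +
      ∑ᶠ P : HeightOneSpectrum (𝓞 E), (dexp K P : ℝ) * Real.log (Ideal.absNorm P.asIdeal) := by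
  have hne : differentIdeal (𝓞 K) (𝓞 E) ≠ 0 := differentIdeal_ne_bot
  have h1 := NumberField.natAbs_discr_eq_absNorm_differentIdeal_mul_natAbs_discr_pow K (𝓞 K) E (𝓞 E)
  have h2 : ∀ z : ℤ, |(z : ℝ)| = (z.natAbs : ℝ) := fun z => by
    rw [← Int.cast_abs, Int.abs_eq_natAbs]; rfl
  have h3 := (log_absNorm_eq hne).2
  rw [h2, h2, h1]
  have hN : (Ideal.absNorm (differentIdeal (𝓞 K) (𝓞 E)) : ℝ) ≠ 0 := by
    exact_mod_cast (Ideal.absNorm_ne_zero_iff_mem_nonZeroDivisors.2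
      (mem_nonZeroDivisors_of_ne_zero hne))
  have hD : ((discr K).natAbs : ℝ) ≠ 0 := by
    exact_mod_cast Int.natAbs_ne_zero.2 (discr_ne_zero K)
  push_cast
  rw [Real.log_mul hN (pow_ne_zero _ hD), Real.log_pow, h3, add_comm]
  rfl

lemma dexp_le (P : HeightOneSpectrum (𝓞 E)) {θ : E} (hθ : Algebra.adjoin K {θ} = ⊤)
    {G : (𝓞 K)[X]} (hG : G.Monic) (h0 : aeval θ G = 0) (h1 : aeval θ (derivative G) ≠ 0) :
    dexp K P ≤ ordAt P (aeval θ (derivative G)) := by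
  have hInt : IsIntegral (𝓞 K) θ := ⟨G, hG, h0⟩
  have hintZ : IsIntegral ℤ θ := isIntegral_trans (R := ℤ) (A := 𝓞 K) θ hInt
  obtain ⟨t, rfl⟩ : ∃ t : 𝓞 E, algebraMap (𝓞 E) E t = θ := ⟨⟨θ, hintZ⟩, rfl⟩
  have hG0 : aeval t G = 0 := by
    apply FaithfulSMul.algebraMap_injective (𝓞 E) E
    rw [← aeval_algebraMap_apply, h0, map_zero]
  have hti : IsIntegral (𝓞 K) t := ⟨G, hG, hG0⟩
  obtain ⟨H, hH⟩ := minpoly.isIntegrallyClosed_dvd hti hG0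
  have hmem := aeval_derivative_mem_differentIdeal (𝓞 K) K E t hθ
  have hder : aeval t (derivative G) =
      aeval t (derivative (minpoly (𝓞 K) t)) * aeval t H := by
    conv_lhs => rw [hH]
    rw [derivative_mul, map_add, map_mul, map_mul, minpoly.aeval, zero_mul, add_zero]
  have hmem' : aeval t (derivative G) ∈ differentIdeal (𝓞 K) (𝓞 E) := by
    rw [hder]
    exact Ideal.mul_mem_right _ _ hmem
  rw [aeval_algebraMap_apply] at h1 ⊢
  rw [← count_spanSingleton P h1]
  refine count_mono E P (spanSingleton_ne_zero_iff.2 h1) ?_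
  rw [spanSingleton_le_iff_mem]
  exact mem_coeIdeal_of_mem _ hmem'

lemma exists_ordAt_eq {f : HeightOneSpectrum (𝓞 K) → ℤ} (hf : {p | f p ≠ 0}.Finite)
    (p : HeightOneSpectrum (𝓞 K)) :
    ∃ γ : K, γ ≠ 0 ∧ ordAt p γ = f p ∧ ∀ p', f p' ≤ ordAt p' γ := by
  set I : FractionalIdeal (𝓞 K)⁰ K :=
    ∏ᶠ v : HeightOneSpectrum (𝓞 K), (v.asIdeal : FractionalIdeal (𝓞 K)⁰ K) ^ f v with hI
  have hcount : ∀ v, count K v I = f v := fun v => count_finprod K v f hf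
  have hI0 : I ≠ 0 := by
    rw [hI, finprod_eq_prod_of_mulSupport_subset (s := hf.toFinset)]
    · exact Finset.prod_ne_zero_iff.2 fun v _ => zpow_ne_zero _ (coeIdeal_ne_zero.2 v.ne_bot)
    · intro v hv
      rw [Finset.mem_coe, Set.Finite.mem_toFinset]
      intro h
      exact hv (by simp only [h, zpow_zero])
  have hp0 : (p.asIdeal : FractionalIdeal (𝓞 K)⁰ K) ≠ 0 := coeIdeal_ne_zero.2 p.ne_bot
  have hnot : ¬ I ≤ I * (p.asIdeal : FractionalIdeal (𝓞 K)⁰ K) := by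
    intro h
    have h1 := count_mono K p hI0 h
    rw [count_mul K p hI0 hp0, count_self] at h1
    omega
  obtain ⟨γ, hγ, hγ'⟩ := SetLike.not_le_iff_exists.1 hnot
  have hγ0 : γ ≠ 0 := by
    rintro rfl
    exact hγ' (zero_mem _)
  have hle : ∀ p', f p' ≤ ordAt p' γ := fun p' => by
    rw [← hcount, ← count_spanSingleton p' hγ0]
    exact count_mono K p' (spanSingleton_ne_zero_iff.2 hγ0) (spanSingleton_le_iff_mem.2 hγ)
  refine ⟨γ, hγ0, le_antisymm ?_ (hle p), hle⟩
  have hJ1 : I⁻¹ * spanSingleton (𝓞 K)⁰ γ ≤ 1 := by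
    rw [← inv_mul_cancel₀ hI0]
    exact mul_le_mul_right ((spanSingleton_le_iff_mem (S := (𝓞 K)⁰)).2 hγ) _
  obtain ⟨J, hJ⟩ := FractionalIdeal.le_one_iff_exists_coeIdeal.1 hJ1
  have hspan : spanSingleton (𝓞 K)⁰ γ = I * J := by
    rw [hJ, mul_inv_cancel_left₀ hI0]
  have hJ0 : J ≠ 0 := by
    rintro rfl
    refine (spanSingleton_ne_zero_iff (R := 𝓞 K) (S := (𝓞 K)⁰)).2 hγ0 ?_
    rw [hspan]
    simp
  have hJp : ¬ p.asIdeal ∣ J := by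
    intro h
    apply hγ'
    rw [← spanSingleton_le_iff_mem, hspan]
    have h1 : (J : FractionalIdeal (𝓞 K)⁰ K) ≤ p.asIdeal :=
      (coeIdeal_le_coeIdeal (R := 𝓞 K) K).2 (Ideal.le_of_dvd h)
    exact mul_le_mul_right h1 _
  have hcJ : count K p (J : FractionalIdeal (𝓞 K)⁰ K) = 0 := by
    rw [count_coe K p hJ0, Nat.cast_eq_zero]
    by_contra h
    exact hJp (Associates.mk_le_mk_iff_dvd.1
      ((Associates.count_ne_zero_iff_dvd hJ0 p.irreducible).1 h |> Associates.mk_le_mk_of_dvd))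
  rw [← count_spanSingleton p hγ0, hspan, count_mul K p hI0 (coeIdeal_ne_zero.2 hJ0), hcJ, hcount,
    add_zero]

end Different

end

section

variable {K : Type*} [Field K] [NumberField K]
variable {E : Type*} [Field E] [NumberField E] [Algebra K E]

section PolyValues

/-- The value at `x` of `a₀ Xⁿ + ⋯ + aₙ`. -/
def ev {R : Type*} [CommRing R] (n : ℕ) (a : ℕ → R) (x : R) : R :=
  ∑ j ∈ Finset.range (n + 1), a j * x ^ (n - j)

/-- The value at `x` of the derivative of `a₀ Xⁿ + ⋯ + aₙ`. -/
def dv {R : Type*} [CommRing R] (n : ℕ) (a : ℕ → R) (x : R) : R :=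
  ∑ j ∈ Finset.range n, ((n - j : ℕ) : R) * a j * x ^ (n - 1 - j)

lemma ev_eq {R : Type*} [CommRing R] (n : ℕ) (a : ℕ → R) (x : R) :
    ev n a x = a 0 * x ^ n + ∑ i ∈ Finset.range n, a (i + 1) * x ^ (n - 1 - i) := by
  rw [ev, Finset.sum_range_succ', Nat.sub_zero, add_comm]
  congr 1
  exact Finset.sum_congr rfl fun i _ => by rw [Nat.sub_sub, add_comm 1 i]

lemma mul_dv {R : Type*} [CommRing R] (n : ℕ) (a : ℕ → R) (x : R) :
    x * dv n a x = n * ev n a x -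
      ∑ i ∈ Finset.range n, ((i + 1 : ℕ) : R) * a (i + 1) * x ^ (n - 1 - i) := by
  have h1 : x * dv n a x = ∑ j ∈ Finset.range (n + 1), ((n : R) - j) * (a j * x ^ (n - j)) := by
    rw [Finset.sum_range_succ, sub_self, zero_mul, add_zero, dv, Finset.mul_sum]
    refine Finset.sum_congr rfl fun j hj => ?_
    have hj' := Finset.mem_range.1 hj
    rw [Nat.cast_sub hj'.le, show n - j = n - 1 - j + 1 by omega, pow_succ]
    ring
  have h2 : ∑ i ∈ Finset.range n, ((i + 1 : ℕ) : R) * a (i + 1) * x ^ (n - 1 - i) =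
      ∑ j ∈ Finset.range (n + 1), (j : R) * (a j * x ^ (n - j)) := by
    rw [Finset.sum_range_succ', Nat.cast_zero, zero_mul, add_zero]
    exact Finset.sum_congr rfl fun i _ => by
      rw [Nat.sub_sub, add_comm 1 i, mul_assoc]
  rw [h1, h2, ev, Finset.mul_sum, ← Finset.sum_sub_distrib]
  exact Finset.sum_congr rfl fun j _ => by ring

lemma dv_eq {R : Type*} [CommRing R] {n : ℕ} (hn : 1 ≤ n) (a : ℕ → R) (x : R) :
    dv n a x = n * a 0 * x ^ (n - 1) +
      ∑ i ∈ Finset.range n, ((n - 1 - i : ℕ) : R) * a (i + 1) * x ^ (n - 2 - i) := by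
  obtain ⟨k, rfl⟩ : ∃ k, n = k + 1 := ⟨n - 1, by omega⟩
  rw [dv, Finset.sum_range_succ', Finset.sum_range_succ]
  simp only [Nat.sub_zero, Nat.add_sub_cancel, Nat.sub_self, Nat.cast_zero, zero_mul, add_zero]
  rw [add_comm]
  congr 1
  exact Finset.sum_congr rfl fun i _ => by
    rw [show k + 1 - (i + 1) = k - i by omega, show k - (i + 1) = k + 1 - 2 - i by omega]

lemma abs_dv_le {F : Type*} [Field F] (f : AbsoluteValue F ℝ) {n : ℕ} (hn : 2 ≤ n) {a : ℕ → F}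
    {x : F} (hx : ev n a x = 0) {M : ℝ} (hM : 1 ≤ M) (ha : ∀ j ≤ n, f (a j) ≤ M) :
    f (a 0 ^ (n - 2) * dv n a x) ≤ n ^ n * M ^ (n - 1) := by
  have hM0 : 0 ≤ M := by linarith
  have hnat : ∀ k : ℕ, f (k : F) ≤ k := by
    intro k
    induction k with
    | zero => simp
    | succ k ih =>
      push_cast
      refine (f.add_le _ _).trans ?_
      rw [map_one]
      linarith
  have hsplitn : n = n - 2 + 2 := by omega
  have hpow : M ^ (n - 1) = M ^ (n - 2) * M := by
    rw [← pow_succ]; congr 1; omega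
  have hnpow : (n : ℝ) ^ n = n ^ (n - 2) * n ^ 2 := by
    rw [← pow_add]; congr 1
  have hn1 : (1 : ℝ) ≤ n := by exact_mod_cast (by omega : 1 ≤ n)
  have hsum : ∀ (c : ℕ → ℕ) (b : ℕ → F) (e : ℕ → ℕ) (k : ℕ), (∀ j < n, c j ≤ n) →
      (∀ j < n, f (b j) ≤ M) → (∀ j < n, f x ^ e j ≤ max 1 (f x) ^ k) →
      f (∑ j ∈ Finset.range n, ((c j : ℕ) : F) * b j * x ^ e j) ≤
        n ^ 2 * M * max 1 (f x) ^ k := by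
    intro c b e k hc hb he
    refine (f.sum_le _ _).trans ?_
    refine (Finset.sum_le_card_nsmul _ _ (n * M * max 1 (f x) ^ k) fun j hj => ?_).trans ?_
    · have hj := Finset.mem_range.1 hj
      rw [map_mul, map_mul, map_pow]
      gcongr
      · exact (hnat _).trans (by exact_mod_cast hc j hj)
      · exact hb j hj
      · exact he j hj
    · rw [Finset.card_range, nsmul_eq_mul]
      exact le_of_eq (by ring)
  rw [map_mul, map_pow]
  rcases le_total (f x) 1 with h1 | h1
  · have h2 := hsum (fun j => n - j) a (fun j => n - 1 - j) 0 (fun j _ => Nat.sub_le _ _)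
      (fun j hj => ha j hj.le) (fun j _ => by
        rw [pow_zero]; exact pow_le_one₀ (f.nonneg _) h1)
    rw [pow_zero, mul_one] at h2
    calc f (a 0) ^ (n - 2) * f (dv n a x) ≤ M ^ (n - 2) * (n ^ 2 * M) := by
          gcongr
          · exact ha 0 (Nat.zero_le _)
          · exact h2
      _ = n ^ 2 * M ^ (n - 1) := by rw [hpow]; ring
      _ ≤ _ := by gcongr
  · have hx0 : 0 < f x := by linarith
    have h2 := hsum (fun j => j + 1) (fun j => a (j + 1)) (fun j => n - 1 - j) (n - 1)
      (fun j hj => hj) (fun j hj => ha _ hj) (fun j _ => by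
        rw [max_eq_right h1]; exact pow_le_pow_right₀ h1 (Nat.sub_le _ _))
    have h3 := hsum (fun j => 1) (fun j => a (j + 1)) (fun j => n - 1 - j) (n - 1)
      (fun j hj => by omega) (fun j hj => ha _ hj) (fun j _ => by
        rw [max_eq_right h1]; exact pow_le_pow_right₀ h1 (Nat.sub_le _ _))
    rw [max_eq_right h1] at h2 h3
    have h4 := mul_dv n a x
    rw [hx, mul_zero, zero_sub] at h4
    have hpx : f x ^ (n - 1) = f x ^ (n - 2) * f x := by
      rw [← pow_succ]; congr 1; omega
    have h5 : f (dv n a x) ≤ n ^ 2 * M * f x ^ (n - 2) := by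
      have h4' : f x * f (dv n a x) = f (∑ i ∈ Finset.range n, ((i + 1 : ℕ) : F) * a (i + 1) *
          x ^ (n - 1 - i)) := by rw [← map_mul, h4, f.map_neg]
      rw [← h4', hpx, ← mul_assoc, mul_comm (f x)] at h2
      exact le_of_mul_le_mul_right h2 hx0
    have h6 : f (a 0) * f x ≤ n * M := by
      have h7 : f (a 0 * x ^ n) ≤ n * M * f x ^ (n - 1) := by
        have h8 : a 0 * x ^ n = - ∑ i ∈ Finset.range n, a (i + 1) * x ^ (n - 1 - i) := by
          rw [ev_eq] at hx
          exact eq_neg_of_add_eq_zero_left hx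
        rw [h8, f.map_neg]
        refine (f.sum_le _ _).trans ?_
        refine (Finset.sum_le_card_nsmul _ _ (M * f x ^ (n - 1)) fun j hj => ?_).trans ?_
        · have hj := Finset.mem_range.1 hj
          rw [map_mul, map_pow]
          exact mul_le_mul (ha _ hj) (pow_le_pow_right₀ h1 (Nat.sub_le _ _))
            (pow_nonneg hx0.le _) hM0
        · rw [Finset.card_range, nsmul_eq_mul]
          exact le_of_eq (by ring)
      rw [map_mul, map_pow, show f x ^ n = f x ^ (n - 1) * f x by
        rw [← pow_succ]; congr 1; omega] at h7
      have h9 : f (a 0) * f x * f x ^ (n - 1) ≤ n * M * f x ^ (n - 1) := by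
        refine le_trans (le_of_eq ?_) h7
        ring
      exact le_of_mul_le_mul_right h9 (by positivity)
    calc f (a 0) ^ (n - 2) * f (dv n a x)
        ≤ f (a 0) ^ (n - 2) * (n ^ 2 * M * f x ^ (n - 2)) := by gcongr
      _ = n ^ 2 * M * (f (a 0) * f x) ^ (n - 2) := by rw [mul_pow]; ring
      _ ≤ n ^ 2 * M * (n * M) ^ (n - 2) := by gcongr
      _ = _ := by rw [hpow, hnpow, mul_pow]; ring

end PolyValues

end

section

variable {K : Type*} [Field K] [NumberField K]
variable {E : Type*} [Field E] [NumberField E] [Algebra K E]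

section DiscriminantSteps

lemma log_discr_le {β : Pl E → ℝ} (hβ : FS β) {z : E} (hz : z ≠ 0)
    (hfin : ∀ P : HeightOneSpectrum (𝓞 E),
      (dexp K P : ℝ) * Real.log (Ideal.absNorm P.asIdeal) ≤ β (.inr P) - Real.log (av (.inr P) z))
    (hinf : ∀ w : InfinitePlace E, Real.log (av (.inl w) z) ≤ β (.inl w)) :
    Real.log |(NumberField.discr E : ℝ)| ≤
      Module.finrank K E * Real.log |(NumberField.discr K : ℝ)| + ∑ᶠ v, β v := by
  set g : Pl E → ℝ := Sum.elim (fun _ => 0)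
    (fun P => (dexp K P : ℝ) * Real.log (Ideal.absNorm P.asIdeal)) with hg
  have hgF : FS g := FS_of_fin ((finite_dexp K E).subset fun P hP h => hP (by simp [hg, h]))
  have hF : FS fun v => β v - Real.log (av v z) :=
    by
    simpa only [sub_eq_add_neg] using hβ.add' (FS_log_av hz).neg'
  rw [log_discr_tower K E]
  have h1 : ∑ᶠ v, g v = ∑ᶠ P : HeightOneSpectrum (𝓞 E),
      (dexp K P : ℝ) * Real.log (Ideal.absNorm P.asIdeal) := by
    rw [finsum_eq_split hgF]; simp [hg]
  have h2 : ∑ᶠ v, g v ≤ ∑ᶠ v, (β v - Real.log (av v z)) := by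
    refine finsum_le_of_FS hgF hF ?_
    rintro (w | P)
    · have := hinf w
      simp only [hg, Sum.elim_inl]
      linarith
    · exact hfin P
  rw [finsum_sub_distrib hβ (FS_log_av hz), product_formula hz] at h2
  linarith

lemma adjoin_eq_top_of_mem {F A : Type*} [CommRing F] [Ring A] [Algebra F A] {x y : A}
    (hx : Algebra.adjoin F {x} = ⊤) (h : x ∈ Algebra.adjoin F {y}) : Algebra.adjoin F {y} = ⊤ := by
  rw [eq_top_iff, ← hx]
  exact Algebra.adjoin_le (Set.singleton_subset_iff.2 h)

lemma exists_integer_eq {x : K} (h : ∀ p : HeightOneSpectrum (𝓞 K), 0 ≤ ordAt p x) :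
    ∃ b : 𝓞 K, algebraMap (𝓞 K) K b = x := by
  refine HeightOneSpectrum.mem_integers_of_valuation_le_one K x fun p => ?_
  rcases eq_or_ne x 0 with rfl | hx
  · simp
  · rw [valuation_eq_exp p hx, ← WithZero.exp_zero, WithZero.exp_le_exp]
    linarith [h p]

/-- The largest pole order at `p` of the coefficients. -/
def poleOrd (n : ℕ) (a : ℕ → K) (p : HeightOneSpectrum (𝓞 K)) : ℤ :=
  (Finset.range (n + 1)).sup' (Finset.nonempty_range_iff.mpr n.succ_ne_zero) fun j => -ordAt p (a j)

lemma neg_ordAt_le_poleOrd {n : ℕ} {a : ℕ → K} (p : HeightOneSpectrum (𝓞 K)) {j : ℕ} (hj : j ≤ n) :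
    -ordAt p (a j) ≤ poleOrd n a p :=
  Finset.le_sup' (fun j => -ordAt p (a j)) (Finset.mem_range.2 (Nat.lt_succ_of_le hj))

lemma exists_poleOrd_eq (n : ℕ) (a : ℕ → K) (p : HeightOneSpectrum (𝓞 K)) :
    ∃ j ≤ n, poleOrd n a p = -ordAt p (a j) := by
  obtain ⟨j, hj, h⟩ := Finset.exists_mem_eq_sup' (Finset.nonempty_range_iff.mpr n.succ_ne_zero)
    fun j => -ordAt p (a j)
  exact ⟨j, Nat.lt_succ_iff.1 (Finset.mem_range.1 hj), h⟩

lemma ordAt_zero (p : HeightOneSpectrum (𝓞 K)) : ordAt p (0 : K) = 0 := by simp [ordAt]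

lemma finite_poleOrd (n : ℕ) (a : ℕ → K) : {p | poleOrd n a p ≠ 0}.Finite := by
  have h : (⋃ j ∈ Finset.range (n + 1), {p | ordAt p (a j) ≠ 0}).Finite := by
    refine Set.Finite.biUnion (Finset.finite_toSet _) fun j _ => ?_
    rcases eq_or_ne (a j) 0 with h0 | h0
    · simp [h0, ordAt_zero]
    · exact finite_ordAt_ne_zero h0
  refine h.subset fun p hp => ?_
  obtain ⟨j, hj, h⟩ := exists_poleOrd_eq n a p
  simp only [Set.mem_iUnion]
  refine ⟨j, Finset.mem_range.2 (Nat.lt_succ_of_le hj), fun h0 => hp ?_⟩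
  rw [h, h0, neg_zero]

lemma poleOrd_mul_log_le {n : ℕ} {a : ℕ → K} {μ : Pl K → ℝ} (hμ0 : ∀ v, 0 ≤ μ v)
    (ha : ∀ j ≤ n, ∀ v, Real.log (av v (a j)) ≤ μ v) (p : HeightOneSpectrum (𝓞 K)) :
    (poleOrd n a p : ℝ) * Real.log (Ideal.absNorm p.asIdeal) ≤ μ (.inr p) := by
  obtain ⟨j, hj, h⟩ := exists_poleOrd_eq n a p
  rw [h]
  rcases eq_or_ne (a j) 0 with h0 | h0
  · simpa [h0, ordAt_zero] using hμ0 _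
  · rw [Int.cast_neg, ← log_av_inr p h0]
    exact ha j hj _

lemma dexp_le_of_root (P : HeightOneSpectrum (𝓞 E)) {n : ℕ} (hn : 2 ≤ n) {a : ℕ → K} {α : E}
    (ha0 : a 0 ≠ 0) (hα : ev n (fun j => algebraMap K E (a j)) α = 0)
    (hd : dv n (fun j => algebraMap K E (a j)) α ≠ 0) (hgen : Algebra.adjoin K {α} = ⊤) :
    dexp K P ≤ (n - 1 : ℕ) * (rid K P * poleOrd n a (resP K P)) +
      ordAt P (algebraMap K E (a 0) ^ (n - 2) * dv n (fun j => algebraMap K E (a j)) α) := by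
  obtain ⟨c, hc0, hcp, hc⟩ := exists_ordAt_eq (finite_poleOrd n a) (resP K P)
  have hInt : ∀ j ≤ n, ∃ b : 𝓞 K, algebraMap (𝓞 K) K b = a j * c := by
    intro j hj
    refine exists_integer_eq fun p => ?_
    rcases eq_or_ne (a j) 0 with h0 | h0
    · simp [h0, ordAt_zero]
    · rw [ordAt_mul p h0 hc0]
      linarith [hc p, neg_ordAt_le_poleOrd (a := a) p hj]
  choose! b hb using hInt
  set G : Polynomial (𝓞 K) := Polynomial.X ^ n + ∑ i ∈ Finset.range n,
    Polynomial.C (b (i + 1) * b 0 ^ i) * Polynomial.X ^ (n - 1 - i) with hG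
  have hGm : G.Monic := by
    refine Polynomial.monic_X_pow_add ?_
    refine ((Polynomial.degree_sum_le _ _).trans (Finset.sup_le (a := ((n - 1 : ℕ) : WithBot ℕ))
      fun i _ => (Polynomial.degree_C_mul_X_pow_le _ _).trans ?_)).trans_lt ?_
    · exact_mod_cast Nat.sub_le _ _
    · exact_mod_cast (by omega : n - 1 < n)
  set φ := algebraMap K E with hφ
  have hbE : ∀ j ≤ n, algebraMap (𝓞 K) E (b j) = φ (a j) * φ c := fun j hj => by
    rw [IsScalarTower.algebraMap_apply (𝓞 K) K E, hb j hj, map_mul]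
  set θ : E := φ (a 0) * φ c * α with hθ
  have hk : φ (a 0) * φ c ≠ 0 := by
    rw [← map_mul]; simpa [ha0] using hc0
  have hθgen : Algebra.adjoin K {θ} = ⊤ := by
    refine adjoin_eq_top_of_mem hgen ?_
    have : α = (a 0 * c)⁻¹ • θ := by
      rw [Algebra.smul_def, map_inv₀, map_mul, hθ, inv_mul_cancel_left₀ hk]
    rw [this]
    exact Subalgebra.smul_mem _ (Algebra.self_mem_adjoin_singleton K θ) _
  have hG0 : Polynomial.aeval θ G = 0 := by
    have : Polynomial.aeval θ G = φ (a 0) ^ (n - 1) * φ c ^ n * ev n (fun j => φ (a j)) α := by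
      simp only [hG, map_add, map_sum, map_mul, map_pow, Polynomial.aeval_X, Polynomial.aeval_C]
      rw [ev_eq, mul_add, Finset.mul_sum]
      congr 1
      · rw [hθ, mul_pow, mul_pow]
        obtain ⟨k, rfl⟩ : ∃ k, n = k + 1 := ⟨n - 1, by omega⟩
        rw [Nat.add_sub_cancel]
        ring
      · refine Finset.sum_congr rfl fun i hi => ?_
        have hi := Finset.mem_range.1 hi
        rw [hbE _ hi, hbE 0 (Nat.zero_le _), hθ]
        obtain ⟨k, rfl⟩ : ∃ k, n = i + 1 + k := ⟨n - 1 - i, by omega⟩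
        rw [show i + 1 + k - 1 - i = k by omega, show i + 1 + k - 1 = i + k by omega]
        ring
    rw [this, hα, mul_zero]
  have hG1 : Polynomial.aeval θ (Polynomial.derivative G) =
      φ c ^ (n - 1) * (φ (a 0) ^ (n - 2) * dv n (fun j => φ (a j)) α) := by
    rw [hG, Polynomial.derivative_add, Polynomial.derivative_sum]
    simp only [Polynomial.derivative_X_pow, Polynomial.derivative_C_mul_X_pow]
    simp only [map_add, map_sum, map_mul, map_pow, Polynomial.aeval_X, Polynomial.aeval_C,
        map_natCast]
    rw [dv_eq (by omega), mul_add, mul_add, Finset.mul_sum, Finset.mul_sum]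
    congr 1
    · rw [hθ, mul_pow, mul_pow]
      obtain ⟨k, rfl⟩ : ∃ k, n = k + 2 := ⟨n - 2, by omega⟩
      rw [Nat.add_sub_cancel, show k + 2 - 1 = k + 1 by omega]
      ring
    · refine Finset.sum_congr rfl fun i hi => ?_
      have hi := Finset.mem_range.1 hi
      rw [hbE _ hi, hbE 0 (Nat.zero_le _), hθ]
      rcases eq_or_ne i (n - 1) with h | h
      · rw [h]; simp
      obtain ⟨k, rfl⟩ : ∃ k, n = i + 2 + k := ⟨n - 2 - i, by omega⟩
      rw [show i + 2 + k - 1 - i - 1 = k by omega, show i + 2 + k - 1 = i + 1 + k by omega,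
        show i + 2 + k - 2 - i = k by omega, show i + 2 + k - 2 = i + k by omega]
      ring
  have hzn : φ (a 0) ^ (n - 2) * dv n (fun j => φ (a j)) α ≠ 0 :=
    mul_ne_zero (pow_ne_zero _ (left_ne_zero_of_mul hk)) hd
  have hcn : φ c ≠ 0 := right_ne_zero_of_mul hk
  have h := dexp_le P hθgen hGm hG0 (by rw [hG1]; exact mul_ne_zero (pow_ne_zero _ hcn) hzn)
  rw [hG1, ordAt_mul P (pow_ne_zero _ hcn) hzn, ordAt_pow P hcn, ordAt_algebraMap, hcp] at h
  exact h

lemma log_discr_le_of_root {n : ℕ} (hn : 2 ≤ n) {a : ℕ → K} {α : E}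
    (ha0 : a 0 ≠ 0) (hα : ev n (fun j => algebraMap K E (a j)) α = 0)
    (hd : dv n (fun j => algebraMap K E (a j)) α ≠ 0) (hgen : Algebra.adjoin K {α} = ⊤)
    {μ : Pl K → ℝ} (hμ : FS μ) (hμ0 : ∀ v, 0 ≤ μ v)
    (ha : ∀ j ≤ n, ∀ v, Real.log (av v (a j)) ≤ μ v) :
    Real.log |(NumberField.discr E : ℝ)| ≤
      Module.finrank K E * (Real.log |(NumberField.discr K : ℝ)| + (n - 1) * ∑ᶠ v, μ v) +
        Module.finrank ℚ E * (n * Real.log n) := by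
  have hn1 : ((n - 1 : ℕ) : ℝ) = n - 1 := by rw [Nat.cast_sub (by omega)]; simp
  have hn0 : (0 : ℝ) ≤ n - 1 := by rw [← hn1]; positivity
  have hF := FS_res (E := E) hμ
  have hβ : FS fun w : Pl E => (n - 1 : ℝ) * (dg K w * μ (res K w)) + cc w * (n * Real.log n) :=
    FS.add' (hF.mul_left' _) (FS_cc_mul _)
  set z : E := algebraMap K E (a 0) ^ (n - 2) * dv n (fun j => algebraMap K E (a j)) α with hz
  have hz0 : z ≠ 0 := mul_ne_zero (pow_ne_zero _ (by simpa using ha0)) hd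
  have h := log_discr_le (K := K) hβ hz0 ?_ ?_
  · rw [finsum_add_distrib (hF.mul_left' _) (FS_cc_mul _), sum_cc_mul, ← mul_finsum,
      finsum_res hμ] at h
    linarith
  · intro P
    have h1 := dexp_le_of_root P hn ha0 hα hd hgen
    have h2 := poleOrd_mul_log_le hμ0 ha (resP K P)
    have h3 := log_norm_pos P
    have h4 := mul_le_mul_of_nonneg_right (Int.cast_le (R := ℝ).2 h1) h3.le
    refine h4.trans ?_
    rw [log_av_inr P hz0]
    push_cast
    rw [hn1, add_mul]
    have h5 : (n - 1 : ℝ) * (rid K P * poleOrd n a (resP K P)) *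
        Real.log (Ideal.absNorm P.asIdeal) ≤
        (n - 1 : ℝ) * (dg K (.inr P) * μ (res K (.inr P))) := by
      rw [mul_assoc]
      refine mul_le_mul_of_nonneg_left ?_ hn0
      rw [norm_resP (K := K) P]
      simp only [dg, res]
      push_cast
      rw [Real.log_pow]
      calc _ = (rid K P * fid K P : ℝ) * (poleOrd n a (resP K P) *
            Real.log (Ideal.absNorm (resP K P).asIdeal)) := by ring
        _ ≤ _ := mul_le_mul_of_nonneg_left h2 (by positivity)
    simp only [cc, Nat.cast_zero, zero_mul, add_zero]
    linarith
  · intro w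
    have hmult : (0 : ℝ) < w.mult := by exact_mod_cast w.mult_pos
    set M : ℝ := dg K (.inl w) * μ (res K (.inl w)) / w.mult with hM
    have hM0 : 0 ≤ M := div_nonneg (mul_nonneg (Nat.cast_nonneg _) (hμ0 _)) hmult.le
    have h1 := abs_dv_le (ab (.inl w)) hn hα (Real.one_le_exp hM0) fun j hj => by
      rcases eq_or_ne (a j) 0 with h0 | h0
      · simp only [h0, map_zero]; positivity
      · have h2 := mul_le_mul_of_nonneg_left (ha j hj (res K (.inl w)))
          (Nat.cast_nonneg (α := ℝ) (dg K (.inl w)))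
        rw [← log_av_algebraMap, log_av_eq] at h2
        have h3 : Real.log (ab (.inl w) (algebraMap K E (a j))) ≤ M := by
          rw [hM, le_div_iff₀ hmult, mul_comm]
          exact h2
        rw [← Real.log_le_iff_le_exp]
        · exact h3
        · exact (ab (.inl w)).pos (by simpa using h0)
    have h2 := Real.log_le_log ((ab (.inl w)).pos hz0) h1
    rw [Real.log_mul (by positivity) (by positivity), Real.log_pow, Real.log_pow, Real.log_exp,
      hn1] at h2
    have h3 := mul_le_mul_of_nonneg_left h2 hmult.le
    rw [log_av_eq]
    refine h3.trans (le_of_eq ?_)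
    have h4 : (w.mult : ℝ) * M = dg K (.inl w) * μ (res K (.inl w)) := by
      rw [hM]; field_simp
    simp only [cc]
    linear_combination (n - 1 : ℝ) * h4

lemma log_discr_le_of_pow_eq_one {m : ℕ} (hm : 1 ≤ m) {ζ : E} (hζ : ζ ^ m = 1)
    (hgen : Algebra.adjoin K {ζ} = ⊤) :
    Real.log |(NumberField.discr E : ℝ)| ≤
      Module.finrank K E * Real.log |(NumberField.discr K : ℝ)| +
        Module.finrank ℚ E * Real.log m := by
  have hζ0 : ζ ≠ 0 := by rintro rfl; rw [zero_pow (by omega)] at hζ; exact zero_ne_one hζ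
  have hm0 : (m : E) ≠ 0 := by exact_mod_cast (by omega : m ≠ 0)
  have hz0 : (m : E) * ζ ^ (m - 1) ≠ 0 := mul_ne_zero hm0 (pow_ne_zero _ hζ0)
  have h := log_discr_le (K := K) (FS_cc_mul (Real.log m)) hz0 ?_ ?_
  · rwa [sum_cc_mul] at h
  · intro P
    have h2 : Polynomial.aeval ζ (Polynomial.derivative (Polynomial.X ^ m - 1 : Polynomial (𝓞 K))) =
        (m : E) * ζ ^ (m - 1) := by
      rw [Polynomial.derivative_sub, Polynomial.derivative_X_pow, Polynomial.derivative_one]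
      simp
    have h1 := dexp_le (K := K) P hgen (G := Polynomial.X ^ m - 1)
      (Polynomial.monic_X_pow_sub_C 1 (by omega)) (by simp [hζ]) (by rwa [h2])
    rw [h2] at h1
    rw [log_av_inr P hz0]
    simp only [cc, Nat.cast_zero, zero_mul]
    have := mul_le_mul_of_nonneg_right (Int.cast_le (R := ℝ).2 h1) (log_norm_pos P).le
    linarith
  · intro w
    have h1 : ab (.inl w) ζ = 1 := by
      have : ab (.inl w) ζ ^ m = 1 := by rw [← map_pow, hζ, map_one]
      exact (pow_eq_one_iff_of_nonneg ((ab (.inl w)).nonneg _) (by omega)).1 this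
    rw [log_av_eq, map_mul, map_pow, h1, one_pow, mul_one]
    have : ab (.inl w) (m : E) = m := by
      simp only [ab]
      change w (m : E) = m
      rw [← InfinitePlace.norm_embedding_eq]
      simp
    rw [this]
    rfl

end DiscriminantSteps

end

section

variable {K : Type*} [Field K] [NumberField K]
variable {E : Type*} [Field E] [NumberField E] [Algebra K E]

section Kummer

/-- For an `m`-th root extension, `c` bounds the tame part of the different at a ramified prime
relative to its ramification index. -/
def IsKummerConst (m : ℕ) (c : ℝ) : Prop :=
  ∀ r : ℤ, ∃ k : ℕ, k.Coprime m ∧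
    (m - 1 : ℝ) * ((k * r % m : ℤ) : ℝ) ≤ m * (c * if (m : ℤ) ∣ r then 0 else 1)

lemma isKummerConst_of_prime {m : ℕ} (hm : m.Prime) : IsKummerConst m 1 := by
  intro r
  by_cases h : (m : ℤ) ∣ r
  · refine ⟨1, Nat.coprime_one_left m, ?_⟩
    simp [h, Int.emod_eq_zero_of_dvd h]
  · have hcop : IsCoprime r (m : ℤ) :=
      ((Nat.prime_iff_prime_int.1 hm).coprime_iff_not_dvd.2 h).symm
    obtain ⟨u, v, huv⟩ := hcop
    have hm0 : (m : ℤ) ≠ 0 := by exact_mod_cast hm.ne_zero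
    have hk : ((u % m).toNat : ℤ) = u % m := Int.toNat_of_nonneg (Int.emod_nonneg _ hm0)
    have h1 : ((u % m).toNat : ℤ) * r % m = 1 := by
      rw [hk, Int.mul_emod, Int.emod_emod_of_dvd _ dvd_rfl, ← Int.mul_emod,
        show u * r = 1 + m * (-v) by linarith, Int.add_mul_emod_self_left]
      exact Int.emod_eq_of_lt (by norm_num) (by exact_mod_cast hm.one_lt)
    refine ⟨(u % m).toNat, ?_, ?_⟩
    · refine (hm.coprime_iff_not_dvd.2 fun hdvd => ?_).symm
      rw [Int.emod_eq_zero_of_dvd (Dvd.dvd.mul_right (Int.natCast_dvd_natCast.2 hdvd) r)] at h1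
      exact zero_ne_one h1
    · rw [h1, if_neg h]
      simp

lemma isKummerConst_four : IsKummerConst 4 (3 / 2) := by
  intro r
  have h : r % 4 = 0 ∨ r % 4 = 1 ∨ r % 4 = 2 ∨ r % 4 = 3 := by omega
  rcases h with h | h | h | h
  · refine ⟨1, by norm_num, ?_⟩
    have : (4 : ℤ) ∣ r := by omega
    simp [h, this]
  · refine ⟨1, by norm_num, ?_⟩
    have : ¬ (4 : ℤ) ∣ r := by omega
    norm_num [h, this]
  · refine ⟨1, by norm_num, ?_⟩
    have : ¬ (4 : ℤ) ∣ r := by omega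
    norm_num [h, this]
  · refine ⟨3, by norm_num, ?_⟩
    have : ¬ (4 : ℤ) ∣ r := by omega
    have h3 : 3 * r % 4 = 1 := by omega
    norm_num [h3, this]

lemma dexp_le_of_kummer (P : HeightOneSpectrum (𝓞 E)) {m : ℕ} (hm : 2 ≤ m) {b : K} (hb : b ≠ 0)
    {ρ : E} (hρ : ρ ^ m = algebraMap K E b) (hgen : Algebra.adjoin K {ρ} = ⊤) {c : ℝ}
    (hc : IsKummerConst m c) :
    (dexp K P : ℝ) ≤ ordAt P (m : E) +
      c * (rid K P * if (m : ℤ) ∣ ordAt (resP K P) b then 0 else 1) := by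
  obtain ⟨k, hk, hkc⟩ := hc (ordAt (resP K P) b)
  have hmZ : (0 : ℤ) < m := by exact_mod_cast (by omega : 0 < m)
  have hfin : {p : HeightOneSpectrum (𝓞 K) | -(k * ordAt p b / m) ≠ 0}.Finite :=
    (finite_ordAt_ne_zero hb).subset fun p hp h => hp (by simp [h])
  obtain ⟨γ, hγ0, hγp, hγ⟩ := exists_ordAt_eq hfin (resP K P)
  have hord : ∀ p, ordAt p (b ^ k * γ ^ m) = k * ordAt p b + m * ordAt p γ := fun p => by
    rw [ordAt_mul p (pow_ne_zero _ hb) (pow_ne_zero _ hγ0), ordAt_pow p hb, ordAt_pow p hγ0]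
  obtain ⟨β, hβ⟩ := exists_integer_eq (x := b ^ k * γ ^ m) fun p => by
    have h1 := Int.emod_nonneg (k * ordAt p b) hmZ.ne'
    have h2 := Int.emod_add_mul_ediv (k * ordAt p b) m
    have h3 := mul_le_mul_of_nonneg_left (hγ p) hmZ.le
    rw [hord]
    linarith
  have hordp : ordAt (resP K P) (b ^ k * γ ^ m) = k * ordAt (resP K P) b % m := by
    have h2 := Int.emod_add_mul_ediv (k * ordAt (resP K P) b) m
    rw [hord, hγp]
    linarith
  have hbE : algebraMap K E b ≠ 0 := by simpa using hb
  have hγE : algebraMap K E γ ≠ 0 := by simpa using hγ0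
  have hρ0 : ρ ≠ 0 := by rintro rfl; rw [zero_pow (by omega)] at hρ; exact hbE hρ.symm
  set θ : E := ρ ^ k * algebraMap K E γ with hθ
  have hθ0 : θ ≠ 0 := mul_ne_zero (pow_ne_zero _ hρ0) hγE
  have hθm : θ ^ m = algebraMap K E (b ^ k * γ ^ m) := by
    rw [hθ, mul_pow, ← pow_mul, mul_comm k, pow_mul, hρ, map_mul, map_pow, map_pow]
  have hθgen : Algebra.adjoin K {θ} = ⊤ := by
    refine adjoin_eq_top_of_mem hgen ?_
    obtain ⟨l, -, hl⟩ := Nat.exists_mul_mod_eq_one_of_coprime hk (by omega)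
    obtain ⟨t, hl'⟩ : ∃ t, k * l = m * t + 1 :=
      ⟨k * l / m, by conv_lhs => rw [← Nat.div_add_mod (k * l) m, hl]⟩
    have h1 : ρ = (b ^ t * γ ^ l)⁻¹ • θ ^ l := by
      rw [Algebra.smul_def, map_inv₀, eq_inv_mul_iff_mul_eq₀ (by simp [hb, hγ0]), hθ, mul_pow,
        ← pow_mul, hl', pow_succ, pow_mul, hρ]
      simp only [map_mul, map_pow]
      ring
    rw [h1]
    exact Subalgebra.smul_mem _ (pow_mem (Algebra.self_mem_adjoin_singleton K θ) _) _
  have hG' : Polynomial.aeval θ (Polynomial.derivative (Polynomial.X ^ m - Polynomial.C β)) =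
      (m : E) * θ ^ (m - 1) := by
    rw [Polynomial.derivative_sub, Polynomial.derivative_X_pow, Polynomial.derivative_C]
    simp
  have hm0 : (m : E) ≠ 0 := by exact_mod_cast (by omega : m ≠ 0)
  have h := dexp_le P hθgen (Polynomial.monic_X_pow_sub_C β (by omega : m ≠ 0))
    (by rw [map_sub, map_pow, Polynomial.aeval_X, Polynomial.aeval_C,
      IsScalarTower.algebraMap_apply (𝓞 K) K E, hβ, hθm, sub_self])
    (by rw [hG']; exact mul_ne_zero hm0 (pow_ne_zero _ hθ0))
  rw [hG', ordAt_mul P hm0 (pow_ne_zero _ hθ0), ordAt_pow P hθ0] at h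
  have hθord : (m : ℤ) * ordAt P θ = rid K P * (k * ordAt (resP K P) b % m) := by
    rw [← ordAt_pow P hθ0, hθm, ordAt_algebraMap, hordp]
  have hmR : (0 : ℝ) < m := by exact_mod_cast hmZ
  have h' : (dexp K P : ℝ) ≤ ordAt P (m : E) + (m - 1 : ℝ) * ordAt P θ := by
    have := Int.cast_le (R := ℝ).2 h
    push_cast [Nat.cast_sub (show 1 ≤ m by omega)] at this
    exact this
  have hθR : (m : ℝ) * ordAt P θ = rid K P * ((k * ordAt (resP K P) b % m : ℤ) : ℝ) := by
    exact_mod_cast hθord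
  have h2 := mul_le_mul_of_nonneg_left hkc (Nat.cast_nonneg (α := ℝ) (rid K P))
  refine le_of_mul_le_mul_left (a := (m : ℝ)) ?_ hmR
  have h3 := mul_le_mul_of_nonneg_left h' hmR.le
  refine h3.trans ?_
  linear_combination h2 + (m - 1 : ℝ) * hθR

lemma two_le_rid (P : HeightOneSpectrum (𝓞 E)) {m : ℕ} (hm : 1 ≤ m) {b : K} (hb : b ≠ 0)
    {ρ : E} (hρ : ρ ^ m = algebraMap K E b) (h : ¬ (m : ℤ) ∣ ordAt (resP K P) b) :
    2 ≤ rid K P := by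
  by_contra! h2
  have h1 : rid K P = 1 := by have := rid_pos (K := K) P; omega
  have hbE : algebraMap K E b ≠ 0 := by simpa using hb
  have hρ0 : ρ ≠ 0 := by rintro rfl; rw [zero_pow (by omega)] at hρ; exact hbE hρ.symm
  apply h
  have h3 := ordAt_algebraMap P b
  rw [h1, Nat.cast_one, one_mul, ← hρ, ordAt_pow P hρ0] at h3
  exact ⟨_, h3.symm⟩

/-- The local contribution of the primes that may ramify tamely when an `m`-th root of `b` is
adjoined. -/
def ram (m : ℕ) (b : K) : Pl K → ℝ :=
  Sum.elim (fun _ => 0)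
    (fun p => if (m : ℤ) ∣ ordAt p b then 0 else Real.log (Ideal.absNorm p.asIdeal))

lemma FS_ram (m : ℕ) {b : K} (hb : b ≠ 0) : FS (ram m b) :=
  FS_of_fin ((finite_ordAt_ne_zero hb).subset fun p hp h => hp (by simp [ram, h]))

lemma ram_le_lq (m : ℕ) (b : K) (v : Pl K) : ram m b v ≤ lq v := by
  rcases v with w | p
  · simp [ram, lq]
  · simp only [ram, lq, Sum.elim_inr]
    split_ifs
    · exact (log_norm_pos p).le
    · exact le_rfl

lemma log_discr_le_of_kummer {m : ℕ} (hm : 2 ≤ m) {b : K} (hb : b ≠ 0)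
    {ρ : E} (hρ : ρ ^ m = algebraMap K E b) (hgen : Algebra.adjoin K {ρ} = ⊤) {c : ℝ}
    (hc : IsKummerConst m c) :
    Real.log |(NumberField.discr E : ℝ)| ≤
      Module.finrank K E * (Real.log |(NumberField.discr K : ℝ)| + c * ∑ᶠ v, ram m b v) +
        Module.finrank ℚ E * Real.log m := by
  have hF := FS_res (E := E) (FS_ram m hb)
  have hm0 : (m : E) ≠ 0 := by exact_mod_cast (by omega : m ≠ 0)
  have h := log_discr_le (K := K)
    (FS.add' (hF.mul_left' c) (FS_cc_mul (Real.log m))) hm0 ?_ ?_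
  · rw [finsum_add_distrib (hF.mul_left' _) (FS_cc_mul _), sum_cc_mul, ← mul_finsum,
      finsum_res (FS_ram m hb)] at h
    linarith
  · intro P
    have h1 := dexp_le_of_kummer P hm hb hρ hgen hc
    have h2 := mul_le_mul_of_nonneg_right h1 (log_norm_pos P).le
    refine h2.trans (le_of_eq ?_)
    rw [log_av_inr P hm0]
    have h3 : (dg K (.inr P) : ℝ) * ram m b (res K (.inr P)) =
        (rid K P * if (m : ℤ) ∣ ordAt (resP K P) b then 0 else 1) *
          Real.log (Ideal.absNorm P.asIdeal) := by
      rw [norm_resP (K := K) P]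
      simp only [dg, res, ram, Sum.elim_inr]
      push_cast
      rw [Real.log_pow]
      split_ifs <;> ring
    rw [h3]
    simp only [cc, Nat.cast_zero, zero_mul, add_zero]
    ring
  · intro w
    have : (av (.inl w) (m : E)) ≤ (m : ℝ) ^ cc (Sum.inl w : Pl E) := av_natCast_le _ _
    have h1 := Real.log_le_log (av_pos _ hm0) this
    rw [Real.log_pow] at h1
    have h2 : ram m b (res K (.inl w)) = 0 := by simp [ram, res]
    simpa [h2] using h1

lemma dg_le_finrank (w : Pl E) : (dg K w : ℝ) ≤ Module.finrank K E := by
  have h := sum_above_dg (E := E) {res K w} fun _ => 1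
  simp only [mul_one, Finset.sum_singleton] at h
  rw [← h]
  exact Finset.single_le_sum (f := fun w => (dg K w : ℝ)) (fun _ _ => Nat.cast_nonneg _)
    (mem_above.2 (Finset.mem_singleton_self _))

lemma lq_eq (w : Pl E) : (lq w = 0) ∨ ∃ P : HeightOneSpectrum (𝓞 E), w = .inr P ∧
    lq w = fid K P * lq (res K w) := by
  rcases w with w | P
  · exact .inl (by simp [lq])
  · refine .inr ⟨P, rfl, ?_⟩
    simp only [lq, res]
    rw [norm_resP (K := K) P]
    push_cast
    rw [Real.log_pow]

lemma sum_ram_add_lq_le {m : ℕ} (hm : 2 ≤ m) {b : K} (hb : b ≠ 0)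
    {ρ : E} (hρ : ρ ^ m = algebraMap K E b) {c : ℝ} (hc : 1 ≤ c) {S : Finset (Pl K)}
    {w : Pl E} (hw : res K w ∈ S) :
    Module.finrank K E * (c * ∑ v ∈ S, ram m b v) + lq w ≤
      Module.finrank K E * ((c + 1 / 2) * ∑ v ∈ S, lq v) := by
  have hD : (0 : ℝ) ≤ Module.finrank K E := Nat.cast_nonneg _
  have h1 : ∑ v ∈ S.erase (res K w), ram m b v ≤ ∑ v ∈ S.erase (res K w), lq v :=
    Finset.sum_le_sum fun v _ => ram_le_lq m b v
  have h0 : 0 ≤ ∑ v ∈ S.erase (res K w), lq v := Finset.sum_nonneg fun v _ => lq_nonneg v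
  rw [← Finset.add_sum_erase S _ hw, ← Finset.add_sum_erase S lq hw]
  have hlq := lq_nonneg (res K w)
  suffices h : Module.finrank K E * (c * ram m b (res K w)) + lq w ≤
      Module.finrank K E * ((c + 1 / 2) * lq (res K w)) by
    have h2 : (Module.finrank K E : ℝ) * (c * ∑ v ∈ S.erase (res K w), ram m b v) ≤
        Module.finrank K E * ((c + 1 / 2) * ∑ v ∈ S.erase (res K w), lq v) := by
      refine mul_le_mul_of_nonneg_left ?_ hD
      nlinarith
    linarith
  have hram := ram_le_lq m b (res K w)
  have hcram : c * ram m b (res K w) ≤ c * lq (res K w) :=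
    mul_le_mul_of_nonneg_left hram (by linarith)
  rcases lq_eq (K := K) w with h | ⟨P, rfl, h⟩
  · rw [h, add_zero]
    refine mul_le_mul_of_nonneg_left ?_ hD
    linarith
  · rw [h]
    have hdg : (rid K P : ℝ) * fid K P ≤ Module.finrank K E := by
      have := dg_le_finrank (K := K) (.inr P : Pl E)
      simpa [dg] using this
    have hf0 : (0 : ℝ) ≤ fid K P := Nat.cast_nonneg _
    have hr1 : (1 : ℝ) ≤ rid K P := by exact_mod_cast rid_pos P
    by_cases hd : (m : ℤ) ∣ ordAt (resP K P) b
    · have h2 : ram m b (res K (.inr P)) = 0 := by simp [ram, res, hd]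
      rw [h2, mul_zero, mul_zero, zero_add]
      have h3 : (fid K P : ℝ) ≤ Module.finrank K E := by nlinarith
      calc (fid K P : ℝ) * lq (res K (.inr P)) ≤ Module.finrank K E * lq (res K (.inr P)) := by
            gcongr
        _ ≤ _ := by
            refine mul_le_mul_of_nonneg_left ?_ hD
            nlinarith
    · have h4 : (2 : ℝ) ≤ rid K P := by exact_mod_cast two_le_rid P (by omega) hb hρ hd
      have h3 : (fid K P : ℝ) ≤ Module.finrank K E / 2 := by nlinarith
      have h5 := mul_le_mul_of_nonneg_left hcram hD
      have h6 := mul_le_mul_of_nonneg_right h3 hlq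
      linarith

lemma log_discr_add_lq_le {m : ℕ} (hm : 2 ≤ m) {b : K} (hb : b ≠ 0)
    {ρ : E} (hρ : ρ ^ m = algebraMap K E b) (hgen : Algebra.adjoin K {ρ} = ⊤) {c : ℝ}
    (hc : IsKummerConst m c) (hc1 : 1 ≤ c) {S : Finset (Pl K)} {w : Pl E} (hw : res K w ∈ S)
    {z : K} (hz : z ≠ 0)
    (hzS : ∀ v ∉ S, ram m b v ≤ -Real.log (av v z)) :
    Real.log |(NumberField.discr E : ℝ)| + lq w ≤
      Module.finrank K E * (Real.log |(NumberField.discr K : ℝ)| +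
        c * ∑ v ∈ S, Real.log (av v z) + (c + 1 / 2) * ∑ v ∈ S, lq v) +
        Module.finrank ℚ E * Real.log m := by
  have h1 := log_discr_le_of_kummer hm hb hρ hgen hc
  have h2 := sum_ram_add_lq_le hm hb hρ hc1 hw
  rw [finsum_eq_sum_add_off (FS_ram m hb) S] at h1
  have hpf := product_formula hz
  rw [finsum_eq_sum_add_off (FS_log_av hz) S] at hpf
  have h3 : ∑ᶠ v, off S (ram m b) v ≤ ∑ v ∈ S, Real.log (av v z) := by
    have h4 : ∑ᶠ v, off S (ram m b) v ≤ ∑ᶠ v, -off S (fun v => Real.log (av v z)) v := by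
      refine finsum_le_of_FS (FS.off (FS_ram m hb) S) (FS.off (FS_log_av hz) S).neg' fun v => ?_
      by_cases hv : v ∈ S
      · rw [off_of_mem hv, off_of_mem hv, neg_zero]
      · rw [off_of_notMem hv, off_of_notMem hv]
        exact hzS v hv
    rw [finsum_neg_distrib] at h4
    linarith
  have hD : (0 : ℝ) ≤ Module.finrank K E := Nat.cast_nonneg _
  have h5 := mul_le_mul_of_nonneg_left (mul_le_mul_of_nonneg_left h3 (by linarith : 0 ≤ c)) hD
  linarith

end Kummer

end

section

variable {K : Type*} [Field K] [NumberField K]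

local notation "gg" => (Module.finrank ℚ K : ℝ)

section LocalHeights

/-- The local height `log max(1, |x|_v)`. -/
def lp (v : Pl K) (x : K) : ℝ := Real.log (max 1 (av v x))

lemma lp_nonneg (v : Pl K) (x : K) : 0 ≤ lp v x := log_max_one_nonneg _

lemma FS_lp (x : K) : FS fun v => lp v x := FS_log_max_one

lemma finsum_lp (x : K) : ∑ᶠ v, lp v x = HH x := rfl

lemma lp_le_HH (v : Pl K) (x : K) : lp v x ≤ HH x := log_max_one_av_le v x

lemma log_av_le_lp (v : Pl K) (x : K) : Real.log (av v x) ≤ lp v x :=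
  log_le_log_max_one (av_nonneg v x)

lemma av_le_exp_lp (v : Pl K) (x : K) : av v x ≤ Real.exp (lp v x) := by
  rw [lp, Real.exp_log (by positivity)]
  exact le_max_right _ _

lemma lp_le_of_av_le {v : Pl K} {x : K} {B : ℝ} (hB : 0 ≤ B) (h : av v x ≤ Real.exp B) :
    lp v x ≤ B := by
  rw [lp, Real.log_le_iff_le_exp (by positivity)]
  exact max_le (Real.one_le_exp hB) h

lemma log_two_mul_cc (v : Pl K) (B : ℝ) :
    (2 : ℝ) ^ cc v * Real.exp B = Real.exp (cc v * Real.log 2 + B) := by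
  rw [Real.exp_add, Real.exp_nat_mul, Real.exp_log (by norm_num)]

lemma cc_mul_log_two_nonneg (v : Pl K) : 0 ≤ cc v * Real.log 2 := by positivity

lemma lp_sub_le' {v : Pl K} {x y : K} {B : ℝ} (hx : lp v x ≤ B) (hy : lp v y ≤ B) :
    lp v (x - y) ≤ cc v * Real.log 2 + B := by
  have hB := (lp_nonneg v x).trans hx
  refine lp_le_of_av_le (add_nonneg (cc_mul_log_two_nonneg v) hB) ?_
  rw [← log_two_mul_cc]
  exact av_sub_le v x y ((av_le_exp_lp v x).trans (Real.exp_le_exp.2 hx))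
    ((av_le_exp_lp v y).trans (Real.exp_le_exp.2 hy))

lemma lp_neg (v : Pl K) (x : K) : lp v (-x) = lp v x := by rw [lp, av_neg, lp]

lemma lp_one (v : Pl K) : lp v (1 : K) = 0 := by simp [lp]

lemma lp_add_le' {v : Pl K} {x y : K} {B : ℝ} (hx : lp v x ≤ B) (hy : lp v y ≤ B) :
    lp v (x + y) ≤ cc v * Real.log 2 + B := by
  rw [← sub_neg_eq_add]
  exact lp_sub_le' hx (by rwa [lp_neg])

lemma lp_mul_le (v : Pl K) (x y : K) : lp v (x * y) ≤ lp v x + lp v y := by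
  refine lp_le_of_av_le (add_nonneg (lp_nonneg _ _) (lp_nonneg _ _)) ?_
  rw [map_mul, Real.exp_add]
  exact mul_le_mul (av_le_exp_lp v x) (av_le_exp_lp v y) (av_nonneg _ _) (Real.exp_pos _).le

lemma lp_sub_le (v : Pl K) (x y : K) : lp v (x - y) ≤ cc v * Real.log 2 + (lp v x + lp v y) :=
  lp_sub_le' (by linarith [lp_nonneg v y]) (by linarith [lp_nonneg v x])

lemma av_eq_one_of_pow_eq_one (v : Pl K) {ζ : K} {m : ℕ} (hm : m ≠ 0) (h : ζ ^ m = 1) :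
    av v ζ = 1 :=
  (pow_eq_one_iff_of_nonneg (av_nonneg v ζ) hm).1 (by rw [← map_pow, h, map_one])

lemma lp_mul_of_av_eq_one {v : Pl K} {ζ : K} (h : av v ζ = 1) (x : K) :
    lp v (ζ * x) = lp v x := by rw [lp, map_mul, h, one_mul, lp]

lemma lp_of_av_eq_one {v : Pl K} {ζ : K} (h : av v ζ = 1) : lp v ζ = 0 := by
  simp [lp, h]

lemma HH_sub_le (x y : K) : HH (x - y) ≤ gg * Real.log 2 + (HH x + HH y) := by
  rw [← sum_cc_mul, ← finsum_lp, ← finsum_lp, ← finsum_lp,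
    ← finsum_add_distrib (FS_lp x) (FS_lp y),
    ← finsum_add_distrib (FS_cc_mul _) ((FS_lp x).add' (FS_lp y))]
  exact finsum_le_of_FS (FS_lp _) ((FS_cc_mul _).add' ((FS_lp x).add' (FS_lp y)))
    fun v => lp_sub_le v x y

lemma HH_eq_zero_of_pow_eq_one {ζ : K} {m : ℕ} (hm : m ≠ 0) (h : ζ ^ m = 1) : HH ζ = 0 := by
  rw [← finsum_lp, ← finsum_zero (α := Pl K)]
  exact finsum_congr fun v => lp_of_av_eq_one (av_eq_one_of_pow_eq_one v hm h)

lemma HH_neg (x : K) : HH (-x) = HH x := finsum_congr fun v => lp_neg v x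

/-- A quotient whose numerator and denominator are both bounded by `2^k max(1, |y|) ⋯`. -/
lemma HH_div_le_of_lp {p q : K} (hq : q ≠ 0) {f : Pl K → ℝ} (hf : FS f) {c : ℝ}
    (h1 : ∀ v, lp v p ≤ cc v * c + f v) (h2 : ∀ v, lp v q ≤ cc v * c + f v) :
    HH (p / q) ≤ gg * c + ∑ᶠ v, f v := by
  rw [← sum_cc_mul, ← finsum_add_distrib (FS_cc_mul c) hf]
  exact HH_div_le hq ((FS_cc_mul c).add' hf) (fun v => .inl ((log_av_le_lp v p).trans (h1 v)))
    fun v => (log_av_le_lp v q).trans (h2 v)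

lemma HH_ratio_le {x α β : K} (h : x - α ≠ 0) :
    HH ((x - β) / (x - α)) ≤ gg * Real.log 2 + (HH x + HH α + HH β) := by
  have hF : FS fun v => lp v x + lp v α + lp v β := ((FS_lp x).add' (FS_lp α)).add' (FS_lp β)
  refine (HH_div_le_of_lp h hF (c := Real.log 2) (fun v => ?_) fun v => ?_).trans (le_of_eq ?_)
  · refine lp_sub_le' ?_ ?_ <;> linarith [lp_nonneg v x, lp_nonneg v α, lp_nonneg v β]
  · refine lp_sub_le' ?_ ?_ <;> linarith [lp_nonneg v x, lp_nonneg v α, lp_nonneg v β]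
  · rw [finsum_add_distrib ((FS_lp x).add' (FS_lp α)) (FS_lp β),
      finsum_add_distrib (FS_lp x) (FS_lp α)]
    rfl

lemma HH_le_of_ratio {x α β b : K} (hb : b * (x - α) = x - β) (hb1 : b ≠ 1) :
    HH x ≤ gg * Real.log 2 + (HH b + HH α + HH β) := by
  have hF : FS fun v => lp v b + lp v α + lp v β := ((FS_lp b).add' (FS_lp α)).add' (FS_lp β)
  have hb0 : b - 1 ≠ 0 := sub_ne_zero.2 hb1
  have hx : x = (b * α - β) / (b - 1) := by
    rw [eq_div_iff hb0]; linear_combination hb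
  rw [hx]
  refine (HH_div_le_of_lp hb0 hF (c := Real.log 2) (fun v => ?_) fun v => ?_).trans (le_of_eq ?_)
  · refine lp_sub_le' ?_ ?_ <;>
      linarith [lp_mul_le v b α, lp_nonneg v b, lp_nonneg v α, lp_nonneg v β]
  · refine lp_sub_le' ?_ ?_
    · linarith [lp_nonneg v b, lp_nonneg v α, lp_nonneg v β]
    · rw [lp_one]; linarith [lp_nonneg v b, lp_nonneg v α, lp_nonneg v β]
  · rw [finsum_add_distrib ((FS_lp b).add' (FS_lp α)) (FS_lp β),
      finsum_add_distrib (FS_lp b) (FS_lp α)]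
    rfl

end LocalHeights

section RootQuotient

variable {m : ℕ} {ζ ρ : K}

/-- The quotient `(1+ζ)(1-ζρ)/(1-ζ²ρ)`, which equals `1` at `ρ = 1`. -/
def uq (ζ ρ : K) : K := (1 + ζ) * (1 - ζ * ρ) / (1 - ζ ^ 2 * ρ)

lemma one_sub_uq (h : 1 - ζ ^ 2 * ρ ≠ 0) : 1 - uq ζ ρ = -ζ * (1 - ρ) / (1 - ζ ^ 2 * ρ) := by
  rw [uq]; field_simp; ring

lemma lp_one_add_le {v : Pl K} (hζ : av v ζ = 1) : lp v (1 + ζ) ≤ cc v * Real.log 2 := by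
  have := lp_add_le' (v := v) (x := 1) (y := ζ) (B := 0) (lp_one v).le (lp_of_av_eq_one hζ).le
  linarith

lemma lp_one_sub_mul_le {v : Pl K} {θ : K} (hθ : av v θ = 1) (ρ : K) :
    lp v (1 - θ * ρ) ≤ cc v * Real.log 2 + lp v ρ :=
  lp_sub_le' (by rw [lp_one]; exact lp_nonneg _ _) (lp_mul_of_av_eq_one hθ ρ).le

lemma HH_uq_le (hm : m ≠ 0) (hζ : ζ ^ m = 1) (h : 1 - ζ ^ 2 * ρ ≠ 0) :
    HH (uq ζ ρ) ≤ gg * (2 * Real.log 2) + HH ρ := by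
  refine HH_div_le_of_lp h (FS_lp ρ) (fun v => ?_) fun v => ?_
  · have h1 := av_eq_one_of_pow_eq_one v hm hζ
    linarith [lp_mul_le v (1 + ζ) (1 - ζ * ρ), lp_one_add_le h1, lp_one_sub_mul_le h1 ρ]
  · have h1 := av_eq_one_of_pow_eq_one v hm (ζ := ζ ^ 2) (by rw [← pow_mul, mul_comm, pow_mul, hζ,
      one_pow])
    linarith [lp_one_sub_mul_le h1 ρ, cc_mul_log_two_nonneg v]

lemma HH_le_HH_uq (hm : m ≠ 0) (hζ : ζ ^ m = 1) (h : 1 - ζ ^ 2 * ρ ≠ 0)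
    (hζ1 : ζ ≠ 1) (hζ2 : 1 + ζ ≠ 0) : HH ρ ≤ gg * (2 * Real.log 2) + HH (uq ζ ρ) := by
  set u := uq ζ ρ with hu
  have hζ0 : ζ ≠ 0 := by rintro rfl; rw [zero_pow hm] at hζ; exact zero_ne_one hζ
  have hu1 : u * (1 - ζ ^ 2 * ρ) = (1 + ζ) * (1 - ζ * ρ) := by
    rw [hu, uq, div_mul_cancel₀ _ h]
  have hq : ζ * (ζ * u - (1 + ζ)) ≠ 0 := by
    refine mul_ne_zero hζ0 fun h0 => ?_
    have h2 : (1 + ζ) * (1 - ζ) = 0 := by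
      linear_combination ζ * hu1 - h0 * (1 - ζ ^ 2 * ρ)
    rcases mul_eq_zero.1 h2 with h3 | h3
    · exact hζ2 h3
    · exact hζ1 (by linear_combination -h3)
  have hρ : ρ = (u - (1 + ζ)) / (ζ * (ζ * u - (1 + ζ))) := by
    rw [eq_div_iff hq]; linear_combination -hu1
  rw [hρ]
  refine HH_div_le_of_lp hq (FS_lp u) (fun v => ?_) fun v => ?_
  · have h1 := av_eq_one_of_pow_eq_one v hm hζ
    have h2 := lp_one_add_le h1
    have h3 := lp_sub_le' (v := v) (x := u) (y := 1 + ζ) (B := cc v * Real.log 2 + lp v u)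
      (by linarith [cc_mul_log_two_nonneg v]) (by linarith [lp_nonneg v u])
    linarith
  · have h1 := av_eq_one_of_pow_eq_one v hm hζ
    have h2 := lp_one_add_le h1
    have h3 := lp_sub_le' (v := v) (x := ζ * u) (y := 1 + ζ) (B := cc v * Real.log 2 + lp v u)
      (by rw [lp_mul_of_av_eq_one h1]; linarith [cc_mul_log_two_nonneg v])
      (by linarith [lp_nonneg v u])
    rw [lp_mul_of_av_eq_one h1]
    linarith

lemma log_av_one_sub_ge {v : Pl K} (hv : cc v = 0) (hm : m ≠ 0) {θ : K} (hθ : θ ^ m = 1)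
    (hρ : 1 - ρ ^ m ≠ 0) :
    Real.log (av v (1 - ρ ^ m)) ≤ Real.log (av v (1 - θ * ρ)) + (m - 1) * lp v ρ := by
  have h1 := av_eq_one_of_pow_eq_one v hm hθ
  have h2 : 1 - ρ ^ m = (1 - θ * ρ) * ∑ i ∈ Finset.range m, (θ * ρ) ^ i := by
    rw [mul_neg_geom_sum, mul_pow, hθ, one_mul]
  have ht : 1 - θ * ρ ≠ 0 := by rintro h; rw [h2, h, zero_mul] at hρ; exact hρ rfl
  have hs : ∑ i ∈ Finset.range m, (θ * ρ) ^ i ≠ 0 := by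
    rintro h; rw [h2, h, mul_zero] at hρ; exact hρ rfl
  have hm1 : ((m - 1 : ℕ) : ℝ) = m - 1 := by
    rw [Nat.cast_sub (Nat.one_le_iff_ne_zero.2 hm), Nat.cast_one]
  have h3 : av v (∑ i ∈ Finset.range m, (θ * ρ) ^ i) ≤ max 1 (av v ρ) ^ (m - 1) := by
    have := av_sum_le v (Finset.range m) (f := fun i => (θ * ρ) ^ i)
      (B := max 1 (av v ρ) ^ (m - 1)) (by positivity) fun i hi => by
        rw [map_pow, map_mul, h1, one_mul]
        refine (pow_le_pow_left₀ (av_nonneg _ _) (le_max_right 1 _) i).trans ?_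
        exact pow_le_pow_right₀ (le_max_left _ _) (by have := Finset.mem_range.1 hi; omega)
    simpa [hv] using this
  have h4 := Real.log_le_log (av_pos v hs) h3
  rw [Real.log_pow, hm1] at h4
  rw [h2, log_av_mul v ht hs]
  exact add_le_add le_rfl h4

lemma abs_log_av_div_le {v : Pl K} (hv : cc v = 0) (hm : m ≠ 0) {θ η : K} (hθ : θ ^ m = 1)
    (hη : η ^ m = 1) (hρ : 1 - ρ ^ m ≠ 0) (h1 : 1 - θ * ρ ≠ 0) (h2 : 1 - η * ρ ≠ 0) :
    |Real.log (av v ((1 - θ * ρ) / (1 - η * ρ)))| ≤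
      lp v (ρ ^ m) - Real.log (av v (1 - ρ ^ m)) := by
  have h3 := log_av_one_sub_ge hv hm hθ hρ
  have h4 := log_av_one_sub_ge hv hm hη hρ
  have h5 := (log_av_le_lp v _).trans (lp_one_sub_mul_le (av_eq_one_of_pow_eq_one v hm hθ) ρ)
  have h6 := (log_av_le_lp v _).trans (lp_one_sub_mul_le (av_eq_one_of_pow_eq_one v hm hη) ρ)
  have h7 : lp v (ρ ^ m) = m * lp v ρ := by
    rw [lp, lp, map_pow, log_max_one_pow (av_nonneg _ _)]
  rw [hv, Nat.cast_zero, zero_mul, zero_add] at h5 h6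
  rw [log_av_div v h1 h2, h7, abs_le]
  constructor <;> linarith

end RootQuotient

end

section

variable {K : Type*} [Field K] [NumberField K]

local notation "gg" => (Module.finrank ℚ K : ℝ)

section CloseToOne

variable {m : ℕ} {ζ ρ x α β : K}

lemma lp_ratio_sub_log_le {v : Pl K} (hv : cc v = 0) (hxv : av v x ≤ 1) (hαβ : α ≠ β)
    (hxα : x ≠ α) (hxβ : x ≠ β) {b : K} (hb : b * (x - α) = x - β) :
    lp v b - Real.log (av v (1 - b)) ≤ lp v α + lp v β + lp v (β - α)⁻¹ := by
  have h1 : x - α ≠ 0 := sub_ne_zero.2 hxα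
  have h2 : x - β ≠ 0 := sub_ne_zero.2 hxβ
  have h3 : β - α ≠ 0 := sub_ne_zero.2 hαβ.symm
  have hb' : b = (x - β) / (x - α) := by rw [eq_div_iff h1, hb]
  have hb1 : 1 - b = (β - α) / (x - α) := by
    rw [eq_div_iff h1]; linear_combination -hb
  have hx0 : lp v x = 0 := by rw [lp, max_eq_left hxv, Real.log_one]
  have h4 := lp_sub_le v x α
  have h5 := lp_sub_le v x β
  rw [hv, hx0, Nat.cast_zero, zero_mul] at h4 h5
  have h6 := log_av_le_lp v (x - α)
  have h7 := log_av_le_lp v (x - β)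
  have h8 : lp v b ≤ lp v α + lp v β - Real.log (av v (x - α)) := by
    refine log_max_one_le ?_ ?_
    · linarith [lp_nonneg v β]
    · rw [hb', log_av_div v h2 h1]; linarith [lp_nonneg v α]
  have h9 := log_av_le_lp v (β - α)⁻¹
  rw [log_av_inv v] at h9
  rw [hb1, log_av_div v h3 h1]
  linarith

lemma one_sub_mul_ne_zero (hρ : 1 - ρ ^ m ≠ 0) {θ : K} (hθ : θ ^ m = 1) : 1 - θ * ρ ≠ 0 := by
  intro h
  apply hρ
  have : (θ * ρ) ^ m = 1 := by rw [← sub_eq_zero.1 h, one_pow]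
  rw [mul_pow, hθ, one_mul] at this
  rw [this, sub_self]

lemma finsum_off_abs_log_uq_le {S : Finset (Pl K)} (hS : ∀ w, .inl w ∈ S) (hm : m ≠ 0)
    (hζ : ζ ^ m = 1) (hζ2 : 1 + ζ ≠ 0) (hαβ : α ≠ β) (hxα : x ≠ α) (hxβ : x ≠ β)
    (hρ : ρ ^ m * (x - α) = x - β) (hρ1 : 1 - ρ ^ m ≠ 0) (hx : ∀ v ∉ S, av v x ≤ 1) :
    ∑ᶠ v, off S (fun v => |Real.log (av v (uq ζ ρ))|) v ≤
      2 * (HH α + HH β) + gg * (3 * Real.log 2) := by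
  have hζ' : (ζ ^ 2) ^ m = 1 := by rw [← pow_mul, mul_comm, pow_mul, hζ, one_pow]
  have h1 := one_sub_mul_ne_zero hρ1 hζ
  have h2 := one_sub_mul_ne_zero hρ1 hζ'
  have hβα : β - α ≠ 0 := sub_ne_zero.2 hαβ.symm
  have hu : uq ζ ρ ≠ 0 := div_ne_zero (mul_ne_zero hζ2 h1) h2
  have hFab : ∀ {y : K}, y ≠ 0 → FS fun v => |Real.log (av v y)| := fun hy =>
    (FS_log_av hy).comp' fun v h => by simp [h]
  have hF3 : FS fun v => lp v α + lp v β + lp v (β - α)⁻¹ :=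
    ((FS_lp α).add' (FS_lp β)).add' (FS_lp _)
  have hF := (hFab hζ2).add' hF3
  have hle : ∑ᶠ v, off S (fun v => |Real.log (av v (uq ζ ρ))|) v ≤
      ∑ᶠ v, (|Real.log (av v (1 + ζ))| + (lp v α + lp v β + lp v (β - α)⁻¹)) := by
    refine finsum_le_of_FS (FS.off (hFab hu) S) hF fun v => ?_
    have hnn : 0 ≤ |Real.log (av v (1 + ζ))| + (lp v α + lp v β + lp v (β - α)⁻¹) := by
      linarith [abs_nonneg (Real.log (av v (1 + ζ))), lp_nonneg v α, lp_nonneg v β,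
        lp_nonneg v (β - α)⁻¹]
    by_cases hv : v ∈ S
    · rwa [off_of_mem hv]
    rw [off_of_notMem hv]
    have hcc : cc v = 0 := by
      rcases v with w | p
      · exact absurd (hS w) hv
      · rfl
    have h3 := abs_log_av_div_le hcc hm hζ hζ' hρ1 h1 h2
    have h4 := lp_ratio_sub_log_le hcc (hx v hv) hαβ hxα hxβ hρ
    rw [uq, mul_div_assoc, log_av_mul v hζ2 (div_ne_zero h1 h2)]
    exact (abs_add_le _ _).trans (by linarith)
  rw [finsum_add_distrib (hFab hζ2) hF3,
    finsum_add_distrib ((FS_lp α).add' (FS_lp β)) (FS_lp _),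
    finsum_add_distrib (FS_lp α) (FS_lp β), finsum_abs_log hζ2, finsum_lp, finsum_lp, finsum_lp,
    HH_inv] at hle
  have h5 := HH_sub_le β α
  have h6 := HH_sub_le (1 : K) (-ζ)
  rw [sub_neg_eq_add, HH_neg, HH_eq_zero_of_pow_eq_one hm hζ,
    HH_eq_zero_of_pow_eq_one hm (one_pow m)] at h6
  linarith

lemma gg_mul_nonneg {c : ℝ} (hc : 0 ≤ c) : 0 ≤ gg * c := by positivity

lemma cc_mul_log_two_le (v : Pl K) : cc v * Real.log 2 ≤ gg * Real.log 2 :=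
  mul_le_mul_of_nonneg_right (cc_le_finrank v) (Real.log_nonneg (by norm_num))

lemma mul_log_av_one_sub_le (hαβ : α ≠ β) (hxα : x ≠ α)
    (hρ : ρ ^ m * (x - α) = x - β) {w : Pl K} (hρ1 : 1 - ρ ≠ 0)
    (hmin : av w (1 - ρ) ^ m ≤ av w (1 - ρ ^ m))
    (hX : gg * Real.log 2 + (HH α + HH β) < lp w x) :
    m * Real.log (av w (1 - ρ)) ≤ 2 * (HH α + HH β) + gg * (2 * Real.log 2) - lp w x := by
  have h1 : x - α ≠ 0 := sub_ne_zero.2 hxα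
  have h3 : β - α ≠ 0 := sub_ne_zero.2 hαβ.symm
  have hb1 : 1 - ρ ^ m = (β - α) / (x - α) := by
    rw [eq_div_iff h1]; linear_combination -hρ
  have h4 := Real.log_le_log (pow_pos (av_pos w hρ1) m) hmin
  rw [Real.log_pow, hb1, log_av_div w h3 h1] at h4
  have h5 := (log_av_le_lp w _).trans (lp_sub_le w β α)
  have h6 := lp_add_le' (v := w) (x := x - α) (y := α) (B := lp w (x - α) + lp w α)
    (by linarith [lp_nonneg w α]) (by linarith [lp_nonneg w (x - α)])
  rw [sub_add_cancel] at h6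
  have h7 := lp_le_HH w α
  have h8 := lp_le_HH w β
  have h9 := cc_mul_log_two_le w
  have h10 : lp w (x - α) = Real.log (av w (x - α)) := by
    have h11 : lp w (x - α) = max 0 (Real.log (av w (x - α))) := log_max_one_eq _ (av_nonneg _ _)
    rcases max_choice 0 (Real.log (av w (x - α))) with h | h
    · rw [h] at h11
      linarith [HH_nonneg β]
    · rw [h11, h]
  linarith [HH_nonneg β]

lemma log_av_one_sub_uq_le (hm : m ≠ 0) (hζ : ζ ^ m = 1) (hζ2 : 1 - ζ ^ 2 ≠ 0) {w : Pl K}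
    (hρ1 : 1 - ρ ≠ 0) (hρ2 : 1 - ζ ^ 2 * ρ ≠ 0)
    (hsmall : Real.log (av w (1 - ρ)) < -(gg * (2 * Real.log 2))) :
    Real.log (av w (1 - uq ζ ρ)) ≤ Real.log (av w (1 - ρ)) + gg * (2 * Real.log 2) := by
  have hζ' : (ζ ^ 2) ^ m = 1 := by rw [← pow_mul, mul_comm, pow_mul, hζ, one_pow]
  have hz1 := av_eq_one_of_pow_eq_one w hm hζ
  have hz2 := av_eq_one_of_pow_eq_one w hm hζ'
  have hζ0 : ζ ≠ 0 := by rintro rfl; rw [zero_pow hm] at hζ; exact zero_ne_one hζ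
  have h1 := neg_HH_le w hζ2
  have h2 := HH_sub_le (1 : K) (ζ ^ 2)
  rw [HH_eq_zero_of_pow_eq_one hm hζ', HH_eq_zero_of_pow_eq_one hm (one_pow m)] at h2
  have h9 := cc_mul_log_two_le w
  have h3 : av w (1 - ζ ^ 2) ≤ 2 ^ cc w * max (av w (1 - ζ ^ 2 * ρ)) (av w (1 - ρ)) := by
    rw [show 1 - ζ ^ 2 = (1 - ζ ^ 2 * ρ) - ζ ^ 2 * (1 - ρ) by ring]
    refine av_sub_le w _ _ (le_max_left _ _) ?_
    rw [map_mul, hz2, one_mul]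
    exact le_max_right _ _
  have h4 := Real.log_le_log (av_pos w hζ2) h3
  have hmaxpos : 0 < max (av w (1 - ζ ^ 2 * ρ)) (av w (1 - ρ)) := lt_max_of_lt_right (av_pos w hρ1)
  rw [Real.log_mul (by positivity) hmaxpos.ne', Real.log_pow] at h4
  have h5 : -(gg * (2 * Real.log 2)) ≤ Real.log (av w (1 - ζ ^ 2 * ρ)) := by
    rcases max_choice (av w (1 - ζ ^ 2 * ρ)) (av w (1 - ρ)) with h | h
    · rw [h] at h4; linarith
    · rw [h] at h4; linarith
  rw [one_sub_uq hρ2, log_av_div w (mul_ne_zero (neg_ne_zero.2 hζ0) hρ1) hρ2,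
    log_av_mul w (neg_ne_zero.2 hζ0) hρ1, av_neg, hz1, Real.log_one]
  linarith

lemma abs_log_av_le_of_one_sub {u : K} (hu : u ≠ 0) (hu1 : 1 - u ≠ 0) {w : Pl K}
    (h : Real.log (av w (1 - u)) < -(gg * Real.log 2)) :
    |Real.log (av w u)| ≤ gg * Real.log 2 := by
  have h9 := cc_mul_log_two_le w
  have hg : 0 ≤ gg * Real.log 2 := gg_mul_nonneg (Real.log_nonneg (by norm_num))
  have hlt : av w (1 - u) < 1 := by
    rw [← Real.log_neg_iff (av_pos w hu1)]; linarith
  have h1 : av w u ≤ 2 ^ cc w * 1 := by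
    have := av_sub_le w 1 (1 - u) (B := 1) (by simp) hlt.le
    rwa [sub_sub_cancel] at this
  have h2 : (1 : ℝ) ≤ 2 ^ cc w * max (av w u) (av w (1 - u)) := by
    have := av_add_le w u (1 - u) (le_max_left (av w u) (av w (1 - u))) (le_max_right _ _)
    rwa [add_sub_cancel, map_one] at this
  have h3 := Real.log_le_log (av_pos w hu) h1
  rw [mul_one, Real.log_pow] at h3
  have h4 := Real.log_le_log one_pos h2
  rw [Real.log_mul (by positivity) (lt_max_of_lt_left (av_pos w hu)).ne', Real.log_pow,
    Real.log_one] at h4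
  rw [abs_le]
  refine ⟨?_, by linarith⟩
  rcases max_choice (av w u) (av w (1 - u)) with h5 | h5
  · rw [h5] at h4; linarith
  · rw [h5] at h4; linarith

lemma exists_rotation (hm : m ≠ 0) (hζ : IsPrimitiveRoot ζ m) (w : Pl K) (ρ : K) :
    ∃ θ : K, θ ^ m = 1 ∧ av w (1 - θ * ρ) ^ m ≤ av w (1 - ρ ^ m) := by
  have hm' : 0 < m := Nat.pos_of_ne_zero hm
  obtain ⟨θ, hθ, hmin⟩ := Finset.exists_min_image (Polynomial.nthRootsFinset m (1 : K))
    (fun θ => av w (1 - θ * ρ)) ⟨1, (Polynomial.mem_nthRootsFinset hm' 1).2 (one_pow m)⟩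
  refine ⟨θ, (Polynomial.mem_nthRootsFinset hm' 1).1 hθ, ?_⟩
  have h := hζ.pow_sub_pow_eq_prod_sub_mul 1 ρ hm'
  rw [one_pow] at h
  have hp : av w (1 - θ * ρ) ^ m =
      ∏ _η ∈ Polynomial.nthRootsFinset m (1 : K), av w (1 - θ * ρ) := by
    rw [Finset.prod_const, hζ.card_nthRootsFinset]
  rw [h, map_prod, hp]
  exact Finset.prod_le_prod (fun _ _ => av_nonneg _ _) hmin

end CloseToOne

set_option maxHeartbeats 800000 in
lemma HH_le_of_root_of_ratio {S : Finset (Pl K)} (hS : ∀ w, .inl w ∈ S) {P N0 : ℕ} (hP : 12 ≤ P)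
    (hSP : S.card ≤ P) {m : ℕ} (hm : 3 ≤ m) {ζ x α β ρ : K} (hζ : IsPrimitiveRoot ζ m)
    (hαβ : α ≠ β) (hxα : x ≠ α) (hxβ : x ≠ β) (hρ : ρ ^ m * (x - α) = x - β)
    (hx : ∀ v ∉ S, av v x ≤ 1) {E : ℝ}
    (hE : 2 * (HH α + HH β) + gg * (4 * Real.log 2) ≤ gg * E) (hN0 : 10 ^ 7 * P ^ 2 ≤ N0)
    (hN : ∀ w ∈ S, Real.exp (2 * halfLogDiscr K) * 2 ^ Module.finrank ℚ K *
      (5 * cellScale S / (1 / (108 * (P : ℝ) ^ 3))) ^ S.card *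
        (120 * (gg * cellScale S + 1) * Real.exp (lq w) * Real.exp (gg * closeExp P)) ≤ N0) :
    HH x ≤ gg * (51 * m * P ^ 2 * N0 * (N0 + E)) := by
  set A := HH α + HH β with hA
  set l := gg * Real.log 2 with hl
  have hg1 : (1 : ℝ) ≤ gg := one_le_finrank
  have hl0 : 0 ≤ l := gg_mul_nonneg (Real.log_nonneg (by norm_num))
  have hlg : l ≤ gg := by
    have := Real.log_two_lt_d9
    calc l ≤ gg * 1 := mul_le_mul_of_nonneg_left (by linarith) (by linarith)
      _ = gg := mul_one _
  have hA0 : 0 ≤ A := add_nonneg (HH_nonneg _) (HH_nonneg _)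
  have hEl : 2 * A + 4 * l ≤ gg * E := by rw [hl]; linarith
  have hE0 : 0 ≤ E := by
    by_contra! h
    linarith only [hA0, hl0, hEl, mul_neg_of_pos_of_neg (zero_lt_one.trans_le hg1) h]
  have hm3 : (3 : ℝ) ≤ m := by exact_mod_cast hm
  have hP12 : (12 : ℝ) ≤ P := by exact_mod_cast hP
  have hN0' : (10 : ℝ) ^ 7 * P ^ 2 ≤ N0 := by exact_mod_cast hN0
  have hm0 : m ≠ 0 := by omega
  have hN1 : (10 : ℝ) ^ 7 * 12 ^ 2 ≤ N0 := le_trans (by gcongr) hN0'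
  have hN0one : (1 : ℝ) ≤ N0 := by linarith only [hN1]
  have hP1 : (1 : ℝ) ≤ P := by linarith only [hP12]
  have hm1 : (1 : ℝ) ≤ m := by linarith only [hm3]
  have hPN : (1 : ℝ) ≤ (P : ℝ) ^ 2 * N0 := one_le_mul_of_one_le_of_one_le (one_le_pow₀ hP1) hN0one
  have hmlg := mul_le_mul_of_nonneg_left hlg (by linarith only [hm1] : (0 : ℝ) ≤ m)
  have hml : 0 ≤ m * l := by positivity
  have hNE : (N0 : ℝ) ≤ N0 + E := by linarith
  by_cases hbig : HH x ≤ 2 * P * (2 * A + (2 * m + 2) * l) + A + (2 * m + 1) * l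
  · refine hbig.trans ?_
    have h1 : 2 * P * (2 * A + (2 * m + 2) * l) + A + (2 * m + 1) * l ≤
        gg * (2 * P * (E + (2 * m + 2)) + E + (2 * m + 1)) := by
      have h2 : 2 * A + (2 * m + 2) * l ≤ gg * (E + (2 * m + 2)) := by
        linarith only [hEl, hl0, hlg, hmlg]
      have h3 : 2 * (P : ℝ) * (2 * A + (2 * m + 2) * l) ≤
          2 * P * (gg * (E + (2 * m + 2))) := by gcongr
      linarith only [h3, hEl, hA0, hl0, hlg, hmlg, hg1]
    refine h1.trans (mul_le_mul_of_nonneg_left ?_ (by linarith))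
    have h4 : 2 * P * (E + (2 * m + 2)) + E + (2 * m + 1) ≤ 51 * m * P * (N0 + E) := by
      have h5 : (1 : ℝ) ≤ m * P := one_le_mul_of_one_le_of_one_le hm1 hP1
      have h6 : (m : ℝ) ≤ m * P := le_mul_of_one_le_right (by linarith only [hm1]) hP1
      have h7 : (P : ℝ) ≤ m * P := le_mul_of_one_le_left (by linarith only [hP1]) hm1
      have h8 : (0 : ℝ) ≤ m * P := by positivity
      linarith only [mul_le_mul_of_nonneg_left hN1 h8, mul_le_mul_of_nonneg_right h5 hE0,
        mul_le_mul_of_nonneg_right h7 hE0, h5, h6, h7, h8, mul_nonneg h8 hE0]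
    refine h4.trans ?_
    have h9 : (0 : ℝ) ≤ 51 * m * P * (N0 + E) := by positivity
    have h10 : (1 : ℝ) ≤ P * N0 := one_le_mul_of_one_le_of_one_le hP1 hN0one
    linarith only [mul_le_mul_of_nonneg_left h10 h9]
  push Not at hbig
  have hA0' := HH_nonneg β
  have hβα : β - α ≠ 0 := sub_ne_zero.2 hαβ.symm
  have h1 : x - α ≠ 0 := sub_ne_zero.2 hxα
  have hρ1 : 1 - ρ ^ m ≠ 0 := by
    intro h
    apply hβα
    linear_combination (x - α) * h + hρ
  have hSne : S.Nonempty := ⟨_, hS (Classical.arbitrary _)⟩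
  obtain ⟨w, hw, hmax⟩ := Finset.exists_max_image S (fun v => lp v x) hSne
  have hHx : HH x ≤ P * lp w x := by
    rw [← finsum_lp, finsum_eq_sum_add_off (FS_lp x) S]
    have hz : ∑ᶠ v, off S (fun v => lp v x) v = 0 := by
      rw [← finsum_zero]
      congr 1
      ext v
      by_cases hv : v ∈ S
      · rw [off_of_mem hv]
      · rw [off_of_notMem hv, lp, max_eq_left (hx v hv), Real.log_one]
    rw [hz, add_zero]
    refine (Finset.sum_le_card_nsmul S _ _ hmax).trans ?_
    rw [nsmul_eq_mul]
    exact mul_le_mul_of_nonneg_right (by exact_mod_cast hSP) (lp_nonneg _ _)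
  have hlp : 2 * (2 * A + (2 * m + 2) * l) < lp w x := by
    by_contra! h
    have := mul_le_mul_of_nonneg_left h (by linarith : (0 : ℝ) ≤ P)
    linarith only [this, hHx, hbig, hA0, hl0, hml]
  obtain ⟨θ, hθ, hmin⟩ := exists_rotation hm0 hζ w ρ
  have hρ' : (θ * ρ) ^ m = ρ ^ m := by rw [mul_pow, hθ, one_mul]
  set ρ' := θ * ρ with hρ'def
  rw [← hρ'] at hρ hmin hρ1
  have hζm := hζ.pow_eq_one
  have hζ1 : 1 + ζ ≠ 0 := by
    intro h
    have : ζ ^ 2 = 1 := by linear_combination (ζ - 1) * h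
    exact hζ.pow_ne_one_of_pos_of_lt two_ne_zero (by omega) this
  have hζ2 : 1 - ζ ^ 2 ≠ 0 := fun h =>
    hζ.pow_ne_one_of_pos_of_lt two_ne_zero (by omega) (sub_eq_zero.1 h).symm
  have hζ2m : (ζ ^ 2) ^ m = 1 := by rw [← pow_mul, mul_comm, pow_mul, hζm, one_pow]
  have hr0 : 1 - ρ' ≠ 0 := by
    have := one_sub_mul_ne_zero hρ1 (one_pow m)
    rwa [one_mul] at this
  have hr1 := one_sub_mul_ne_zero hρ1 hζm
  have hr2 := one_sub_mul_ne_zero hρ1 hζ2m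
  have hu : uq ζ ρ' ≠ 0 := div_ne_zero (mul_ne_zero hζ1 hr1) hr2
  have hζ0 : ζ ≠ 0 := hζ.ne_zero hm0
  have hu1 : 1 - uq ζ ρ' ≠ 0 := by
    rw [one_sub_uq hr2]
    exact div_ne_zero (mul_ne_zero (neg_ne_zero.2 hζ0) hr0) hr2
  have ht := mul_log_av_one_sub_le hαβ hxα hρ hr0 hmin
    (by rw [← hl, ← hA]; linarith only [hlp, hA0, hl0, hml])
  rw [← hA] at ht
  have hl2 : gg * (2 * Real.log 2) = 2 * l := by rw [hl]; ring
  rw [hl2] at ht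
  set t := Real.log (av w (1 - ρ')) with htdef
  have ht2 : t < -(4 * l) := by
    by_contra! h
    have := mul_le_mul_of_nonneg_left h (by linarith : (0 : ℝ) ≤ m)
    linarith only [this, ht, hlp, hA0, hl0, hml]
  have hlpos : 0 < l := mul_pos (by linarith) (Real.log_pos (by norm_num))
  have h1u := log_av_one_sub_uq_le hm0 hζm hζ2 hr0 hr2 (by rw [hl2]; linarith)
  rw [hl2] at h1u
  have hau := abs_log_av_le_of_one_sub hu hu1 (w := w) (by rw [← hl]; linarith)
  have hoffS := finsum_off_abs_log_uq_le hS hm0 hζm hζ1 hαβ hxα hxβ hρ hρ1 hx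
  have hoff : ∑ᶠ v, off (S.erase w) (fun v => |Real.log (av v (uq ζ ρ'))|) v ≤ gg * E := by
    have hF : FS fun v => |Real.log (av v (uq ζ ρ'))| :=
      (FS_log_av hu).comp' fun v h => by simp [h]
    have hle : ∑ᶠ v, off (S.erase w) (fun v => |Real.log (av v (uq ζ ρ'))|) v ≤
        ∑ᶠ v, (off S (fun v => |Real.log (av v (uq ζ ρ'))|) v +
          if v ∈ ({w} : Finset (Pl K)) then l else 0) := by
      refine finsum_le_of_FS (FS.off hF _) ((FS.off hF _).add' (FS_ite _ _)) fun v => ?_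
      by_cases hvw : v = w
      · subst hvw
        rw [off_of_notMem (Finset.notMem_erase _ _), off_of_mem hw, if_pos (by simp), zero_add]
        exact hau
      rw [if_neg (by simpa using hvw), add_zero]
      by_cases hv : v ∈ S
      · rw [off_of_mem (Finset.mem_erase.2 ⟨hvw, hv⟩), off_of_mem hv]
      · rw [off_of_notMem (fun h => hv (Finset.mem_of_mem_erase h)), off_of_notMem hv]
    rw [finsum_add_distrib (FS.off hF _) (FS_ite _ _), finsum_ite, Finset.card_singleton] at hle
    push_cast at hle
    linarith
  have hHu := HH_uq_le hm0 hζm (ρ := ρ') hr2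
  have hHρ := HH_ratio_le (β := β) h1
  rw [← (eq_div_iff h1).2 hρ, HH_pow] at hHρ
  have hHu2 := HH_le_HH_uq hm0 hζm (ρ := ρ') hr2
    (fun h => hζ2 (by rw [h]; ring)) hζ1
  have hHx2 := HH_le_of_ratio hρ (fun h => hρ1 (by rw [h, sub_self]))
  rw [HH_pow] at hHx2
  rw [hl2] at hHu hHu2
  have hmHu : m * HH (uq ζ ρ') ≤ (2 * m + 1) * l + HH x + A := by
    have := mul_le_mul_of_nonneg_left hHu (by linarith : (0 : ℝ) ≤ m)
    linarith
  have hclose : Real.log (av w (1 - uq ζ ρ')) ≤ -(HH (uq ζ ρ') / (2 * P)) := by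
    refine h1u.trans ?_
    rw [le_neg, div_le_iff₀ (by linarith)]
    have hmpos : (0 : ℝ) < m := by linarith
    refine le_of_mul_le_mul_left ?_ hmpos
    have h7 : 2 * P * (lp w x - 2 * A - 2 * l - 2 * m * l) ≤
        2 * P * (m * -(t + 2 * l)) := mul_le_mul_of_nonneg_left (by linarith) (by linarith)
    linarith
  have hcore := HH_le_of_close hS hw hP hSP hu hE0 hoff hclose hN0 (hN w hw)
  have h8 := mul_le_mul_of_nonneg_left hcore (by linarith : (0 : ℝ) ≤ m)
  have h9 := mul_le_mul_of_nonneg_left hHu2 (by linarith : (0 : ℝ) ≤ m)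
  have h10 : (2 * m + 1) * l + A ≤ gg * (m * P ^ 2 * N0 * (N0 + E)) := by
    have h11 : (2 * m + 1) * l + A ≤ gg * ((2 * m + 1) + E) := by
      linarith only [hEl, hA0, hl0, hlg, hmlg, hg1]
    refine h11.trans (mul_le_mul_of_nonneg_left ?_ (by linarith))
    have h12 : (2 * m + 1) + E ≤ m * (N0 + E) := by
      linarith only [mul_le_mul_of_nonneg_left hN1 (by linarith only [hm1] : (0 : ℝ) ≤ m),
        le_mul_of_one_le_left hE0 hm1, hm1]
    refine h12.trans ?_
    have h13 : 0 ≤ m * (N0 + E) := by positivity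
    linarith only [mul_le_mul_of_nonneg_left hPN h13]
  linarith

end

section

variable {K : Type*} [Field K] [NumberField K]
variable {E : Type*} [Field E] [NumberField E] [Algebra K E]

local notation "gg" => (Module.finrank ℚ K : ℝ)

lemma dexp_nonneg (P : HeightOneSpectrum (𝓞 E)) : 0 ≤ dexp K P :=
  FractionalIdeal.count_coe_nonneg E P _

section Roots

variable {n : ℕ} {a : ℕ → K} {α : K} {μ : Pl K → ℝ}

lemma lp_root_le (hn : 1 ≤ n) (ha0 : a 0 ≠ 0) (hα : ev n a α = 0) {v : Pl K}
    (ha : ∀ j ≤ n, Real.log (av v (a j)) ≤ μ v) :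
    lp v α ≤ cc v * Real.log n + μ v - Real.log (av v (a 0)) := by
  have hlog : 0 ≤ Real.log n := Real.log_natCast_nonneg n
  have hcl : 0 ≤ cc v * Real.log n := by positivity
  rcases le_or_gt (av v α) 1 with h1 | h1
  · rw [lp, max_eq_left h1, Real.log_one]
    linarith [ha 0 (Nat.zero_le n)]
  have hα0 : α ≠ 0 := by rintro rfl; rw [map_zero] at h1; linarith
  have hle : ∀ j ≤ n, av v (a j) ≤ Real.exp (μ v) := by
    intro j hj
    rcases eq_or_ne (a j) 0 with h | h
    · rw [h, map_zero]; positivity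
    · exact (Real.log_le_iff_le_exp (av_pos v h)).1 (ha j hj)
  have heq : a 0 * α = ∑ i ∈ Finset.range n, -(a (i + 1) * (α⁻¹) ^ i) := by
    rw [ev_eq] at hα
    have h2 : a 0 * α * α ^ (n - 1) =
        (∑ i ∈ Finset.range n, -(a (i + 1) * (α⁻¹) ^ i)) * α ^ (n - 1) := by
      rw [mul_assoc, ← pow_succ', Nat.sub_add_cancel hn, Finset.sum_mul,
        eq_neg_of_add_eq_zero_left hα, ← Finset.sum_neg_distrib]
      refine Finset.sum_congr rfl fun i hi => ?_
      have hi' := Finset.mem_range.1 hi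
      have h3 : α ^ (n - 1) = α ^ i * α ^ (n - 1 - i) := by rw [← pow_add]; congr 1; omega
      rw [neg_mul, mul_assoc, h3, ← mul_assoc (α⁻¹ ^ i), ← mul_pow, inv_mul_cancel₀ hα0, one_pow,
        one_mul]
    exact mul_right_cancel₀ (pow_ne_zero _ hα0) h2
  have h4 := av_sum_le v (Finset.range n) (fun i => -(a (i + 1) * (α⁻¹) ^ i))
    (Real.exp_pos (μ v)).le (by
      intro i hi
      have hi' := Finset.mem_range.1 hi
      rw [av_neg, map_mul, map_pow, map_inv₀]
      refine (mul_le_of_le_one_right (av_nonneg _ _) ?_).trans (hle (i + 1) (by omega))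
      exact pow_le_one₀ (inv_nonneg.2 (av_nonneg _ _)) (inv_le_one_of_one_le₀ h1.le))
  rw [← heq, Finset.card_range] at h4
  have h5 := Real.log_le_log (av_pos v (mul_ne_zero ha0 hα0)) h4
  rw [log_av_mul v ha0 hα0, Real.log_mul (by positivity) (Real.exp_pos _).ne', Real.log_pow,
    Real.log_exp] at h5
  rw [lp, max_eq_right h1.le]
  linarith

lemma HH_root_le (hn : 1 ≤ n) (ha0 : a 0 ≠ 0) (hα : ev n a α = 0) (hμ : FS μ)
    (ha : ∀ j ≤ n, ∀ v, Real.log (av v (a j)) ≤ μ v) :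
    HH α ≤ gg * Real.log n + ∑ᶠ v, μ v := by
  have hF1 := FS_cc_mul (K := K) (Real.log n)
  have hF2 := (FS_log_av ha0).neg'
  have h := finsum_le_of_FS (FS_lp α) ((hF1.add' hμ).add' hF2) fun v =>
    (lp_root_le hn ha0 hα fun j hj => ha j hj v).trans_eq (sub_eq_add_neg _ _)
  rw [finsum_lp, finsum_add_distrib (hF1.add' hμ) hF2, finsum_add_distrib hF1 hμ, sum_cc_mul,
    finsum_neg_distrib, product_formula ha0, neg_zero, add_zero] at h
  exact h

lemma log_av_dv_le (hn : 2 ≤ n) (ha0 : a 0 ≠ 0) (hα : ev n a α = 0) (hd : dv n a α ≠ 0)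
    (hμ0 : ∀ v, 0 ≤ μ v) (ha : ∀ j ≤ n, ∀ v, Real.log (av v (a j)) ≤ μ v) (v : Pl K) :
    Real.log (av v (a 0 ^ (n - 2) * dv n a α)) ≤ cc v * (n * Real.log n) + (n - 1) * μ v := by
  have hn1 : ((n - 1 : ℕ) : ℝ) = n - 1 := by rw [Nat.cast_sub (by omega)]; simp
  have hz : a 0 ^ (n - 2) * dv n a α ≠ 0 := mul_ne_zero (pow_ne_zero _ ha0) hd
  rcases v with w | P
  · have hmult : (0 : ℝ) < w.mult := by exact_mod_cast w.mult_pos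
    set M : ℝ := μ (.inl w) / w.mult with hM
    have hM0 : 0 ≤ M := div_nonneg (hμ0 _) hmult.le
    have h1 := abs_dv_le (ab (.inl w)) hn hα (Real.one_le_exp hM0) fun j hj => by
      rcases eq_or_ne (a j) 0 with h0 | h0
      · simp only [h0, map_zero]; positivity
      · have h2 := ha j hj (.inl w)
        rw [log_av_eq] at h2
        rw [← Real.log_le_iff_le_exp ((ab (.inl w)).pos h0), hM, le_div_iff₀ hmult, mul_comm]
        exact h2
    have h2 := Real.log_le_log ((ab (.inl w)).pos hz) h1
    rw [Real.log_mul (by positivity) (by positivity), Real.log_pow, Real.log_pow, Real.log_exp,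
      hn1] at h2
    have h3 := mul_le_mul_of_nonneg_left h2 hmult.le
    rw [log_av_eq]
    refine h3.trans (le_of_eq ?_)
    have h4 : (w.mult : ℝ) * M = μ (.inl w) := by
      rw [hM]; field_simp
    simp only [cc]
    linear_combination (n - 1 : ℝ) * h4
  · have h1 := dexp_le_of_root (K := K) (E := K) P hn ha0 (by simpa using hα) (by simpa using hd)
      (by rw [eq_top_iff]; exact fun y _ => Subalgebra.algebraMap_mem _ y)
    obtain ⟨j, hj, hj'⟩ := exists_poleOrd_eq n a (resP K P)
    have h2 := ordAt_algebraMap (K := K) P (a j)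
    simp only [Algebra.algebraMap_self, RingHom.id_apply] at h1 h2
    rw [hj', mul_neg, ← h2] at h1
    have h3 : -ordAt P (a 0 ^ (n - 2) * dv n a α) ≤ (n - 1 : ℕ) * -ordAt P (a j) := by
      have : (0 : ℤ) ≤ dexp K P := dexp_nonneg P
      linarith
    have h4 := mul_le_mul_of_nonneg_right (Int.cast_le (R := ℝ).2 h3) (log_norm_pos P).le
    have h5 : -(ordAt P (a j) : ℝ) * Real.log (Ideal.absNorm P.asIdeal) ≤ μ (.inr P) := by
      rcases eq_or_ne (a j) 0 with h0 | h0
      · simpa [h0, ordAt_zero] using hμ0 _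
      · rw [← log_av_inr P h0]; exact ha j hj _
    have h6 := mul_le_mul_of_nonneg_left h5 (Nat.cast_nonneg (α := ℝ) (n - 1))
    rw [log_av_inr P hz]
    push_cast at h4
    simp only [cc, Nat.cast_zero, zero_mul, zero_add]
    rw [← hn1]
    linarith

end Roots

section Valuations

lemma mem_integer_iff {p : HeightOneSpectrum (𝓞 K)} {x : K} :
    x ∈ (p.valuation K).integer ↔ av (.inr p) x ≤ 1 := by
  rw [Valuation.mem_integer_iff]
  rcases eq_or_ne x 0 with rfl | hx
  · simp
  · rw [valuation_eq_exp p hx, ← WithZero.exp_zero, WithZero.exp_le_exp, av_inr_le_one]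
    constructor <;> intro h <;> linarith

/-- The polynomial `a₀ Xⁿ + ⋯ + aₙ`. -/
def poly {R : Type*} [CommRing R] (n : ℕ) (a : ℕ → R) : Polynomial R :=
  ∑ j ∈ Finset.range (n + 1), Polynomial.C (a j) * Polynomial.X ^ (n - j)

lemma eval_poly {R : Type*} [CommRing R] (n : ℕ) (a : ℕ → R) (x : R) :
    (poly n a).eval x = ev n a x := by
  simp [poly, Polynomial.eval_finsetSum, ev]

lemma eval_derivative_poly {R : Type*} [CommRing R] (n : ℕ) (a : ℕ → R) (x : R) :
    (poly n a).derivative.eval x = dv n a x := by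
  rw [poly, Finset.sum_range_succ, dv]
  simp only [map_add, Polynomial.derivative_sum, Polynomial.derivative_C_mul_X_pow]
  simp only [Polynomial.eval_add, Polynomial.eval_finsetSum, Nat.sub_self]
  simp only [Polynomial.eval_mul, Polynomial.eval_C, Polynomial.eval_pow, Polynomial.eval_X,
    Nat.cast_zero, mul_zero, zero_mul, add_zero]
  refine Finset.sum_congr rfl fun j _ => ?_
  rw [Nat.sub_right_comm]; ring

lemma ev_eq_taylor {R : Type*} [CommRing R] (n : ℕ) (a : ℕ → R) (α x : R) :
    ∃ k, ev n a x = ev n a α + (x - α) * (dv n a α + k * (x - α)) := by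
  obtain ⟨k, hk⟩ := (poly n a).binomExpansion α (x - α)
  refine ⟨k, ?_⟩
  rw [add_sub_cancel, eval_poly, eval_poly, eval_derivative_poly] at hk
  rw [hk]; ring

lemma dvd_ordAt_sub_root {p : HeightOneSpectrum (𝓞 K)} {n m : ℕ} {a : ℕ → K} {x y α δ : K}
    (ha : ∀ j ≤ n, av (.inr p) (a j) ≤ 1) (hx : av (.inr p) x ≤ 1) (hα : av (.inr p) α ≤ 1)
    (hxα : x ≠ α) (hroot : ev n a α = 0) (hd0 : dv n a α ≠ 0) (hd : ordAt p (dv n a α) = 0)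
    (hδ0 : δ ≠ 0) (hδ : ordAt p δ = 0) (hy : y ≠ 0) (heq : ev n a x = δ * y ^ m) :
    (m : ℤ) ∣ ordAt p (x - α) := by
  have hxα' : x - α ≠ 0 := sub_ne_zero.2 hxα
  set R := (p.valuation K).integer
  obtain ⟨k, hk⟩ := ev_eq_taylor (R := R) n
    (fun j => if h : j ≤ n then ⟨a j, mem_integer_iff.2 (ha j h)⟩ else 0)
    ⟨α, mem_integer_iff.2 hα⟩ ⟨x, mem_integer_iff.2 hx⟩
  have hk' := congrArg (fun r : R => (r : K)) hk
  have hev : ∀ z : R, ((ev n (fun j => if h : j ≤ n then (⟨a j, mem_integer_iff.2 (ha j h)⟩ : R)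
      else 0) z : R) : K) = ev n a z := by
    intro z
    rw [ev, ev]
    push_cast
    refine Finset.sum_congr rfl fun j hj => ?_
    rw [dif_pos (Nat.lt_succ_iff.1 (Finset.mem_range.1 hj))]
  have hdv : ∀ z : R, ((dv n (fun j => if h : j ≤ n then (⟨a j, mem_integer_iff.2 (ha j h)⟩ : R)
      else 0) z : R) : K) = dv n a z := by
    intro z
    rw [dv, dv]
    push_cast
    refine Finset.sum_congr rfl fun j hj => ?_
    rw [dif_pos (Finset.mem_range.1 hj).le]
  simp only [Subring.coe_add, Subring.coe_mul, AddSubgroupClass.coe_sub, hev, hdv, hroot,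
    zero_add] at hk'
  have hkle : av (.inr p) (k : K) ≤ 1 := mem_integer_iff.1 k.2
  rw [heq] at hk'
  by_cases h0 : ordAt p (x - α) = 0
  · rw [h0]; exact dvd_zero _
  have hle : av (.inr p) (x - α) ≤ 1 := by
    have := av_sub_le (.inr p) x α hx hα
    simpa [cc] using this
  have hpos : 0 < ordAt p (x - α) := lt_of_le_of_ne (av_inr_le_one p |>.1 hle) (Ne.symm h0)
  have hunit : ordAt p (dv n a α + k * (x - α)) = 0 ∧ dv n a α + k * (x - α) ≠ 0 := by
    have hd1 : av (.inr p) (dv n a α) = 1 := by rw [av_inr p hd0, hd, neg_zero, zpow_zero]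
    have hxlt : av (.inr p) (x - α) < 1 := by
      rw [av_inr p hxα']
      exact zpow_lt_one_of_neg₀ (one_lt_norm p) (by omega)
    have hzlt : av (.inr p) (k * (x - α)) < 1 := by
      rw [map_mul]
      exact mul_lt_one_of_nonneg_of_lt_one_right hkle (av_nonneg _ _) hxlt
    have h1 : 1 ≤ av (.inr p) (dv n a α + k * (x - α)) := by
      have := av_sub_le (.inr p) (dv n a α + k * (x - α)) (k * (x - α))
        (le_max_left _ _) (le_max_right _ _)
      rw [add_sub_cancel_right, hd1] at this
      simp only [cc, pow_zero, one_mul, le_max_iff] at this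
      rcases this with h | h
      · exact h
      · linarith
    have h2 : av (.inr p) (dv n a α + k * (x - α)) ≤ 1 := by
      have := av_add_le (.inr p) _ _ hd1.le hzlt.le
      simpa [cc] using this
    have hne : dv n a α + k * (x - α) ≠ 0 := by
      intro h
      rw [h, map_zero] at h1
      linarith
    refine ⟨?_, hne⟩
    have h3 := log_av_inr p hne
    rw [le_antisymm h2 h1, Real.log_one, eq_comm, mul_eq_zero] at h3
    rcases h3 with h3 | h3
    · exact_mod_cast neg_eq_zero.1 h3
    · exact absurd h3 (log_norm_pos p).ne'
  have h3 := congrArg (ordAt p) hk'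
  rw [ordAt_mul p hδ0 (pow_ne_zero _ hy), hδ, ordAt_pow p hy, ordAt_mul p hxα' hunit.2, hunit.1,
    zero_add, add_zero] at h3
  exact ⟨_, h3.symm⟩

end Valuations

end

section Discriminant

variable {R : Type*} [CommRing R]

lemma sum_shift_mul_pow {N i d : ℕ} (h : i + d + 1 ≤ N) (c : ℕ → R) (α : R) :
    ∑ j ∈ Finset.range N, (if i ≤ j ∧ j ≤ i + d then c (j - i) else 0) * α ^ (N - 1 - j) =
      α ^ (N - 1 - d - i) * ∑ k ∈ Finset.range (d + 1), c k * α ^ (d - k) := by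
  have h1 : ∑ j ∈ Finset.range N, (if i ≤ j ∧ j ≤ i + d then c (j - i) else 0) * α ^ (N - 1 - j) =
      ∑ j ∈ Finset.Ico i (i + (d + 1)), c (j - i) * α ^ (N - 1 - j) := by
    rw [← Finset.sum_filter_add_sum_filter_not (Finset.range N) (fun j => i ≤ j ∧ j ≤ i + d),
      Finset.sum_eq_zero (s := Finset.filter (fun j => ¬ (i ≤ j ∧ j ≤ i + d)) _), add_zero]
    · refine Finset.sum_congr ?_ fun j hj => ?_
      · ext j
        simp only [Finset.mem_filter, Finset.mem_range, Finset.mem_Ico]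
        omega
      · rw [Finset.mem_Ico] at hj
        rw [if_pos (by omega)]
    · intro j hj
      rw [if_neg (Finset.mem_filter.1 hj).2, zero_mul]
  rw [h1, Finset.sum_Ico_eq_sum_range, Finset.mul_sum, Nat.add_sub_cancel_left]
  refine Finset.sum_congr rfl fun k hk => ?_
  have hk' := Finset.mem_range.1 hk
  rw [Nat.add_sub_cancel_left, mul_left_comm, ← pow_add]
  congr 2
  omega

lemma dv_ne_zero_of_root {F : Type*} [Field F] {n : ℕ} (hn : 2 ≤ n) {a : ℕ → F}
    (hdisc : binDisc n a ≠ 0) {α : F} (hα : ev n a α = 0) : dv n a α ≠ 0 := by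
  intro hd
  apply hdisc
  rw [binDisc, ← Matrix.exists_mulVec_eq_zero_iff]
  refine ⟨fun j => α ^ (2 * n - 2 - 1 - (j : ℕ)), ?_, ?_⟩
  · intro h
    have := congrFun h ⟨2 * n - 2 - 1, by omega⟩
    simp at this
  have hd' : ∑ k ∈ Finset.range (n - 1 + 1), ((n - k : ℕ) : F) * a k * α ^ (n - 1 - k) = 0 := by
    rw [Nat.sub_add_cancel (by omega)]; exact hd
  have hy : ∑ k ∈ Finset.range (n - 1 + 1), ((k + 1 : ℕ) : F) * a (k + 1) * α ^ (n - 1 - k) =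
      0 := by
    have h := mul_dv n a α
    rw [hd, hα, mul_zero, mul_zero, zero_sub, eq_comm, neg_eq_zero] at h
    rw [Nat.sub_add_cancel (by omega)]; exact h
  ext i
  have hi := i.2
  simp only [Matrix.mulVec, dotProduct, Pi.zero_apply, discMat]
  by_cases h1 : (i : ℕ) < n - 2
  · simp only [if_pos h1]
    rw [Fin.sum_univ_eq_sum_range (fun j => (if (i : ℕ) ≤ j ∧ j ≤ i + n then a (j - i) else 0) *
      α ^ (2 * n - 2 - 1 - j)), sum_shift_mul_pow (by omega) a]
    change _ * ev n a α = 0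
    rw [hα, mul_zero]
  · simp only [if_neg h1]
    by_cases h2 : (i : ℕ) = n - 2
    · simp only [if_pos h2]
      have h3 := sum_shift_mul_pow (N := 2 * n - 2) (i := 0) (d := n - 1) (by omega)
        (fun k => ((k + 1 : ℕ) : F) * a (k + 1)) α
      rw [hy, mul_zero] at h3
      refine Eq.trans ?_ h3
      rw [Fin.sum_univ_eq_sum_range (fun j => (if j + 1 ≤ n then
        ((j + 1 : ℕ) : F) * a (j + 1) else 0) * α ^ (2 * n - 2 - 1 - j))]
      refine Finset.sum_congr rfl fun j _ => ?_
      congr 1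
      refine if_congr (by omega) rfl rfl
    · simp only [if_neg h2]
      have h3 := sum_shift_mul_pow (N := 2 * n - 2) (i := (i : ℕ) - (n - 1)) (d := n - 1) (by omega)
        (fun k => ((n - k : ℕ) : F) * a k) α
      rw [hd', mul_zero] at h3
      refine Eq.trans ?_ h3
      rw [← Fin.sum_univ_eq_sum_range (fun j => (if (i : ℕ) - (n - 1) ≤ j ∧
        j ≤ (i : ℕ) - (n - 1) + (n - 1) then ((n - (j - ((i : ℕ) - (n - 1))) : ℕ) : F) *
          a (j - ((i : ℕ) - (n - 1))) else 0) * α ^ (2 * n - 2 - 1 - j))]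

lemma binDisc_map {F F' : Type*} [Field F] [Field F'] (f : F →+* F') (n : ℕ) (a : ℕ → F) :
    binDisc n (fun j => f (a j)) = f (binDisc n a) := by
  rw [binDisc, binDisc, RingHom.map_det]
  congr 1
  ext i j
  simp only [discMat, RingHom.mapMatrix_apply, Matrix.map_apply]
  split_ifs <;> simp

lemma map_ev {F F' : Type*} [Field F] [Field F'] (f : F →+* F') (n : ℕ) (a : ℕ → F) (x : F) :
    ev n (fun j => f (a j)) (f x) = f (ev n a x) := by
  simp [ev, map_sum]

end Discriminant

section Extensions

open Polynomial

lemma exists_extension_root (M : Type) [Field M] [NumberField M] {f : M[X]} (hf : f.natDegree ≠ 0) :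
    ∃ (E : Type) (_ : Field E) (_ : NumberField E) (_ : Algebra M E) (α : E),
      aeval α f = 0 ∧ Algebra.adjoin M {α} = ⊤ ∧ Module.finrank M E ≤ f.natDegree := by
  have hirr := Polynomial.irreducible_factor f
  have hfact : Fact (Irreducible f.factor) := ⟨hirr⟩
  have hdvd := Polynomial.factor_dvd_of_natDegree_ne_zero hf
  have hf0 : f ≠ 0 := by rintro rfl; simp at hf
  have hfin : Module.Finite M (AdjoinRoot f.factor) :=
    (AdjoinRoot.powerBasis hirr.ne_zero).finite
  refine ⟨AdjoinRoot f.factor, inferInstance, NumberField.of_module_finite M _, inferInstance,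
    AdjoinRoot.root _, ?_, AdjoinRoot.adjoinRoot_eq_top, ?_⟩
  · obtain ⟨q, hq⟩ := hdvd
    have h : aeval (AdjoinRoot.root f.factor) (f.factor * q) = 0 := by simp
    rwa [← hq] at h
  · rw [(AdjoinRoot.powerBasis hirr.ne_zero).finrank, AdjoinRoot.powerBasis_dim]
    exact Polynomial.natDegree_le_of_dvd hdvd hf0

lemma exists_extension_primitiveRoot (M : Type) [Field M] [NumberField M] {m : ℕ} (hm : 2 ≤ m) :
    ∃ (E : Type) (_ : Field E) (_ : NumberField E) (_ : Algebra M E) (ζ : E),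
      IsPrimitiveRoot ζ m ∧ Algebra.adjoin M {ζ} = ⊤ ∧ Module.finrank M E ≤ m - 1 := by
  have hdeg := natDegree_cyclotomic m M
  obtain ⟨E, _, _, _, ζ, h1, h2, h3⟩ := exists_extension_root M (f := cyclotomic m M) (by
    rw [hdeg]; exact (Nat.totient_pos.2 (by omega)).ne')
  refine ⟨E, _, inferInstance, _, ζ, ?_, h2, ?_⟩
  · have : NeZero (m : E) := ⟨by exact_mod_cast (by omega : m ≠ 0)⟩
    rw [← isRoot_cyclotomic_iff, IsRoot, ← map_cyclotomic m (algebraMap M E), eval_map_algebraMap]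
    exact h1
  · have := Nat.totient_lt m (by omega)
    omega

lemma exists_extension_radical (M : Type) [Field M] [NumberField M] {m : ℕ} (hm : 1 ≤ m) (b : M) :
    ∃ (E : Type) (_ : Field E) (_ : NumberField E) (_ : Algebra M E) (ρ : E),
      ρ ^ m = algebraMap M E b ∧ Algebra.adjoin M {ρ} = ⊤ ∧ Module.finrank M E ≤ m := by
  have hdeg : (X ^ m - C b : M[X]).natDegree = m := natDegree_X_pow_sub_C
  obtain ⟨E, _, _, _, ρ, h1, h2, h3⟩ := exists_extension_root M (f := X ^ m - C b) (by omega)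
  refine ⟨E, _, inferInstance, _, ρ, ?_, h2, h3.trans_eq hdeg⟩
  simpa [sub_eq_zero] using h1

lemma natDegree_poly {F : Type*} [Field F] {n : ℕ} {a : ℕ → F} (ha0 : a 0 ≠ 0) :
    (poly n a).natDegree = n := by
  refine natDegree_eq_of_le_of_coeff_ne_zero ?_ (n := n) ?_
  · exact natDegree_sum_le_of_forall_le _ _ fun j _ =>
      (natDegree_C_mul_X_pow_le _ _).trans (Nat.sub_le _ _)
  · rw [poly, finsetSum_coeff, Finset.sum_eq_single 0]
    · simpa using ha0
    · intro j hj hj0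
      have hj' := Finset.mem_range.1 hj
      rw [coeff_C_mul_X_pow, if_neg (by omega)]
    · simp

lemma aeval_poly {M E : Type*} [Field M] [Field E] [Algebra M E] (n : ℕ) (a : ℕ → M) (x : E) :
    aeval x (poly n a) = ev n (fun j => algebraMap M E (a j)) x := by
  simp [poly, ev]

lemma exists_extension_ev (M : Type) [Field M] [NumberField M] {n : ℕ} (hn : 1 ≤ n) {a : ℕ → M}
    (ha0 : a 0 ≠ 0) :
    ∃ (E : Type) (_ : Field E) (_ : NumberField E) (_ : Algebra M E) (α : E),
      ev n (fun j => algebraMap M E (a j)) α = 0 ∧ Algebra.adjoin M {α} = ⊤ ∧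
        Module.finrank M E ≤ n := by
  have hdeg := natDegree_poly (n := n) ha0
  obtain ⟨E, _, _, _, α, h1, h2, h3⟩ := exists_extension_root M (f := poly n a) (by omega)
  exact ⟨E, _, inferInstance, _, α, by rwa [← aeval_poly], h2, h3.trans_eq hdeg⟩

lemma exists_extension_second_root (M : Type) [Field M] [NumberField M] {n : ℕ} (hn : 2 ≤ n)
    {a : ℕ → M} (ha0 : a 0 ≠ 0) (hdisc : binDisc n a ≠ 0) {α : M} (hα : ev n a α = 0) :
    ∃ (E : Type) (_ : Field E) (_ : NumberField E) (_ : Algebra M E) (β : E),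
      ev n (fun j => algebraMap M E (a j)) β = 0 ∧ algebraMap M E α ≠ β ∧
        Algebra.adjoin M {β} = ⊤ ∧ Module.finrank M E ≤ n - 1 := by
  have hdeg := natDegree_poly (n := n) ha0
  have hroot : (poly n a).IsRoot α := by
    rw [IsRoot, eval_poly, hα]
  obtain ⟨q, hq⟩ := dvd_iff_isRoot.2 hroot
  have hq0 : q ≠ 0 := by rintro rfl; rw [mul_zero] at hq; rw [hq] at hdeg; simp at hdeg; omega
  have hqdeg : q.natDegree = n - 1 := by
    rw [hq, natDegree_mul (X_sub_C_ne_zero α) hq0, natDegree_X_sub_C] at hdeg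
    omega
  obtain ⟨E, _, _, _, β, h1, h2, h3⟩ := exists_extension_root M (f := q) (by omega)
  have hβ : ev n (fun j => algebraMap M E (a j)) β = 0 := by
    rw [← aeval_poly, hq, map_mul, h1, mul_zero]
  refine ⟨E, _, inferInstance, _, β, hβ, ?_, h2, h3.trans_eq hqdeg⟩
  rintro rfl
  have hd := dv_ne_zero_of_root hn hdisc hα
  apply hd
  have h4 : q.eval α = 0 := by
    rw [aeval_algebraMap_apply, coe_aeval_eq_eval] at h1
    exact (map_eq_zero _).1 h1
  have h5 : (poly n a).derivative.eval α = 0 := by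
    rw [hq, derivative_mul]
    simp [h4]
  rw [← h5, eval_derivative_poly]

end Extensions

/-- A superelliptic equation `a₀ xⁿ + ⋯ + aₙ = δ yᵐ` over a number field, together with a finite set
of places outside of which everything is integral, and a majorant of the local sizes of the
coefficients. -/
structure Datum (n m : ℕ) (M : Type) [Field M] [NumberField M] where
  a : ℕ → M
  δ : M
  x : M
  y : M
  S : Finset (Pl M)
  μ : Pl M → ℝ
  inf_mem : ∀ w, .inl w ∈ S
  lead_ne : a 0 ≠ 0
  disc_ne : binDisc n a ≠ 0
  δ_ne : δ ≠ 0
  y_ne : y ≠ 0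
  μ_nonneg : ∀ v, 0 ≤ μ v
  μ_off : ∀ v ∉ S, μ v = 0
  coeff_le : ∀ j ≤ n, ∀ v, Real.log (av v (a j)) ≤ μ v
  δ_le : ∀ v, Real.log (av v δ) ≤ μ v
  x_le : ∀ v ∉ S, av v x ≤ 1
  eq : ev n a x = δ * y ^ m

namespace Datum

variable {n m : ℕ} {M : Type} [Field M] [NumberField M] (d : Datum n m M)

lemma FS_μ : FS d.μ := d.S.finite_toSet.subset fun v hv => by
  by_contra h
  exact hv (d.μ_off v h)

lemma ev_x_ne : ev n d.a d.x ≠ 0 := by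
  rw [d.eq]; exact mul_ne_zero d.δ_ne (pow_ne_zero _ d.y_ne)

lemma ne_root {α : M} (hα : ev n d.a α = 0) : d.x ≠ α := fun h => d.ev_x_ne (h ▸ hα)

/-- Extension of the base field. -/
def map (E : Type) [Field E] [NumberField E] [Algebra M E] : Datum n m E where
  a := fun j => algebraMap M E (d.a j)
  δ := algebraMap M E d.δ
  x := algebraMap M E d.x
  y := algebraMap M E d.y
  S := above E d.S
  μ := fun w => dg M w * d.μ (res M w)
  inf_mem := fun w => mem_above.2 (d.inf_mem _)
  lead_ne := by simpa using d.lead_ne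
  disc_ne := by rw [binDisc_map]; simpa using d.disc_ne
  δ_ne := by simpa using d.δ_ne
  y_ne := by simpa using d.y_ne
  μ_nonneg := fun w => mul_nonneg (Nat.cast_nonneg _) (d.μ_nonneg _)
  μ_off := fun w hw => by rw [d.μ_off _ fun h => hw (mem_above.2 h), mul_zero]
  coeff_le := fun j hj w => by
    rw [log_av_algebraMap]
    exact mul_le_mul_of_nonneg_left (d.coeff_le j hj _) (Nat.cast_nonneg _)
  δ_le := fun w => by
    rw [log_av_algebraMap]
    exact mul_le_mul_of_nonneg_left (d.δ_le _) (Nat.cast_nonneg _)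
  x_le := fun w hw => by
    rw [av_algebraMap]
    exact pow_le_one₀ (av_nonneg _ _) (d.x_le _ fun h => hw (mem_above.2 h))
  eq := by rw [map_ev, d.eq, map_mul, map_pow]

/-- The numerical relations between a datum and its extension to a field of relative degree `D`. -/
structure Over {E : Type} [Field E] [NumberField E] (d : Datum n m M) (d' : Datum n m E) (D : ℕ) :
    Prop where
  finrank_eq : Module.finrank ℚ E = D * Module.finrank ℚ M
  card_le : d'.S.card ≤ D * d.S.card
  sum_μ : ∑ᶠ v, d'.μ v = D * ∑ᶠ v, d.μ v
  HH_x : HH d'.x = D * HH d.x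
  sum_lq : ∑ v ∈ d'.S, lq v ≤ D * ∑ v ∈ d.S, lq v

lemma Over.trans {E F : Type} [Field E] [NumberField E] [Field F] [NumberField F]
    {d : Datum n m M} {d' : Datum n m E} {d'' : Datum n m F} {D D' : ℕ}
    (h : Over d d' D) (h' : Over d' d'' D') : Over d d'' (D' * D) where
  finrank_eq := by rw [h'.finrank_eq, h.finrank_eq, mul_assoc]
  card_le := h'.card_le.trans (by rw [mul_assoc]; exact Nat.mul_le_mul_left _ h.card_le)
  sum_μ := by rw [h'.sum_μ, h.sum_μ]; push_cast; ring
  HH_x := by rw [h'.HH_x, h.HH_x]; push_cast; ring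
  sum_lq := by
    refine h'.sum_lq.trans ?_
    push_cast
    rw [mul_assoc]
    exact mul_le_mul_of_nonneg_left h.sum_lq (Nat.cast_nonneg _)

lemma lq_le_dg_mul {K E : Type*} [Field K] [NumberField K] [Field E] [NumberField E] [Algebra K E]
    (w : Pl E) : lq w ≤ dg K w * lq (res K w) := by
  rcases lq_eq (K := K) w with h | ⟨P, rfl, h⟩
  · rw [h]; exact mul_nonneg (Nat.cast_nonneg _) (lq_nonneg _)
  · rw [h]
    refine mul_le_mul_of_nonneg_right ?_ (lq_nonneg _)
    exact_mod_cast Nat.le_mul_of_pos_left _ (rid_pos P)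

lemma over_map (E : Type) [Field E] [NumberField E] [Algebra M E] :
    Over d (d.map E) (Module.finrank M E) where
  finrank_eq := by rw [mul_comm, finrank_mul]
  card_le := card_above _
  sum_μ := finsum_res d.FS_μ
  HH_x := HH_algebraMap _
  sum_lq := by
    rw [← sum_above_dg]
    exact Finset.sum_le_sum fun w _ => lq_le_dg_mul w

/-- An integer of the field divisible by the ramified primes of the Kummer extension. -/
def badProd (α β : M) : M :=
  d.a 0 * d.δ * (d.a 0 ^ (n - 2) * dv n d.a α) * (d.a 0 ^ (n - 2) * dv n d.a β)

variable {α β : M}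

lemma log_av_badProd_le (hn : 2 ≤ n) (hα : ev n d.a α = 0) (hβ : ev n d.a β = 0) (v : Pl M) :
    Real.log (av v (d.badProd α β)) ≤ cc v * (2 * n * Real.log n) + 2 * n * d.μ v := by
  have h1 := dv_ne_zero_of_root hn d.disc_ne hα
  have h2 := dv_ne_zero_of_root hn d.disc_ne hβ
  have ha := pow_ne_zero (n - 2) d.lead_ne
  have h3 := log_av_dv_le hn d.lead_ne hα h1 d.μ_nonneg d.coeff_le v
  have h4 := log_av_dv_le hn d.lead_ne hβ h2 d.μ_nonneg d.coeff_le v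
  have h5 := d.coeff_le 0 (Nat.zero_le n) v
  have h6 := d.δ_le v
  rw [badProd, log_av_mul v (mul_ne_zero (mul_ne_zero d.lead_ne d.δ_ne) (mul_ne_zero ha h1))
    (mul_ne_zero ha h2), log_av_mul v (mul_ne_zero d.lead_ne d.δ_ne) (mul_ne_zero ha h1),
    log_av_mul v d.lead_ne d.δ_ne]
  linarith

lemma badProd_ne (hn : 2 ≤ n) (hα : ev n d.a α = 0) (hβ : ev n d.a β = 0) :
    d.badProd α β ≠ 0 :=
  mul_ne_zero (mul_ne_zero (mul_ne_zero d.lead_ne d.δ_ne) (mul_ne_zero (pow_ne_zero _ d.lead_ne)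
    (dv_ne_zero_of_root hn d.disc_ne hα))) (mul_ne_zero (pow_ne_zero _ d.lead_ne)
    (dv_ne_zero_of_root hn d.disc_ne hβ))

lemma sum_log_av_badProd_le (hn : 2 ≤ n) (hα : ev n d.a α = 0) (hβ : ev n d.a β = 0) :
    ∑ v ∈ d.S, Real.log (av v (d.badProd α β)) ≤
      Module.finrank ℚ M * (2 * n * Real.log n) + 2 * n * ∑ᶠ v, d.μ v := by
  have hF1 := FS_cc_mul (K := M) (2 * n * Real.log n)
  have hF2 := d.FS_μ.mul_left' (2 * n)
  have hnn : ∀ v : Pl M, 0 ≤ cc v * (2 * n * Real.log n) + 2 * n * d.μ v := fun v => by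
    have := d.μ_nonneg v
    have := Real.log_natCast_nonneg n
    positivity
  have h := (Finset.sum_le_sum fun v (_ : v ∈ d.S) => d.log_av_badProd_le hn hα hβ v).trans
    (sum_le_finsum (hF1.add' hF2) hnn d.S)
  rwa [finsum_add_distrib hF1 hF2, sum_cc_mul, ← mul_finsum] at h

lemma av_le_one_of_log_nonpos {v : Pl M} {z : M} (h : Real.log (av v z) ≤ 0) : av v z ≤ 1 := by
  rcases eq_or_ne z 0 with rfl | hz
  · simp
  · exact (Real.log_nonpos_iff (av_nonneg _ _)).1 h

lemma ram_le_neg_log (hn : 2 ≤ n) (hα : ev n d.a α = 0) (hβ : ev n d.a β = 0)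
    {v : Pl M} (hv : v ∉ d.S) :
    ram m ((d.x - β) / (d.x - α)) v ≤ -Real.log (av v (d.badProd α β)) := by
  rcases v with w | p
  · exact absurd (d.inf_mem w) hv
  have hz := d.badProd_ne hn hα hβ
  have h1 := dv_ne_zero_of_root hn d.disc_ne hα
  have h2 := dv_ne_zero_of_root hn d.disc_ne hβ
  have hα' := d.ne_root hα
  have hβ' := d.ne_root hβ
  have ha := pow_ne_zero (n - 2) d.lead_ne
  have hμ := d.μ_off _ hv
  have hcc : (cc (.inr p : Pl M) : ℝ) = 0 := by simp [cc]
  have e0 := d.coeff_le 0 (Nat.zero_le n) (.inr p)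
  have e1 := d.δ_le (.inr p)
  have e2 := log_av_dv_le hn d.lead_ne hα h1 d.μ_nonneg d.coeff_le (.inr p)
  have e3 := log_av_dv_le hn d.lead_ne hβ h2 d.μ_nonneg d.coeff_le (.inr p)
  rw [hμ] at e0 e1
  rw [hμ, hcc, zero_mul, mul_zero, add_zero] at e2 e3
  have hsplit : ordAt p (d.badProd α β) = ordAt p (d.a 0) + ordAt p d.δ +
      ordAt p (d.a 0 ^ (n - 2) * dv n d.a α) + ordAt p (d.a 0 ^ (n - 2) * dv n d.a β) := by
    rw [badProd, ordAt_mul p (mul_ne_zero (mul_ne_zero d.lead_ne d.δ_ne) (mul_ne_zero ha h1))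
      (mul_ne_zero ha h2), ordAt_mul p (mul_ne_zero d.lead_ne d.δ_ne) (mul_ne_zero ha h1),
      ordAt_mul p d.lead_ne d.δ_ne]
  have o0 := (av_inr_le_one p).1 (av_le_one_of_log_nonpos e0)
  have o1 := (av_inr_le_one p).1 (av_le_one_of_log_nonpos e1)
  have o2 := (av_inr_le_one p).1 (av_le_one_of_log_nonpos e2)
  have o3 := (av_inr_le_one p).1 (av_le_one_of_log_nonpos e3)
  have hN := log_norm_pos p
  rw [log_av_inr p hz]
  simp only [ram, Sum.elim_inr]
  have key : (m : ℤ) ∣ ordAt p ((d.x - β) / (d.x - α)) ∨ 1 ≤ ordAt p (d.badProd α β) := by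
    by_contra! hcon
    obtain ⟨hc1, hc2⟩ := hcon
    apply hc1
    have z0 : ordAt p (d.a 0) = 0 := by omega
    have z1 : ordAt p d.δ = 0 := by omega
    have z2 : ordAt p (d.a 0 ^ (n - 2) * dv n d.a α) = 0 := by omega
    have z3 : ordAt p (d.a 0 ^ (n - 2) * dv n d.a β) = 0 := by omega
    rw [ordAt_mul p ha h1, ordAt_pow p d.lead_ne, z0, mul_zero, zero_add] at z2
    rw [ordAt_mul p ha h2, ordAt_pow p d.lead_ne, z0, mul_zero, zero_add] at z3
    have hcoef : ∀ j ≤ n, av (.inr p) (d.a j) ≤ 1 := fun j hj =>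
      av_le_one_of_log_nonpos ((d.coeff_le j hj _).trans_eq hμ)
    have hroot : ∀ γ, ev n d.a γ = 0 → av (.inr p) γ ≤ 1 := fun γ hγ => by
      have h := lp_root_le (v := .inr p) (by omega) d.lead_ne hγ fun j hj => d.coeff_le j hj _
      rw [hμ, hcc, log_av_inr p d.lead_ne, z0] at h
      refine av_le_one_of_log_nonpos ((log_av_le_lp _ _).trans (h.trans_eq ?_))
      simp
    have hx := d.x_le _ hv
    rw [ordAt_div p (sub_ne_zero.2 hβ') (sub_ne_zero.2 hα')]
    exact dvd_sub
      (dvd_ordAt_sub_root hcoef hx (hroot β hβ) hβ' hβ h2 z3 d.δ_ne z1 d.y_ne d.eq)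
      (dvd_ordAt_sub_root hcoef hx (hroot α hα) hα' hα h1 z2 d.δ_ne z1 d.y_ne d.eq)
  split_ifs with h
  · have : (0 : ℝ) ≤ ordAt p (d.badProd α β) := by exact_mod_cast (by omega)
    nlinarith
  · have : (1 : ℝ) ≤ ordAt p (d.badProd α β) := by exact_mod_cast key.resolve_left h
    nlinarith

end Datum

namespace Datum

variable {n m : ℕ}

lemma isRoot_map {M E : Type} [Field M] [NumberField M] [Field E] [NumberField E] [Algebra M E]
    (d : Datum n m M) {α : M} (hα : ev n d.a α = 0) :
    ev n (d.map E).a (algebraMap M E α) = 0 := by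
  change ev n (fun j => algebraMap M E (d.a j)) _ = 0
  rw [map_ev, hα, map_zero]

lemma log_discr_map_le {M E : Type} [Field M] [NumberField M] [Field E] [NumberField E]
    [Algebra M E] (d : Datum n m M) (hn : 2 ≤ n) {α : E} (hα : ev n (d.map E).a α = 0)
    (hgen : Algebra.adjoin M {α} = ⊤) :
    Real.log |(NumberField.discr E : ℝ)| ≤
      Module.finrank M E * (Real.log |(NumberField.discr M : ℝ)| + (n - 1) * ∑ᶠ v, d.μ v) +
        Module.finrank ℚ E * (n * Real.log n) :=
  log_discr_le_of_root hn d.lead_ne hα (dv_ne_zero_of_root hn (d.map E).disc_ne hα) hgen d.FS_μ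
    d.μ_nonneg d.coeff_le

/-- Over an extension of bounded degree and discriminant, a solution yields two distinct roots
`α`, `β` of the polynomial and an `m`-th root of `(x - β) / (x - α)`. -/
lemma exists_extension {L : Type} [Field L] [NumberField L] (d : Datum n m L) (hn : 2 ≤ n)
    (hm : 3 ≤ m) {c : ℝ} (hc : IsKummerConst m c) (hc1 : 1 ≤ c) :
    ∃ (K : Type) (_ : Field K) (_ : NumberField K) (d' : Datum n m K) (D : ℕ) (ζ α β ρ : K),
      Over d d' D ∧ D ≤ m * (m - 1) * (n - 1) * n ∧ IsPrimitiveRoot ζ m ∧ α ≠ β ∧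
      ev n d'.a α = 0 ∧ ev n d'.a β = 0 ∧ ρ ^ m * (d'.x - α) = d'.x - β ∧
      ∀ w ∈ d'.S, Real.log |(NumberField.discr K : ℝ)| + lq w ≤
        D * (Real.log |(NumberField.discr L : ℝ)| + (2 * (n - 1) + 2 * n * c) * (∑ᶠ v, d.μ v) +
          (c + 1 / 2) * (∑ v ∈ d.S, lq v) +
          Module.finrank ℚ L * ((2 * n + 2 * n * c) * Real.log n + 2 * Real.log m)) := by
  obtain ⟨M₁, _, _, _, α₁, hα₁, hgen₁, hdeg₁⟩ :=
    exists_extension_ev L (n := n) (by omega) d.lead_ne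
  have ho₁ := d.over_map M₁
  have hΔ₁ := d.log_discr_map_le hn hα₁ hgen₁
  obtain ⟨M₂, _, _, _, β₂, hβ₂, hne₂, hgen₂, hdeg₂⟩ :=
    exists_extension_second_root M₁ hn (d.map M₁).lead_ne (d.map M₁).disc_ne hα₁
  have ho₂ := (d.map M₁).over_map M₂
  have hΔ₂ := (d.map M₁).log_discr_map_le hn hβ₂ hgen₂
  have hα₂ := (d.map M₁).isRoot_map (E := M₂) hα₁
  obtain ⟨M₃, _, _, _, ζ₃, hζ₃, hgen₃, hdeg₃⟩ :=
    exists_extension_primitiveRoot M₂ (m := m) (by omega)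
  have ho₃ := ((d.map M₁).map M₂).over_map M₃
  have hΔ₃ := log_discr_le_of_pow_eq_one (K := M₂) (by omega) hζ₃.pow_eq_one hgen₃
  have hα₃ := ((d.map M₁).map M₂).isRoot_map (E := M₃) hα₂
  have hβ₃ := ((d.map M₁).map M₂).isRoot_map (E := M₃) hβ₂
  set d₃ := ((d.map M₁).map M₂).map M₃ with hd₃
  set α₃ := algebraMap M₂ M₃ (algebraMap M₁ M₂ α₁)
  set β₃ := algebraMap M₂ M₃ β₂
  have hne₃ : α₃ ≠ β₃ := fun h => hne₂ ((algebraMap M₂ M₃).injective h)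
  obtain ⟨K, _, _, _, ρ, hρ, hgen₄, hdeg₄⟩ :=
    exists_extension_radical M₃ (m := m) (by omega) ((d₃.x - β₃) / (d₃.x - α₃))
  have ho₄ := d₃.over_map K
  have hxα := sub_ne_zero.2 (d₃.ne_root hα₃)
  have hxβ := sub_ne_zero.2 (d₃.ne_root hβ₃)
  have ho := ((ho₁.trans ho₂).trans ho₃).trans ho₄
  refine ⟨K, _, inferInstance, d₃.map K, _, algebraMap M₃ K ζ₃, algebraMap M₃ K α₃,
    algebraMap M₃ K β₃, ρ, ho, ?_, hζ₃.map_of_injective (algebraMap M₃ K).injective,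
    fun h => hne₃ ((algebraMap M₃ K).injective h), d₃.isRoot_map hα₃, d₃.isRoot_map hβ₃, ?_, ?_⟩
  · rw [mul_assoc m, mul_assoc m]
    refine Nat.mul_le_mul hdeg₄ ?_
    rw [mul_assoc (m - 1)]
    exact Nat.mul_le_mul hdeg₃ (Nat.mul_le_mul hdeg₂ hdeg₁)
  · change ρ ^ m * (algebraMap M₃ K d₃.x - _) = algebraMap M₃ K d₃.x - _
    rw [hρ, ← map_sub, ← map_sub, ← map_mul, div_mul_cancel₀ _ hxα]
  · intro w hw
    have hΔ₄ := log_discr_add_lq_le (by omega) (div_ne_zero hxβ hxα) hρ hgen₄ hc hc1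
      (mem_above.1 hw) (d₃.badProd_ne hn hα₃ hβ₃) fun v hv => d₃.ram_le_neg_log hn hα₃ hβ₃ hv
    have hb := d₃.sum_log_av_badProd_le hn hα₃ hβ₃
    have o₃ := (ho₁.trans ho₂).trans ho₃
    have o₂ := ho₁.trans ho₂
    have f₁ := ho₁.finrank_eq
    have f₂ := o₂.finrank_eq
    have f₃ := o₃.finrank_eq
    have f₄ := ho.finrank_eq
    have s₁ := ho₁.sum_μ
    have s₃ := o₃.sum_μ
    have l₃ := o₃.sum_lq
    rw [f₁] at hΔ₁
    rw [f₂, s₁] at hΔ₂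
    rw [f₃] at hΔ₃
    rw [f₄] at hΔ₄
    rw [f₃, s₃] at hb
    push_cast at hΔ₁ hΔ₂ hΔ₃ hΔ₄ hb l₃ ⊢
    generalize (Module.finrank L M₁ : ℕ) = D₁ at *
    generalize (Module.finrank M₁ M₂ : ℕ) = D₂ at *
    generalize (Module.finrank M₂ M₃ : ℕ) = D₃ at *
    generalize (Module.finrank M₃ K : ℕ) = D₄ at *
    have hb' := mul_le_mul_of_nonneg_left hb (by linarith : 0 ≤ c)
    have hl' := mul_le_mul_of_nonneg_left l₃ (by linarith : 0 ≤ c + 1 / 2)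
    have e₁ := mul_le_mul_of_nonneg_left hΔ₁ (by positivity : (0 : ℝ) ≤ D₂ * D₃ * D₄)
    have e₂ := mul_le_mul_of_nonneg_left hΔ₂ (by positivity : (0 : ℝ) ≤ D₃ * D₄)
    have e₃ := mul_le_mul_of_nonneg_left hΔ₃ (by positivity : (0 : ℝ) ≤ D₄)
    have e₄ := mul_le_mul_of_nonneg_left (add_le_add hb' hl') (by positivity : (0 : ℝ) ≤ D₄)
    linarith only [e₁, e₂, e₃, e₄, hΔ₄]

end Datum

section Numerics

lemma log_three_bounds : (1.09 : ℝ) ≤ Real.log 3 ∧ Real.log 3 ≤ 1.11 := by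
  have h2 := Real.log_two_gt_d9
  have h2' := Real.log_two_lt_d9
  have h : Real.log (9 / 8) = 2 * Real.log 3 - 3 * Real.log 2 := by
    rw [Real.log_div (by norm_num) (by norm_num), show (9 : ℝ) = 3 ^ 2 by norm_num,
      show (8 : ℝ) = 2 ^ 3 by norm_num, Real.log_pow, Real.log_pow]
    push_cast; ring
  have h3 := Real.one_sub_inv_le_log_of_pos (show (0 : ℝ) < 9 / 8 by norm_num)
  have h4 := Real.log_le_sub_one_of_pos (show (0 : ℝ) < 9 / 8 by norm_num)
  rw [h] at h3 h4
  norm_num at h3 h4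
  constructor <;> linarith

/-- The part of the final estimate which depends on `n`, `m`, `s` only. -/
lemma constant_bound {n m s P : ℝ} (hn : 2 ≤ n) (hm : 3 ≤ m) (hs : 1 ≤ s)
    (hP : P = m * (m - 1) * (n - 1) * n * s) :
    4 + Real.log m + 2 * Real.log P + 2 + 109 / 24 * P * (5 * n * Real.log n + 2 * Real.log m) +
      13 / 6 * P * (1 / (n * s) + Real.log (2 * n * s) - 1) + 54 * P * Real.log P + 138 * P +
      5 * Real.log (2 * n) ≤ 14 * n ^ 3 * s * m ^ 3 * Real.log (6 * n * s) := by
  obtain ⟨h3, h3'⟩ := log_three_bounds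
  have h2 := Real.log_two_gt_d9
  have h6 : Real.log 6 = Real.log 2 + Real.log 3 := by
    rw [← Real.log_mul (by norm_num) (by norm_num)]; norm_num
  have hl : Real.log (6 * n * s) = Real.log 6 + Real.log n + Real.log s := by
    rw [Real.log_mul (by positivity) (by positivity), Real.log_mul (by positivity) (by positivity)]
  have hl2 : Real.log (2 * n * s) = Real.log 2 + Real.log n + Real.log s := by
    rw [Real.log_mul (by positivity) (by positivity), Real.log_mul (by positivity) (by positivity)]
  have hl2n : Real.log (2 * n) = Real.log 2 + Real.log n := by
    rw [Real.log_mul (by positivity) (by positivity)]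
  have hls : 0 ≤ Real.log s := Real.log_nonneg hs
  have hlm : 0 ≤ Real.log m := Real.log_nonneg (by linarith)
  have hln : Real.log 2 ≤ Real.log n := Real.log_le_log (by norm_num) hn
  have hlm' : Real.log m ≤ m / 3 + 0.11 := by
    have h := Real.log_le_sub_one_of_pos (show 0 < m / 3 by positivity)
    rw [Real.log_div (by positivity) (by norm_num)] at h
    linarith
  have hm2 : 6 ≤ m * (m - 1) := by nlinarith only [hm]
  have hn2 : 2 ≤ (n - 1) * n := by nlinarith only [hn]
  have hP12 : 12 ≤ P := by
    have h : (6 : ℝ) * 2 * 1 ≤ m * (m - 1) * ((n - 1) * n) * s :=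
      mul_le_mul (mul_le_mul hm2 hn2 (by norm_num) (by linarith)) hs (by norm_num)
        (mul_nonneg (by linarith) (by linarith))
    rw [hP]; linarith
  have hPle : P ≤ m ^ 2 * n ^ 2 * s := by
    have h : m * (m - 1) * ((n - 1) * n) * s ≤ m ^ 2 * n ^ 2 * s :=
      mul_le_mul_of_nonneg_right (mul_le_mul (by linarith) (by linarith) (by linarith)
        (by positivity)) (by linarith)
    rw [hP]; linarith
  have hlP : Real.log P ≤ 2 * Real.log m + 2 * Real.log n + Real.log s := by
    refine (Real.log_le_log (by linarith) hPle).trans_eq ?_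
    rw [Real.log_mul (by positivity) (by positivity), Real.log_mul (by positivity) (by positivity),
      Real.log_pow, Real.log_pow]
    push_cast; ring
  have hlP0 : 0 ≤ Real.log P := Real.log_nonneg (by linarith)
  have hns : 1 / (n * s) ≤ 1 / 2 :=
    one_div_le_one_div_of_le (by norm_num) (by nlinarith only [hn, hs])
  have hbud : P * ((m + 1) * (n + 1)) ≤ n ^ 3 * s * m ^ 3 := by
    have h : ((m - 1) * (m + 1)) * ((n - 1) * (n + 1)) ≤ m ^ 2 * n ^ 2 :=
      mul_le_mul (by linarith) (by linarith)
        (mul_nonneg (by linarith) (by linarith)) (by positivity)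
    have h' := mul_le_mul_of_nonneg_left h (show 0 ≤ m * n * s by positivity)
    rw [hP]; linarith
  set ℓ := Real.log (6 * n * s) with hℓ
  have hℓ2 : 2.47 ≤ ℓ := by rw [hl, h6]; linarith
  have hlnℓ : Real.log n ≤ ℓ - 1.78 := by rw [hl, h6]; linarith
  have hnln : n * Real.log n ≤ n * (ℓ - 1.78) := mul_le_mul_of_nonneg_left hlnℓ (by linarith)
  have e1 : 0 ≤ (m - 3) * (n + 1) * (ℓ - 2.47) :=
    mul_nonneg (mul_nonneg (by linarith) (by linarith)) (by linarith)
  have e2 : 0 ≤ (m - 3) * (n - 2) := mul_nonneg (by linarith) (by linarith)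
  have e3 : 0 ≤ (n - 2) * (ℓ - 2.47) := mul_nonneg (by linarith) (by linarith)
  have hlPℓ : Real.log P ≤ 2 * Real.log m + 2 * ℓ - 3.56 := by rw [hl, h6]; linarith
  have hl2ℓ : Real.log (2 * n * s) ≤ ℓ - 1.09 := by rw [hl, hl2, h6]; linarith
  have hl2nℓ : Real.log (2 * n) ≤ ℓ - 1.09 := by rw [hl, hl2n, h6]; linarith
  have hl2n0 : 0 ≤ Real.log (2 * n) := by rw [hl2n]; linarith
  have hbr : 1 / 2 + 1 / 12 * Real.log m + 1 / 6 * Real.log P +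
      109 / 24 * (5 * n * Real.log n + 2 * Real.log m) +
      13 / 6 * (1 / (n * s) + Real.log (2 * n * s) - 1) + 54 * Real.log P + 138 +
      5 / 12 * Real.log (2 * n) ≤ 14 * ((m + 1) * (n + 1)) * ℓ := by
    linarith
  have hbrP := mul_le_mul_of_nonneg_left hbr (by linarith : 0 ≤ P)
  have hfin := mul_le_mul_of_nonneg_left hbud (by linarith : 0 ≤ 14 * ℓ)
  have x1 : Real.log m ≤ P / 12 * Real.log m := le_mul_of_one_le_left hlm (by linarith)
  have x2 : 2 * Real.log P ≤ P / 6 * Real.log P :=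
    mul_le_mul_of_nonneg_right (by linarith) hlP0
  have x3 : 5 * Real.log (2 * n) ≤ 5 / 12 * P * Real.log (2 * n) :=
    mul_le_mul_of_nonneg_right (by linarith) hl2n0
  linarith

lemma discr_coeff_le {n m : ℝ} (hn : 2 ≤ n) (hm : 3 ≤ m) :
    (2 * n + 13 / 24) * (m * (m - 1) * (n - 1)) ≤ 2 * m ^ 2 * n ^ 2 := by
  have h : ((2 * n + 13 / 24) * (n - 1)) * (m * (m - 1)) ≤ (2 * n ^ 2) * m ^ 2 :=
    mul_le_mul (by linarith) (by linarith) (mul_nonneg (by linarith) (by linarith))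
      (by positivity)
  linarith

lemma norm_coeff_le {n m c : ℝ} (hn : 2 ≤ n) (hm : 3 ≤ m) (hc2 : (2 * c + 1) * (m - 1) ≤ 3 * m) :
    (2 * n + 13 / 24) * (m * (m - 1) * (n - 1)) * (c + 1 / 2) +
      13 / 12 * (m * (m - 1) * (n - 1)) ≤ 3 * m ^ 2 * n ^ 2 := by
  have h1 := mul_le_mul_of_nonneg_left hc2
    (show 0 ≤ (2 * n + 13 / 24) * (m * (n - 1)) / 2 by
      have : 0 ≤ n - 1 := by linarith
      positivity)
  have h2 : m * (n - 1) * (m - 1) ≤ m * (n - 1) * m :=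
    mul_le_mul_of_nonneg_left (by linarith) (mul_nonneg (by linarith) (by linarith))
  have h3 : (n - 1) * (3 * n + 2) * m ^ 2 ≤ 3 * n ^ 2 * m ^ 2 :=
    mul_le_mul_of_nonneg_right (by linarith) (by positivity)
  have h4 : 0 ≤ (n - 1) * m ^ 2 := mul_nonneg (by linarith) (by positivity)
  linarith

lemma height_coeff_le {n m c d : ℝ} (hn : 2 ≤ n) (hm : 3 ≤ m) (hd : 1 ≤ d)
    (hc3 : (2 + 2 * c) * (m - 1) ≤ 4 * m - 1) :
    (2 * n + 13 / 24) * (m * (m - 1) * (n - 1)) * ((2 * (n - 1) + 2 * n * c) * d) + 5 ≤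
      8 * m ^ 2 * n ^ 3 * d := by
  have h1 : (2 * (n - 1) + 2 * n * c) * (m - 1) ≤ n * (4 * m - 1) := by
    have := mul_le_mul_of_nonneg_left hc3 (by linarith : 0 ≤ n)
    linarith
  have h2 : (2 * n + 13 / 24) * (n - 1) ≤ 2 * n ^ 2 - n := by linarith
  have h3 := mul_le_mul_of_nonneg_left h1 (show 0 ≤ (2 * n + 13 / 24) * (n - 1) * m * d from
    mul_nonneg (mul_nonneg (mul_nonneg (by linarith) (by linarith)) (by linarith)) (by linarith))
  have h4 := mul_le_mul_of_nonneg_left h2 (show 0 ≤ m * d * (n * (4 * m - 1)) from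
    mul_nonneg (by positivity) (mul_nonneg (by linarith) (by linarith)))
  have h5 : 5 ≤ m * n ^ 2 * d * (2 * n + 4 * m - 1) := by
    have h : (3 * 2 ^ 2 * 1) * 1 ≤ m * n ^ 2 * d * (2 * n + 4 * m - 1) := by
      refine mul_le_mul ?_ (by linarith) (by norm_num) (by positivity)
      gcongr
    linarith
  linarith

set_option maxHeartbeats 1000000 in
lemma log_total_le {n m s d D P c H q δ W B : ℝ} (hn : 2 ≤ n) (hm : 3 ≤ m) (hs : 1 ≤ s)
    (hd : 1 ≤ d) (hds : d ≤ 2 * s) (hD : D ≤ m * (m - 1) * (n - 1) * n)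
    (hP : P = m * (m - 1) * (n - 1) * n * s) (hc1 : 1 ≤ c) (hc : c ≤ 3 / 2)
    (hc2 : (2 * c + 1) * (m - 1) ≤ 3 * m) (hc3 : (2 + 2 * c) * (m - 1) ≤ 4 * m - 1)
    (hH : 0 ≤ H) (hq : 0 ≤ q) (hδ : 0 ≤ δ) (hW : 0 < W) {Λ : ℝ}
    (hΛ : Λ = δ + (2 * (n - 1) + 2 * n * c) * (d * H) + (c + 1 / 2) * q +
      d * ((2 * n + 2 * n * c) * Real.log n + 2 * Real.log m))
    (hWΛ : W ≤ Λ / 2 + q + 2)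
    (hB : B ≤ D * Λ + (P + 1) * Real.log W + 27 * P * Real.log P + 69 * P) :
    4 + Real.log m + 2 * Real.log P + 2 * (B + 1) + 5 * Real.log (2 * n) + 5 * H ≤
      14 * n ^ 3 * s * m ^ 3 * Real.log (6 * n * s) + 2 * m ^ 2 * n ^ 2 * δ +
        3 * m ^ 2 * n ^ 2 * q + 8 * m ^ 2 * n ^ 3 * d * H := by
  have hconst := constant_bound hn hm hs hP
  set D₁ := m * (m - 1) * (n - 1) with hD₁
  have hD₁0 : 0 ≤ D₁ := mul_nonneg (mul_nonneg (by linarith) (by linarith)) (by linarith)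
  have hD₁6 : 6 ≤ D₁ := by
    have h : (3 * 2 : ℝ) * 1 ≤ m * (m - 1) * (n - 1) :=
      mul_le_mul (mul_le_mul hm (by linarith) (by norm_num) (by linarith)) (by linarith)
        (by norm_num) (mul_nonneg (by linarith) (by linarith))
    linarith
  have hP12 : 12 ≤ P := by
    have h : (6 : ℝ) * 2 * 1 ≤ D₁ * n * s :=
      mul_le_mul (mul_le_mul hD₁6 hn (by norm_num) hD₁0) hs (by norm_num)
        (mul_nonneg hD₁0 (by linarith))
    linarith
  have hln : 0 ≤ Real.log n := Real.log_nonneg (by linarith)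
  have hlm : 0 ≤ Real.log m := Real.log_nonneg (by linarith)
  have hnc : 0 ≤ 2 * (n - 1) + 2 * n * c :=
    add_nonneg (by linarith only [hn]) (mul_nonneg (by linarith only [hn]) (by linarith))
  have hΛ0 : 0 ≤ Λ := by
    rw [hΛ]
    have := mul_nonneg hnc (mul_nonneg (by linarith : 0 ≤ d) hH)
    positivity
  have hDΛ : 2 * (D * Λ) ≤ 2 * n * D₁ * Λ := by
    have := mul_le_mul_of_nonneg_right hD hΛ0
    linarith
  set b := 2 * n * s with hb
  have hb0 : 0 < b := by positivity
  have hlogW : Real.log W ≤ W / b + Real.log b - 1 := by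
    have h := Real.log_le_sub_one_of_pos (div_pos hW hb0)
    rw [Real.log_div hW.ne' hb0.ne'] at h
    linarith
  have hlogb : 0 ≤ W / b + Real.log b - 1 := by
    have h := Real.log_le_sub_one_of_pos (inv_pos.2 (div_pos hW hb0))
    have h' := Real.one_sub_inv_le_log_of_pos hb0
    have hb4 : 4 ≤ b := by nlinarith
    have h1 : Real.log 4 ≤ Real.log b := Real.log_le_log (by norm_num) hb4
    have h4 : Real.log 4 = 2 * Real.log 2 := by
      rw [show (4 : ℝ) = 2 ^ 2 by norm_num, Real.log_pow]; push_cast; ring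
    have := Real.log_two_gt_d9
    have : 0 ≤ W / b := by positivity
    linarith
  have hW1 : 2 * ((P + 1) * Real.log W) ≤ 13 / 6 * P * (W / b + Real.log b - 1) := by
    have h1 := mul_le_mul_of_nonneg_left hlogW (by linarith : 0 ≤ P + 1)
    have h2 := mul_le_mul_of_nonneg_right (by linarith : 2 * (P + 1) ≤ 13 / 6 * P) hlogb
    linarith
  have hW2 : 13 / 6 * P * (W / b) ≤
      13 / 12 * D₁ * (Λ / 2 + q) + 13 / 6 * P * (1 / (n * s)) := by
    have h1 : 13 / 6 * P * (W / b) ≤ 13 / 6 * P * ((Λ / 2 + q + 2) / b) := by gcongr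
    have h2 : 13 / 6 * P * ((Λ / 2 + q + 2) / b) =
        13 / 12 * D₁ * (Λ / 2 + q) + 13 / 6 * P * (1 / (n * s)) := by
      rw [hP, hb]; field_simp; ring
    linarith
  have k1 := mul_le_mul_of_nonneg_right (discr_coeff_le hn hm) hδ
  have k2 := mul_le_mul_of_nonneg_right (norm_coeff_le hn hm hc2) hq
  have k3 := mul_le_mul_of_nonneg_right (height_coeff_le hn hm hd hc3) hH
  have k4 : (2 * n + 13 / 24) * D₁ * (d * ((2 * n + 2 * n * c) * Real.log n + 2 * Real.log m)) ≤
      109 / 24 * P * (5 * n * Real.log n + 2 * Real.log m) := by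
    have h1 : (2 * n + 2 * n * c) * Real.log n + 2 * Real.log m ≤
        5 * n * Real.log n + 2 * Real.log m := by
      have := mul_le_mul_of_nonneg_right (by nlinarith : 2 * n + 2 * n * c ≤ 5 * n) hln
      linarith
    have h2 : (2 * n + 13 / 24) * D₁ * d ≤ 109 / 24 * P := by
      have a1 : (2 * n + 13 / 24) * D₁ ≤ (109 / 48 * n) * D₁ :=
        mul_le_mul_of_nonneg_right (by linarith) hD₁0
      have a2 := mul_le_mul a1 hds (by linarith) (by positivity)
      rw [hP]; linarith
    have h3 := mul_le_mul h2 h1 (by positivity) (by positivity)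
    linarith
  rw [← hD₁] at k1 k2 k3
  have hexp : (2 * n + 13 / 24) * D₁ * Λ = (2 * n + 13 / 24) * D₁ * δ +
      (2 * n + 13 / 24) * D₁ * ((2 * (n - 1) + 2 * n * c) * d) * H +
      (2 * n + 13 / 24) * D₁ * (c + 1 / 2) * q +
      (2 * n + 13 / 24) * D₁ * (d * ((2 * n + 2 * n * c) * Real.log n + 2 * Real.log m)) := by
    rw [hΛ]; ring
  linarith

end Numerics

section Closeness

lemma closeExp_le {P : ℝ} (hP : 0 < P) : closeExp P ≤ 29.9 + 12 * Real.log P := by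
  obtain ⟨_, h3⟩ := log_three_bounds
  have h2 := Real.log_two_lt_d9
  have e1 : Real.log (18 * P ^ 2) = Real.log 2 + 2 * Real.log 3 + 2 * Real.log P := by
    rw [show (18 : ℝ) = 2 * 3 ^ 2 by norm_num, Real.log_mul (by norm_num) (by positivity),
      Real.log_mul (by norm_num) (by norm_num), Real.log_pow, Real.log_pow]
    push_cast; ring
  have e2 : Real.log (36 * P ^ 2) = 2 * Real.log 2 + 2 * Real.log 3 + 2 * Real.log P := by
    rw [show (36 : ℝ) = 2 ^ 2 * 3 ^ 2 by norm_num, Real.log_mul (by norm_num) (by positivity),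
      Real.log_mul (by norm_num) (by norm_num), Real.log_pow, Real.log_pow, Real.log_pow]
    push_cast; ring
  rw [closeExp, e1, e2]
  linarith

lemma closeness_le_exp {P W W₀ g l lw X : ℝ} {σ d : ℕ} (hP : 12 ≤ P) (hσ : (σ : ℝ) ≤ P)
    (hd : g = d) (hg1 : 1 ≤ g) (hg : g ≤ 2 * P) (hW : 1 ≤ W) (hWW : W ≤ W₀)
    (hl : 2 * l = lw + 2) {q : ℝ} (hX : lw + q ≤ X) :
    Real.exp (2 * l) * 2 ^ d * (5 * W / (1 / (108 * P ^ 3))) ^ σ *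
      (120 * (g * W + 1) * Real.exp q * Real.exp (g * closeExp P)) ≤
    Real.exp (X + (P + 1) * Real.log W₀ + 27 * P * Real.log P + 69 * P) := by
  obtain ⟨h3l, h3⟩ := log_three_bounds
  have h2 := Real.log_two_lt_d9
  have hP0 : 0 < P := by linarith
  have hlP : 0 ≤ Real.log P := Real.log_nonneg (by linarith)
  have hlW : 0 ≤ Real.log W := Real.log_nonneg hW
  have hlWW : Real.log W ≤ Real.log W₀ := Real.log_le_log (by linarith) hWW
  have e1 : 5 * W / (1 / (108 * P ^ 3)) = 540 * P ^ 3 * W := by field_simp; ring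
  have hc1 : Real.log 540 ≤ 6 * Real.log 2 + 2 * Real.log 3 := by
    refine (Real.log_le_log (by norm_num) (by norm_num : (540 : ℝ) ≤ 2 ^ 6 * 3 ^ 2)).trans_eq ?_
    rw [Real.log_mul (by norm_num) (by norm_num), Real.log_pow, Real.log_pow]; push_cast; ring
  have hc2 : Real.log 300 ≤ 2 * Real.log 2 + 4 * Real.log 3 := by
    refine (Real.log_le_log (by norm_num) (by norm_num : (300 : ℝ) ≤ 2 ^ 2 * 3 ^ 4)).trans_eq ?_
    rw [Real.log_mul (by norm_num) (by norm_num), Real.log_pow, Real.log_pow]; push_cast; ring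
  have hc3 : Real.log P ≤ P / 12 - 1 + (2 * Real.log 2 + Real.log 3) := by
    have h := Real.log_le_sub_one_of_pos (show 0 < P / 12 by positivity)
    rw [Real.log_div (by positivity) (by norm_num), show (12 : ℝ) = 2 ^ 2 * 3 by norm_num,
      Real.log_mul (by norm_num) (by norm_num), Real.log_pow] at h
    push_cast at h
    linarith
  have f1 : (540 * P ^ 3 * W) ^ σ ≤
      Real.exp (P * (Real.log 540 + 3 * Real.log P + Real.log W)) := by
    rw [← Real.log_le_iff_le_exp (by positivity), Real.log_pow, Real.log_mul (by positivity)
      (by positivity), Real.log_mul (by positivity) (by positivity), Real.log_pow]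
    have : 0 ≤ Real.log 540 := Real.log_nonneg (by norm_num)
    push_cast
    exact mul_le_mul_of_nonneg_right hσ (by positivity)
  have f2 : 120 * (g * W + 1) ≤ Real.exp (Real.log 300 + Real.log P + Real.log W) := by
    rw [Real.exp_add, Real.exp_add, Real.exp_log (by norm_num), Real.exp_log hP0,
      Real.exp_log (by linarith)]
    have := mul_le_mul_of_nonneg_right hg (by linarith : 0 ≤ W)
    nlinarith
  have f3 : (2 : ℝ) ^ d ≤ Real.exp (2 * P * Real.log 2) := by
    rw [← Real.log_le_iff_le_exp (by positivity), Real.log_pow, ← hd]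
    exact mul_le_mul_of_nonneg_right hg (Real.log_nonneg (by norm_num))
  have f4 : Real.exp (g * closeExp P) ≤ Real.exp (2 * P * (29.9 + 12 * Real.log P)) := by
    rw [Real.exp_le_exp]
    refine (mul_le_mul_of_nonneg_left (closeExp_le hP0) (by linarith)).trans ?_
    exact mul_le_mul_of_nonneg_right hg (by positivity)
  rw [e1]
  calc _ ≤ Real.exp (2 * l) * Real.exp (2 * P * Real.log 2) *
      Real.exp (P * (Real.log 540 + 3 * Real.log P + Real.log W)) *
      (Real.exp (Real.log 300 + Real.log P + Real.log W) * Real.exp q *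
        Real.exp (2 * P * (29.9 + 12 * Real.log P))) := by gcongr
    _ ≤ _ := by
      simp only [← Real.exp_add]
      rw [Real.exp_le_exp]
      have a1 := mul_le_mul_of_nonneg_left hlWW (by linarith : 0 ≤ P + 1)
      have a2 := mul_le_mul_of_nonneg_left hc1 hP0.le
      have a3 := mul_le_mul_of_nonneg_left h2.le hP0.le
      have a4 := mul_le_mul_of_nonneg_left h3 hP0.le
      linarith

end Closeness

/-- The logarithm of the bound for the heights of the solutions. -/
def logBound (n m s d δ q H : ℝ) : ℝ :=
  14 * n ^ 3 * s * m ^ 3 * Real.log (6 * n * s) + 2 * m ^ 2 * n ^ 2 * δ +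
    3 * m ^ 2 * n ^ 2 * q + 8 * m ^ 2 * n ^ 3 * d * H

namespace Datum

set_option maxHeartbeats 1000000 in
lemma wHeight_x_mul_le {n m : ℕ} {L : Type} [Field L] [NumberField L] (d : Datum n m L)
    (hn : 2 ≤ n) (hm : 3 ≤ m) {c : ℝ} (hc : IsKummerConst m c) (hc1 : 1 ≤ c) (hc0 : c ≤ 3 / 2)
    (hc2 : (2 * c + 1) * (m - 1) ≤ 3 * m) (hc3 : (2 + 2 * c) * (m - 1) ≤ 4 * m - 1)
    {s : ℕ} (hs : d.S.card ≤ s) (hs1 : 1 ≤ s) (hds : Module.finrank ℚ L ≤ 2 * s)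
    {H q : ℝ} (hH : 0 ≤ H) (hμ : ∑ᶠ v, d.μ v ≤ Module.finrank ℚ L * H)
    (hq : ∑ v ∈ d.S, lq v ≤ q) :
    wHeight d.x * (2 * n * (1 + H)) ≤ Real.exp (logBound n m s (Module.finrank ℚ L)
      (Real.log |(NumberField.discr L : ℝ)|) q H) := by
  obtain ⟨K, _, _, d', D, ζ, α, β, ρ, ho, hD, hζ, hαβ, hα, hβ, hρ, hΔ⟩ :=
    d.exists_extension hn hm hc hc1
  have hn' : (2 : ℝ) ≤ n := by exact_mod_cast hn
  have hm' : (3 : ℝ) ≤ m := by exact_mod_cast hm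
  have hs' : (1 : ℝ) ≤ s := by exact_mod_cast hs1
  have hq0 : 0 ≤ ∑ v ∈ d.S, lq v := Finset.sum_nonneg fun v _ => lq_nonneg v
  have hq0' : 0 ≤ q := hq0.trans hq
  have hdL : (1 : ℝ) ≤ Module.finrank ℚ L := one_le_finrank
  have hds' : (Module.finrank ℚ L : ℝ) ≤ 2 * s := by exact_mod_cast hds
  have hδ := Real.log_nonneg (one_le_abs_discr L)
  have hfin := ho.finrank_eq
  have hgK : (1 : ℝ) ≤ Module.finrank ℚ K := one_le_finrank
  have hgKL : (Module.finrank ℚ K : ℝ) = D * Module.finrank ℚ L := by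
    rw [hfin]; push_cast; ring
  have hD1 : 1 ≤ D := by
    rcases Nat.eq_zero_or_pos D with h | h
    · rw [h] at hgKL; simp at hgKL
      have := Module.finrank_pos (R := ℚ) (M := K)
      omega
    · exact h
  have hD1' : (1 : ℝ) ≤ D := by exact_mod_cast hD1
  set P : ℕ := m * (m - 1) * (n - 1) * n * s with hPdef
  have hPr : (P : ℝ) = m * (m - 1) * (n - 1) * n * s := by
    rw [hPdef]; push_cast [Nat.cast_sub (by omega : 1 ≤ m), Nat.cast_sub (by omega : 1 ≤ n)]; ring
  have hDr : (D : ℝ) ≤ m * (m - 1) * (n - 1) * n := by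
    have : (D : ℝ) ≤ (m * (m - 1) * (n - 1) * n : ℕ) := by exact_mod_cast hD
    rwa [Nat.cast_mul, Nat.cast_mul, Nat.cast_mul, Nat.cast_sub (by omega : 1 ≤ m),
      Nat.cast_sub (by omega : 1 ≤ n), Nat.cast_one] at this
  have hP12 : 12 ≤ P := by
    have h1 : 3 * 2 * 1 * 2 * 1 ≤ m * (m - 1) * (n - 1) * n * s :=
      Nat.mul_le_mul (Nat.mul_le_mul (Nat.mul_le_mul (Nat.mul_le_mul hm (by omega)) (by omega)) hn)
        hs1
    omega
  have hP12' : (12 : ℝ) ≤ P := by exact_mod_cast hP12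
  have hSP : d'.S.card ≤ P := ho.card_le.trans (Nat.mul_le_mul hD hs)
  have hgP : (Module.finrank ℚ K : ℝ) ≤ 2 * P := by
    rw [hgKL, hPr]
    have := mul_le_mul hDr hds' (by linarith) (by linarith)
    linarith
  set gL : ℝ := (Module.finrank ℚ L : ℝ) with hgL
  set gK : ℝ := (Module.finrank ℚ K : ℝ) with hgK'
  set δ : ℝ := Real.log |(NumberField.discr L : ℝ)| with hδdef
  set Λ : ℝ := δ + (2 * (n - 1) + 2 * n * c) * (gL * H) + (c + 1 / 2) * q +
      gL * ((2 * n + 2 * n * c) * Real.log n + 2 * Real.log m) with hΛ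
  have hln : 0 ≤ Real.log n := Real.log_natCast_nonneg n
  have hlm : 0 ≤ Real.log m := Real.log_natCast_nonneg m
  have hnc : 0 ≤ 2 * ((n : ℝ) - 1) + 2 * n * c :=
    add_nonneg (by linarith) (mul_nonneg (by positivity) (by linarith))
  have hΔ' : ∀ w ∈ d'.S, Real.log |(NumberField.discr K : ℝ)| + lq w ≤ D * Λ := by
    intro w hw
    refine (hΔ w hw).trans (mul_le_mul_of_nonneg_left ?_ (by linarith))
    have h1 := mul_le_mul_of_nonneg_left hμ
      hnc
    have h2 := mul_le_mul_of_nonneg_left hq (show 0 ≤ c + 1 / 2 by linarith)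
    linarith
  have hΛ0 : 0 ≤ Λ := by
    positivity
  have hδK := Real.log_nonneg (one_le_abs_discr K)
  obtain ⟨w₀⟩ : Nonempty (InfinitePlace K) := inferInstance
  have hΔ0 := hΔ' _ (d'.inf_mem w₀)
  have hW1 := one_le_cellScale d'.S
  have hW : cellScale d'.S ≤ Λ / 2 + q + 2 := by
    have h1 : halfLogDiscr K + ∑ v ∈ d'.S, lq v ≤ gK * (Λ / 2 + q + 1) := by
      have a1 := ho.sum_lq
      have a2 := mul_le_mul_of_nonneg_left hq (by linarith : (0 : ℝ) ≤ D)
      have a3 := lq_nonneg (.inl w₀ : Pl K)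
      have a4 : D * (Λ / 2 + q) ≤ gK * (Λ / 2 + q) := by
        rw [hgKL]
        refine mul_le_mul_of_nonneg_right ?_ (by positivity)
        exact le_mul_of_one_le_right (by linarith) hdL
      unfold halfLogDiscr
      linarith
    have h2 := (div_le_iff₀' (by linarith : 0 < gK)).2 h1
    unfold cellScale
    linarith
  set B : ℝ := D * Λ + (P + 1) * Real.log (Λ / 2 + q + 2) + 27 * P * Real.log P + 69 * P with hB
  have hlP0 : 0 ≤ Real.log P := Real.log_natCast_nonneg P
  have hlW0 : 0 ≤ Real.log (Λ / 2 + q + 2) := Real.log_nonneg (by linarith)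
  set N0 : ℕ := ⌈Real.exp B⌉₊ with hN0
  have hN0ge : Real.exp B ≤ N0 := Nat.le_ceil _
  have hN0le : (N0 : ℝ) ≤ Real.exp (B + 1) := by
    have h1 := (Nat.ceil_lt_add_one (Real.exp_pos B).le).le
    have hB0 : 0 ≤ B := by positivity
    have h2 := Real.one_le_exp hB0
    have h3 := Real.exp_one_gt_d9
    have h4 : 2 * Real.exp B ≤ Real.exp 1 * Real.exp B :=
      mul_le_mul_of_nonneg_right (by linarith) (by linarith)
    rw [Real.exp_add, mul_comm]
    linarith
  have hN0P : 10 ^ 7 * P ^ 2 ≤ N0 := by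
    have h : (10 : ℝ) ^ 7 * P ^ 2 ≤ Real.exp B := by
      rw [← Real.log_le_iff_le_exp (by positivity), Real.log_mul (by positivity) (by positivity),
        Real.log_pow, Real.log_pow]
      have h1 : Real.log 10 ≤ 10 - 1 := Real.log_le_sub_one_of_pos (by norm_num)
      have h2 : 2 * Real.log P ≤ 27 * P * Real.log P :=
        mul_le_mul_of_nonneg_right (by linarith) hlP0
      have h3 : 0 ≤ D * Λ + (P + 1) * Real.log (Λ / 2 + q + 2) := by positivity
      push_cast
      linarith
    exact_mod_cast h.trans hN0ge
  set E : ℝ := 4 * Real.log (2 * n) + 4 * H with hE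
  have hl2n : Real.log (2 * n) = Real.log 2 + Real.log n := by
    rw [Real.log_mul (by norm_num) (by positivity)]
  have hE0 : 0 ≤ E := by
    have := Real.log_nonneg (show (1 : ℝ) ≤ 2 * n by linarith)
    positivity
  have hroot : ∀ γ, ev n d'.a γ = 0 → HH γ ≤ gK * Real.log n + gK * H := by
    intro γ hγ
    refine (HH_root_le (by omega) d'.lead_ne hγ d'.FS_μ d'.coeff_le).trans ?_
    have h := mul_le_mul_of_nonneg_left hμ (by linarith : (0 : ℝ) ≤ D)
    rw [ho.sum_μ, ← hgK', hgKL]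
    linarith
  have hcore := HH_le_of_root_of_ratio d'.inf_mem hP12 hSP hm hζ hαβ (d'.ne_root hα)
    (d'.ne_root hβ) hρ d'.x_le (E := E) (by
      have h1 := hroot α hα
      have h2 := hroot β hβ
      rw [hE, hl2n]
      linarith) hN0P fun w hw => (closeness_le_exp hP12' (by exact_mod_cast hSP) rfl hgK hgP hW1 hW
        (by unfold halfLogDiscr; ring) (hΔ' w hw)).trans hN0ge
  rw [ho.HH_x, HH_eq, ← hgL, ← hgK', hgKL] at hcore
  have hh : wHeight d.x ≤ 51 * m * P ^ 2 * N0 * (N0 + E) := by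
    refine le_of_mul_le_mul_left ?_ (show 0 < D * gL by positivity)
    linarith
  have htot := log_total_le hn' hm' hs' hdL hds' hDr hPr hc1 hc0 hc2 hc3 hH hq0' hδ
    (by linarith : 0 < Λ / 2 + q + 2) hΛ le_rfl hB.le
  have hN01 : (1 : ℝ) ≤ N0 := by
    have : (0 : ℝ) < N0 := (Real.exp_pos B).trans_le hN0ge
    exact_mod_cast this
  have hNE : N0 + E ≤ Real.exp (B + 1) * Real.exp E := by
    have h1 := Real.add_one_le_exp E
    have h2 : N0 + E ≤ N0 * (E + 1) := by
      have h := le_mul_of_one_le_left hE0 hN01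
      linarith only [h]
    exact h2.trans (mul_le_mul hN0le h1 (by linarith) (Real.exp_pos _).le)
  have h51 : 51 * m * (P : ℝ) ^ 2 ≤ Real.exp (4 + Real.log m + 2 * Real.log P) := by
    have h4 : (51 : ℝ) ≤ Real.exp 4 := by
      rw [show (4 : ℝ) = (4 : ℕ) * 1 by norm_num, Real.exp_nat_mul]
      have := Real.exp_one_gt_d9
      calc (51 : ℝ) ≤ 2.718 ^ 4 := by norm_num
        _ ≤ _ := by gcongr; linarith
    rw [Real.exp_add, Real.exp_add, Real.exp_log (by positivity), two_mul, Real.exp_add,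
      Real.exp_log (by positivity), ← sq]
    gcongr
  have h2n : 2 * n * (1 + H) ≤ Real.exp (Real.log (2 * n) + H) := by
    rw [Real.exp_add, Real.exp_log (by positivity)]
    have := Real.add_one_le_exp H
    gcongr
    linarith
  calc wHeight d.x * (2 * n * (1 + H))
      ≤ (Real.exp (4 + Real.log m + 2 * Real.log P) * Real.exp (B + 1) *
          (Real.exp (B + 1) * Real.exp E)) * Real.exp (Real.log (2 * n) + H) := by
        refine mul_le_mul (hh.trans ?_) h2n (by positivity) (by positivity)
        gcongr
    _ ≤ _ := by
      simp only [← Real.exp_add]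
      rw [Real.exp_le_exp, logBound]
      linarith

end Datum

section CoefficientSize

variable {L : Type} [Field L] [NumberField L]

/-- The local contribution at a place to `hhat`. -/
def coeffSize (n : ℕ) (δ : L) (a : ℕ → L) : Pl L → ℝ
  | .inl w => (w.mult : ℝ) *
      Real.log (max 1 (max (w δ)
        ((Finset.range (n + 1)).sup'
          (Finset.nonempty_range_iff.mpr (Nat.succ_ne_zero n)) fun j => w (a j))))
  | .inr v => ((max 0 (-(min (ordAt v δ)
        ((Finset.range (n + 1)).inf'
          (Finset.nonempty_range_iff.mpr (Nat.succ_ne_zero n)) fun j => ordAt v (a j)))) : ℤ) : ℝ) *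
        Real.log (Ideal.absNorm v.asIdeal)

variable {n : ℕ} {δ : L} {a : ℕ → L}

lemma coeffSize_nonneg (v : Pl L) : 0 ≤ coeffSize n δ a v := by
  rcases v with w | p
  · exact mul_nonneg (Nat.cast_nonneg _) (log_max_one_nonneg _)
  · exact mul_nonneg (by exact_mod_cast le_max_left _ _) (log_norm_pos p).le

lemma coeffSize_inr_eq_zero {p : HeightOneSpectrum (𝓞 L)} (hδ : 0 ≤ ordAt p δ)
    (ha : ∀ j ≤ n, 0 ≤ ordAt p (a j)) : coeffSize n δ a (.inr p) = 0 := by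
  have h : 0 ≤ (Finset.range (n + 1)).inf'
      (Finset.nonempty_range_iff.mpr (Nat.succ_ne_zero n)) fun j => ordAt p (a j) :=
    (Finset.le_inf'_iff _ _).2 fun j hj => ha j (Nat.lt_succ_iff.1 (Finset.mem_range.1 hj))
  rw [coeffSize, max_eq_left (by simp [hδ, h]), Int.cast_zero, zero_mul]

lemma finsum_coeffSize (h : FS (coeffSize n δ a)) :
    ∑ᶠ v, coeffSize n δ a v = Module.finrank ℚ L * hhat n δ a := by
  rw [finsum_eq_split h, hhat, mul_div_cancel₀]
  · rfl
  · exact_mod_cast (Module.finrank_pos (R := ℚ) (M := L)).ne'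

lemma log_av_inl_le {w : InfinitePlace L} {x : L} {B : ℝ} (h : w x ≤ B) :
    Real.log (av (.inl w) x) ≤ w.mult * Real.log (max 1 B) := by
  change Real.log (w x ^ w.mult) ≤ _
  rw [Real.log_pow]
  refine mul_le_mul_of_nonneg_left ?_ (Nat.cast_nonneg _)
  rcases (apply_nonneg w x).eq_or_lt with h0 | h0
  · rw [← h0, Real.log_zero]; exact log_max_one_nonneg _
  · exact Real.log_le_log h0 (h.trans (le_max_right _ _))

lemma log_av_inr_le {p : HeightOneSpectrum (𝓞 L)} {x : L} {k : ℤ} (h : k ≤ ordAt p x) :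
    Real.log (av (.inr p) x) ≤ ((max 0 (-k) : ℤ) : ℝ) * Real.log (Ideal.absNorm p.asIdeal) := by
  have hN := (log_norm_pos p).le
  rcases eq_or_ne x 0 with rfl | hx
  · rw [map_zero, Real.log_zero]
    exact mul_nonneg (by exact_mod_cast le_max_left _ _) hN
  · rw [log_av_inr p hx]
    refine mul_le_mul_of_nonneg_right ?_ hN
    exact_mod_cast (neg_le_neg h).trans (le_max_right _ _)

lemma log_av_le_coeffSize {j : ℕ} (hj : j ≤ n) (v : Pl L) :
    Real.log (av v (a j)) ≤ coeffSize n δ a v := by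
  have hj' : j ∈ Finset.range (n + 1) := Finset.mem_range.2 (Nat.lt_succ_of_le hj)
  rcases v with w | p
  · exact log_av_inl_le ((Finset.le_sup' (fun j => w (a j)) hj').trans (le_max_right _ _))
  · exact log_av_inr_le ((min_le_right _ _).trans (Finset.inf'_le (fun j => ordAt p (a j)) hj'))

lemma log_av_le_coeffSize' (v : Pl L) : Real.log (av v δ) ≤ coeffSize n δ a v := by
  rcases v with w | p
  · exact log_av_inl_le (le_max_left _ _)
  · exact log_av_inr_le (min_le_left _ _)

end CoefficientSize

section Solution

variable {L : Type} [Field L] [NumberField L] {n : ℕ} {a : ℕ → L} {μ : Pl L → ℝ}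

lemma log_av_ev_le (hμ0 : ∀ v, 0 ≤ μ v) (ha : ∀ j ≤ n, ∀ v, Real.log (av v (a j)) ≤ μ v)
    (x : L) (v : Pl L) :
    Real.log (av v (ev n a x)) ≤ cc v * Real.log (n + 1 : ℕ) + μ v + n * lp v x := by
  have hl := lp_nonneg v x
  have hnn : 0 ≤ cc v * Real.log (n + 1 : ℕ) + μ v + n * lp v x := by
    have := Real.log_natCast_nonneg (n + 1)
    have := hμ0 v
    positivity
  rcases eq_or_ne (ev n a x) 0 with h0 | h0
  · rwa [h0, map_zero, Real.log_zero]
  rw [Real.log_le_iff_le_exp (av_pos v h0)]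
  refine (av_sum_le v _ _ (Real.exp_pos (μ v + n * lp v x)).le fun j hj => ?_).trans_eq ?_
  · have hj' := Nat.lt_succ_iff.1 (Finset.mem_range.1 hj)
    rw [map_mul, map_pow, Real.exp_add, Real.exp_nat_mul]
    have h1 : av v (a j) ≤ Real.exp (μ v) := by
      rcases eq_or_ne (a j) 0 with h | h
      · rw [h, map_zero]; exact (Real.exp_pos _).le
      · exact (Real.log_le_iff_le_exp (av_pos v h)).1 (ha j hj' v)
    have h2 : av v x ^ (n - j) ≤ Real.exp (lp v x) ^ n :=
      (pow_le_pow_left₀ (av_nonneg _ _) (av_le_exp_lp v x) _).trans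
        (pow_le_pow_right₀ (Real.one_le_exp hl) (Nat.sub_le _ _))
    exact mul_le_mul h1 h2 (pow_nonneg (av_nonneg _ _) _) (Real.exp_pos _).le
  · rw [Finset.card_range, add_assoc, Real.exp_add (_ * _), Real.exp_nat_mul (Real.log _),
      Real.exp_log (by exact_mod_cast n.succ_pos)]

lemma mul_wHeight_le {δ y x : L} {m : ℕ} {H : ℝ} (hδ : δ ≠ 0) (heq : ev n a x = δ * y ^ m)
    (hF : FS μ) (hμ0 : ∀ v, 0 ≤ μ v) (ha : ∀ j ≤ n, ∀ v, Real.log (av v (a j)) ≤ μ v)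
    (hδμ : ∀ v, Real.log (av v δ) ≤ μ v) (hμ : ∑ᶠ v, μ v = Module.finrank ℚ L * H) :
    m * wHeight y ≤ Real.log (n + 1 : ℕ) + H + n * wHeight x := by
  have hy : y ^ m = ev n a x / δ := by rw [heq, mul_div_cancel_left₀ _ hδ]
  have hF1 := FS_cc_mul (K := L) (Real.log (n + 1 : ℕ))
  have hF2 := (FS_lp x).mul_left' n
  have h := HH_div_le hδ ((hF1.add' hF).add' hF2)
    (fun v => Or.inl (log_av_ev_le hμ0 ha x v)) fun v => (hδμ v).trans <| by
      have h1 : 0 ≤ n * lp v x := mul_nonneg (Nat.cast_nonneg _) (lp_nonneg _ _)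
      have h2 : 0 ≤ cc v * Real.log (n + 1 : ℕ) :=
        mul_nonneg (Nat.cast_nonneg _) (Real.log_natCast_nonneg _)
      linarith
  rw [← hy, HH_pow, finsum_add_distrib (hF1.add' hF) hF2, finsum_add_distrib hF1 hF, sum_cc_mul,
    ← mul_finsum, finsum_lp, hμ, HH_eq, HH_eq] at h
  have hg : (0 : ℝ) < Module.finrank ℚ L := by
    exact_mod_cast Module.finrank_pos (R := ℚ) (M := L)
  refine le_of_mul_le_mul_left ?_ hg
  linarith

lemma finrank_le_two_mul_card : Module.finrank ℚ L ≤ 2 * Fintype.card (InfinitePlace L) := by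
  rw [← InfinitePlace.sum_mult_eq, mul_comm]
  refine (Finset.sum_le_card_nsmul Finset.univ _ 2 fun w _ => ?_).trans_eq (by simp)
  unfold InfinitePlace.mult
  split_ifs <;> omega

end Solution

section Bound

variable {n m m' s d δ q H : ℝ}

lemma logBound_mono (hn : 1 ≤ n) (hs : 1 ≤ s) (hd : 0 ≤ d) (hδ : 0 ≤ δ) (hq : 0 ≤ q) (hH : 0 ≤ H)
    (hm : 0 ≤ m') (hmm : m' ≤ m) : logBound n m' s d δ q H ≤ logBound n m s d δ q H := by
  have : 0 ≤ Real.log (6 * n * s) := Real.log_nonneg (by nlinarith)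
  unfold logBound
  gcongr

lemma two_mul_le_exp_logBound (hn : 2 ≤ n) (hm : 3 ≤ m) (hs : 1 ≤ s) (hd : 1 ≤ d) (hδ : 0 ≤ δ)
    (hq : 0 ≤ q) (hH : 0 ≤ H) : 2 * n * (1 + H) ≤ Real.exp (logBound n m s d δ q H) := by
  have hl : Real.log (2 * n) ≤ Real.log (6 * n * s) :=
    Real.log_le_log (by positivity) (by nlinarith)
  have hl0 : 0 ≤ Real.log (2 * n) := Real.log_nonneg (by linarith)
  have h1 : 1 ≤ 14 * n ^ 3 * s * m ^ 3 := by
    calc (1 : ℝ) ≤ 14 * 2 ^ 3 * 1 * 3 ^ 3 := by norm_num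
      _ ≤ _ := by gcongr
  have h2 : 1 ≤ 8 * m ^ 2 * n ^ 3 * d := by
    calc (1 : ℝ) ≤ 8 * 3 ^ 2 * 2 ^ 3 * 1 := by norm_num
      _ ≤ _ := by gcongr
  have h3 : Real.log (2 * n) + H ≤ logBound n m s d δ q H := by
    have a1 : Real.log (2 * n) ≤ 14 * n ^ 3 * s * m ^ 3 * Real.log (6 * n * s) :=
      hl.trans (le_mul_of_one_le_left (hl0.trans hl) h1)
    have a2 : H ≤ 8 * m ^ 2 * n ^ 3 * d * H := le_mul_of_one_le_left hH h2
    have a3 : 0 ≤ 2 * m ^ 2 * n ^ 2 * δ := by positivity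
    have a4 : 0 ≤ 3 * m ^ 2 * n ^ 2 * q := by positivity
    unfold logBound
    linarith
  calc 2 * n * (1 + H) ≤ Real.exp (Real.log (2 * n)) * Real.exp H := by
        rw [Real.exp_log (by positivity)]
        have := Real.add_one_le_exp H
        gcongr
        linarith
    _ ≤ _ := by rw [← Real.exp_add]; exact Real.exp_le_exp.2 h3

lemma exp_logBound {n m s : ℕ} (hn : 2 ≤ n) (hs : 1 ≤ s) {Δ Q d H : ℝ} (hΔ : 0 < Δ) (hQ : 0 < Q) :
    Real.exp (logBound n m s d (Real.log Δ) (Real.log Q) H) =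
      ((6 * (n : ℝ) * s) ^ (14 * n ^ 3 * s)) ^ (m ^ 3) * Δ ^ (2 * m ^ 2 * n ^ 2) *
        Q ^ (3 * m ^ 2 * n ^ 2) * Real.exp (8 * (m : ℝ) ^ 2 * (n : ℝ) ^ 3 * d * H) := by
  have hb : (0 : ℝ) < 6 * n * s := by
    have : (0 : ℝ) < n := by exact_mod_cast (by omega : 0 < n)
    have : (0 : ℝ) < s := by exact_mod_cast hs
    positivity
  rw [logBound, Real.exp_add, Real.exp_add, Real.exp_add]
  congr 1
  congr 1
  congr 1
  · rw [← pow_mul, ← Real.exp_log (pow_pos hb _), Real.log_pow]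
    push_cast
    ring_nf
  · rw [← Real.exp_log (pow_pos hΔ _), Real.log_pow]
    push_cast
    ring_nf
  · rw [← Real.exp_log (pow_pos hQ _), Real.log_pow]
    push_cast
    ring_nf

end Bound

section Main

lemma exists_dvd_isKummerConst {m : ℕ} (hm : 3 ≤ m) : ∃ (k l : ℕ) (c : ℝ), m = l * k ∧ 3 ≤ k ∧
    IsKummerConst k c ∧ 1 ≤ c ∧ c ≤ 3 / 2 ∧ (2 * c + 1) * ((k : ℝ) - 1) ≤ 3 * k ∧
    (2 + 2 * c) * ((k : ℝ) - 1) ≤ 4 * k - 1 := by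
  rcases Nat.four_dvd_or_exists_odd_prime_and_dvd_of_two_lt hm with ⟨l, rfl⟩ | ⟨p, hp, ⟨l, rfl⟩, ho⟩
  · exact ⟨4, l, 3 / 2, mul_comm _ _, by norm_num, isKummerConst_four, by norm_num, le_rfl,
      by norm_num, by norm_num⟩
  · have hp3 : 3 ≤ p := by
      have := hp.two_le
      rcases ho with ⟨r, hr⟩
      omega
    exact ⟨p, l, 1, mul_comm _ _, hp3, isKummerConst_of_prime hp, le_rfl, by norm_num,
      by linarith, by linarith⟩

variable {L : Type} [Field L] [NumberField L]

/-- The places of a finite set of primes together with all infinite places. -/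
def placesOf (T : Finset (HeightOneSpectrum (𝓞 L))) : Finset (Pl L) := Finset.univ.disjSum T

lemma inr_mem_placesOf {T : Finset (HeightOneSpectrum (𝓞 L))} {p} :
    .inr p ∈ placesOf T ↔ p ∈ T := Finset.inr_mem_disjSum

lemma exists_inr_of_notMem_placesOf {T : Finset (HeightOneSpectrum (𝓞 L))} {v : Pl L}
    (hv : v ∉ placesOf T) : ∃ p, v = .inr p ∧ p ∉ T := by
  rcases v with w | p
  · exact absurd (Finset.inl_mem_disjSum.2 (Finset.mem_univ w)) hv
  · exact ⟨p, rfl, fun h => hv (inr_mem_placesOf.2 h)⟩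

lemma sum_lq_placesOf_le {T : Finset (HeightOneSpectrum (𝓞 L))} {Q : ℕ}
    (hQ : (T = ∅ ∧ Q = 2) ∨ (T.Nonempty ∧ Q = Ideal.absNorm (∏ v ∈ T, v.asIdeal))) :
    ∑ v ∈ placesOf T, lq v ≤ Real.log Q := by
  have h : ∑ v ∈ placesOf T, lq v = ∑ p ∈ T, Real.log (Ideal.absNorm p.asIdeal) := by
    rw [placesOf, Finset.sum_disjSum]
    simp [lq]
  rw [h]
  rcases hQ with ⟨rfl, rfl⟩ | ⟨-, rfl⟩
  · simpa using Real.log_nonneg one_le_two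
  · rw [map_prod, Nat.cast_prod, Real.log_prod fun p _ hp => ?_]
    have := log_norm_pos p
    rw [hp, Real.log_zero] at this
    exact this.false

lemma natCast_pos_of_eq_two_or_absNorm {T : Finset (HeightOneSpectrum (𝓞 L))} {Q : ℕ}
    (hQ : (T = ∅ ∧ Q = 2) ∨ (T.Nonempty ∧ Q = Ideal.absNorm (∏ v ∈ T, v.asIdeal))) :
    (0 : ℝ) < Q := by
  rcases hQ with ⟨-, rfl⟩ | ⟨-, rfl⟩
  · norm_num
  · rw [Nat.cast_pos, Nat.pos_iff_ne_zero, Ne, Ideal.absNorm_eq_zero_iff, ← Ideal.zero_eq_bot,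
      Finset.prod_eq_zero_iff]
    rintro ⟨p, -, hp⟩
    exact p.ne_bot hp

variable {n m : ℕ} {a : ℕ → L} {δ x y : L} {T : Finset (HeightOneSpectrum (𝓞 L))} {q : ℝ}

lemma coeffSize_eq_zero_of_notMem (hδ : ∀ p ∉ T, 0 ≤ ordAt p δ)
    (ha : ∀ j ≤ n, ∀ p ∉ T, 0 ≤ ordAt p (a j)) {v : Pl L} (hv : v ∉ placesOf T) :
    coeffSize n δ a v = 0 := by
  obtain ⟨p, rfl, hp⟩ := exists_inr_of_notMem_placesOf hv
  exact coeffSize_inr_eq_zero (hδ p hp) fun j hj => ha j hj p hp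

lemma FS_coeffSize (hδ : ∀ p ∉ T, 0 ≤ ordAt p δ)
    (ha : ∀ j ≤ n, ∀ p ∉ T, 0 ≤ ordAt p (a j)) : FS (coeffSize n δ a) :=
  (placesOf T).finite_toSet.subset fun _ hv =>
    by_contra fun h => hv (coeffSize_eq_zero_of_notMem hδ ha h)

lemma hhat_nonneg (h : FS (coeffSize n δ a)) : 0 ≤ hhat n δ a := by
  have h1 := finsum_coeffSize h
  have h2 : 0 ≤ ∑ᶠ v, coeffSize n δ a v := finsum_nonneg coeffSize_nonneg
  rw [h1] at h2
  exact nonneg_of_mul_nonneg_right h2 (by exact_mod_cast Module.finrank_pos (R := ℚ) (M := L))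

lemma wHeight_mul_le_of_ne_zero (hn : 2 ≤ n) (hm : 3 ≤ m) (ha0 : a 0 ≠ 0) (hdisc : binDisc n a ≠ 0)
    (ha : ∀ j ≤ n, ∀ p ∉ T, 0 ≤ ordAt p (a j)) (hδ0 : δ ≠ 0) (hδ : ∀ p ∉ T, 0 ≤ ordAt p δ)
    (hx : ∀ p ∉ T, 0 ≤ ordAt p x) (hy0 : y ≠ 0) (heq : ev n a x = δ * y ^ m)
    (hq : ∑ v ∈ placesOf T, lq v ≤ q) (hq0 : 0 ≤ q) :
    wHeight x * (2 * n * (1 + hhat n δ a)) ≤ Real.exp (logBound n m (placesOf T).card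
      (Module.finrank ℚ L) (Real.log |(discr L : ℝ)|) q (hhat n δ a)) := by
  obtain ⟨k, l, c, rfl, hk, hc, hc1, hc0, hc2, hc3⟩ := exists_dvd_isKummerConst hm
  have hF := FS_coeffSize hδ ha
  have hS1 : Fintype.card (InfinitePlace L) ≤ (placesOf T).card := by
    simp [placesOf, Finset.card_disjSum]
  have hS2 : 1 ≤ (placesOf T).card := hS1.trans' Fintype.card_pos
  let D : Datum n k L :=
    { a := a, δ := δ, x := x, y := y ^ l, S := placesOf T, μ := coeffSize n δ a
      inf_mem := fun w => Finset.inl_mem_disjSum.2 (Finset.mem_univ w)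
      lead_ne := ha0, disc_ne := hdisc, δ_ne := hδ0, y_ne := pow_ne_zero _ hy0
      μ_nonneg := coeffSize_nonneg
      μ_off := fun v hv => coeffSize_eq_zero_of_notMem hδ ha hv
      coeff_le := fun j hj v => log_av_le_coeffSize hj v
      δ_le := log_av_le_coeffSize'
      x_le := fun v hv => by
        obtain ⟨p, rfl, hp⟩ := exists_inr_of_notMem_placesOf hv
        exact (av_inr_le_one p).2 (hx p hp)
      eq := by rw [heq, pow_mul] }
  refine (D.wHeight_x_mul_le hn hk hc hc1 hc0 hc2 hc3 le_rfl hS2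
    (finrank_le_two_mul_card.trans (Nat.mul_le_mul_left 2 hS1)) (hhat_nonneg hF)
    (finsum_coeffSize hF).le hq).trans (Real.exp_le_exp.2 ?_)
  refine logBound_mono (by exact_mod_cast one_le_two.trans hn) (by exact_mod_cast hS2)
    (Nat.cast_nonneg _) (Real.log_nonneg (one_le_abs_discr L)) hq0 (hhat_nonneg hF)
    (Nat.cast_nonneg _) ?_
  exact_mod_cast Nat.le_mul_of_pos_left k (Nat.pos_of_ne_zero fun h => by simp [h] at hm)

theorem max_wHeight_le (hn : 2 ≤ n) (hm : 3 ≤ m) (ha0 : a 0 ≠ 0) (hdisc : binDisc n a ≠ 0)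
    (ha : ∀ j ≤ n, ∀ p ∉ T, 0 ≤ ordAt p (a j)) (hδ0 : δ ≠ 0) (hδ : ∀ p ∉ T, 0 ≤ ordAt p δ)
    (hx : ∀ p ∉ T, 0 ≤ ordAt p x) (heq : ev n a x = δ * y ^ m)
    (hq : ∑ v ∈ placesOf T, lq v ≤ q) (hq0 : 0 ≤ q) :
    max (wHeight x) (wHeight y) ≤ Real.exp (logBound n m (placesOf T).card
      (Module.finrank ℚ L) (Real.log |(discr L : ℝ)|) q (hhat n δ a)) := by
  have hF := FS_coeffSize hδ ha
  have hH := hhat_nonneg hF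
  have hn' : (2 : ℝ) ≤ n := by exact_mod_cast hn
  have hm' : (3 : ℝ) ≤ m := by exact_mod_cast hm
  have hg : (0 : ℝ) < Module.finrank ℚ L := by
    exact_mod_cast Module.finrank_pos (R := ℚ) (M := L)
  have hwn (z : L) : 0 ≤ wHeight z := nonneg_of_mul_nonneg_right ((HH_eq z) ▸ HH_nonneg z) hg
  have hS : 1 ≤ (placesOf T).card := by
    have : 0 < Fintype.card (InfinitePlace L) := Fintype.card_pos
    rw [placesOf, Finset.card_disjSum, Finset.card_univ]
    omega
  have hX := two_mul_le_exp_logBound (n := n) (m := m) (s := (placesOf T).card)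
    (d := Module.finrank ℚ L) (δ := Real.log |(discr L : ℝ)|) (q := q) hn' hm'
    (by exact_mod_cast hS) (by exact_mod_cast hg) (Real.log_nonneg (one_le_abs_discr L)) hq0 hH
  have hnH : 0 ≤ n * hhat n δ a := by positivity
  rcases eq_or_ne y 0 with rfl | hy0
  · have h := HH_root_le (one_le_two.trans hn) ha0
      (by rw [heq, zero_pow (by omega), mul_zero]) hF (fun j hj v => log_av_le_coeffSize hj v)
    rw [HH_eq, finsum_coeffSize hF, ← mul_add] at h
    have h1 := le_of_mul_le_mul_left h hg
    have h2 := Real.log_le_self (by linarith : (0 : ℝ) ≤ n)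
    have h3 : wHeight (0 : L) = 0 := by
      have := HH_eq (0 : L)
      simpa [HH, lp, hg.ne'] using this
    rw [h3]
    refine max_le (le_trans ?_ hX) (Real.exp_pos _).le
    nlinarith
  · have h := wHeight_mul_le_of_ne_zero hn hm ha0 hdisc ha hδ0 hδ hx hy0 heq hq hq0
    have hmul := mul_wHeight_le hδ0 heq hF coeffSize_nonneg
      (fun j hj v => log_av_le_coeffSize hj v) log_av_le_coeffSize' (finsum_coeffSize hF)
    have h1 : 2 * (n * wHeight x) ≤ wHeight x * (2 * n * (1 + hhat n δ a)) := by
      have := mul_nonneg (hwn x) hnH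
      linarith
    have h2 := Real.log_le_sub_one_of_pos (show (0 : ℝ) < (n + 1 : ℕ) by positivity)
    push_cast at h2 hmul
    have h3 : 2 * wHeight x ≤ n * wHeight x := mul_le_mul_of_nonneg_right hn' (hwn x)
    have h4 : 3 * wHeight y ≤ m * wHeight y := mul_le_mul_of_nonneg_right hm' (hwn y)
    have h5 := hwn x
    have h6 : 2 * hhat n δ a ≤ n * hhat n δ a := mul_le_mul_of_nonneg_right hn' hH
    refine max_le ?_ ?_ <;> linarith

end Main

end SuperElliptic

/-- **Proposition 6.4** (Theorem 2.1 of Bérczes–Evertse–Győry): effective bounds for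
superelliptic equations over the `S`-integers of a number field. -/
theorem superelliptic_number_field_bound
    (L : Type) [Field L] [NumberField L]
    (T : Finset (HeightOneSpectrum (𝓞 L)))
    (s : ℕ) (hs : s = T.card + Fintype.card (InfinitePlace L))
    (Q : ℕ)
    (hQ : (T = ∅ ∧ Q = 2) ∨
      (T.Nonempty ∧ Q = Ideal.absNorm (∏ v ∈ T, v.asIdeal)))
    (n m : ℕ) (hn : 2 ≤ n) (hm : 3 ≤ m)
    (a : ℕ → L) (ha0 : a 0 ≠ 0) (hdisc : binDisc n a ≠ 0)
    (haS : ∀ i, i ≤ n → ∀ v : HeightOneSpectrum (𝓞 L), v ∉ T → 0 ≤ ordAt v (a i))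
    (δ : L) (hδ0 : δ ≠ 0)
    (hδS : ∀ v : HeightOneSpectrum (𝓞 L), v ∉ T → 0 ≤ ordAt v δ)
    (x y : L)
    (hx : ∀ v : HeightOneSpectrum (𝓞 L), v ∉ T → 0 ≤ ordAt v x)
    (hy : ∀ v : HeightOneSpectrum (𝓞 L), v ∉ T → 0 ≤ ordAt v y)
    (heq : (∑ j ∈ Finset.range (n + 1), a j * x ^ (n - j)) = δ * y ^ m) :
    max (wHeight x) (wHeight y) ≤
      ((6 * (n : ℝ) * s) ^ (14 * n ^ 3 * s)) ^ (m ^ 3) *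
        ((|NumberField.discr L| : ℤ) : ℝ) ^ (2 * m ^ 2 * n ^ 2) *
        (Q : ℝ) ^ (3 * m ^ 2 * n ^ 2) *
        Real.exp (8 * (m : ℝ) ^ 2 * (n : ℝ) ^ 3 * (Module.finrank ℚ L : ℝ) *
          hhat n δ a) := by
  rw [show ((|NumberField.discr L| : ℤ) : ℝ) = |(NumberField.discr L : ℝ)| from Int.cast_abs]
  have hcard : (SuperElliptic.placesOf T).card = s := by
    rw [SuperElliptic.placesOf, Finset.card_disjSum, Finset.card_univ, hs, add_comm]
  have hs1 : 1 ≤ s := by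
    have : 0 < Fintype.card (InfinitePlace L) := Fintype.card_pos
    omega
  have hQ0 := SuperElliptic.natCast_pos_of_eq_two_or_absNorm hQ
  have h := SuperElliptic.max_wHeight_le hn hm ha0 hdisc haS hδ0 hδS hx heq
    (SuperElliptic.sum_lq_placesOf_le hQ) (Real.log_nonneg (by exact_mod_cast hQ0))
  rwa [hcard, SuperElliptic.exp_logBound hn hs1
    (one_pos.trans_le (SuperElliptic.one_le_abs_discr L)) hQ0] at h
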